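/- Let q be a fixed prime power. Then lim_{n→∞} U_n / q^{n²+n} = ∏_{i ≥ 1, i odd} (1 - q^{-i})^{-1} · ∏_{i ≥ 2, i even} (1 - q^{-i})^{-⌊i/4⌋}, where the infinite products converge. -/

import Mathlib

open Matrix

/-- `U_n`: the number of ordered pairs of commuting elements of the Lie algebra
`gu(n,q) = {A : A* = -A}` of skew-Hermitian `n × n` matrices over the field `K` with `q²`
elements, where `A*` is the conjugate-transpose `(A.map (·^q))ᵀ`. -/
noncomputable def guCommPairs (q : ℕ) (K : Type) [Field K] [Fintype K] (n : ℕ) : ℕ :=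
  Nat.card {P : Matrix (Fin n) (Fin n) K × Matrix (Fin n) (Fin n) K //
    (P.1.map (fun a => a ^ q))ᵀ = -P.1 ∧ (P.2.map (fun a => a ^ q))ᵀ = -P.2 ∧
    P.1 * P.2 = P.2 * P.1}

section file_PA1
open Finset Filter Topology
namespace FFU

/-- `poch Q k = ∏_{j<k} (1 - (-1/Q)^(j+1))` -/
noncomputable def poch (Q : ℝ) (k : ℕ) : ℝ := ∏ j ∈ Finset.range k, (1 - (-Q⁻¹) ^ (j + 1))

section A
variable {Q : ℝ}

lemma abs_t_le (hQ : 2 ≤ Q) : |(-Q⁻¹)| ≤ 1 / 2 := by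
  rw [abs_neg, abs_of_pos (by positivity), one_div]
  exact inv_anti₀ (by norm_num) hQ

lemma abs_t_pow_le (hQ : 2 ≤ Q) (j : ℕ) : |(-Q⁻¹) ^ (j + 1)| ≤ 1 / 2 := by
  rw [abs_pow, pow_succ]
  have := abs_t_le hQ
  have h0 := abs_nonneg (-Q⁻¹)
  have : |(-Q⁻¹)| ^ j ≤ 1 := pow_le_one₀ h0 (by linarith)
  nlinarith [pow_nonneg h0 j]

lemma fac_pos (hQ : 2 ≤ Q) (j : ℕ) : 0 < 1 - (-Q⁻¹) ^ (j + 1) := by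
  have := (abs_le.1 (abs_t_pow_le hQ j)).2
  linarith

lemma poch_pos (hQ : 2 ≤ Q) (k : ℕ) : 0 < poch Q k :=
  Finset.prod_pos fun j _ => fac_pos hQ j

lemma poch_succ (k : ℕ) : poch Q (k + 1) = poch Q k * (1 - (-Q⁻¹) ^ (k + 1)) := by
  simp [poch, Finset.prod_range_succ]

lemma poch_zero : poch Q 0 = 1 := by simp [poch]

lemma poch_tendsto (hQ : 2 ≤ Q) : ∃ c : ℝ, 0 < c ∧ Tendsto (poch Q) atTop (𝓝 c) := by
  have hs : Summable (fun j : ℕ => ‖-((-Q⁻¹) ^ (j + 1))‖) := by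
    have : Summable (fun j : ℕ => |(-Q⁻¹)| ^ (j+1)) :=
      (summable_nat_add_iff 1).2 (summable_geometric_of_lt_one (abs_nonneg _)
        (lt_of_le_of_lt (abs_t_le hQ) (by norm_num)))
    simpa [abs_pow] using this
  have hm := Real.multipliable_one_add_of_summable hs.of_norm
  have h0 := tprod_one_add_ne_zero_of_summable (f := fun j : ℕ => -((-Q⁻¹) ^ (j + 1)))
    (fun i => by have := fac_pos hQ i; rw [← sub_eq_add_neg]; exact this.ne') hs
  have ht := hm.hasProd.tendsto_prod_nat
  have ht' : Tendsto (poch Q) atTop (𝓝 (∏' i : ℕ, (1 + -((-Q⁻¹) ^ (i + 1))))) := by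
    refine ht.congr fun n => ?_
    simp [poch, sub_eq_add_neg]
  refine ⟨_, lt_of_le_of_ne ?_ (Ne.symm h0), ht'⟩
  exact ge_of_tendsto' ht' fun n => (poch_pos hQ n).le

lemma poch_bounds (hQ : 2 ≤ Q) : ∃ a b : ℝ, 0 < a ∧ 0 < b ∧ ∀ n, a ≤ poch Q n ∧ poch Q n ≤ b := by
  obtain ⟨c, hc, ht⟩ := poch_tendsto hQ
  obtain ⟨b, hb⟩ := ht.bddAbove_range
  obtain ⟨a, ha⟩ := (ht.inv₀ hc.ne').bddAbove_range
  have hb' : ∀ n, poch Q n ≤ b := fun n => hb ⟨n, rfl⟩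
  have ha' : ∀ n, (poch Q n)⁻¹ ≤ a := fun n => ha ⟨n, rfl⟩
  have a0 : 0 < a := lt_of_lt_of_le (inv_pos.2 (poch_pos hQ 0)) (ha' 0)
  refine ⟨a⁻¹, b, inv_pos.2 a0, lt_of_lt_of_le (poch_pos hQ 0) (hb' 0), fun n => ⟨?_, hb' n⟩⟩
  exact inv_le_of_inv_le₀ (poch_pos hQ n) (ha' n)

/-! ### sums over finitely supported functions -/

lemma hasSum_finsupp_support (a : ℕ → ℕ → ℝ) (h0 : ∀ k j, 0 ≤ a k j) (h1 : ∀ k, a k 0 = 1)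
    (hs : ∀ k, Summable (a k)) (S : Finset ℕ) :
    HasSum (fun m : {m : ℕ →₀ ℕ // m.support ⊆ S} => m.1.prod a) (∏ k ∈ S, ∑' j, a k j) := by
  classical
  induction S using Finset.induction_on with
  | empty =>
    have : Unique {m : ℕ →₀ ℕ // m.support ⊆ ∅} :=
      ⟨⟨⟨0, by simp⟩⟩, fun m => Subtype.ext (by simpa using m.2)⟩
    have hu := hasSum_unique (fun m : {m : ℕ →₀ ℕ // m.support ⊆ ∅} => m.1.prod a)
    have h : (default : {m : ℕ →₀ ℕ // m.support ⊆ ∅}).1 = 0 := by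
      simpa using (default : {m : ℕ →₀ ℕ // m.support ⊆ ∅}).2
    simpa [h] using hu
  | insert k S hk ih =>
    rw [Finset.prod_insert hk]
    have hp0 : ∀ m : ℕ →₀ ℕ, 0 ≤ m.prod a := fun m => Finset.prod_nonneg fun i _ => h0 _ _
    have hsum := (hs k).hasSum.mul ih ((hs k).mul_of_nonneg ih.summable (fun j => h0 k j)
      (fun m => hp0 m.1))
    let e : {m : ℕ →₀ ℕ // m.support ⊆ insert k S} ≃ ℕ × {m : ℕ →₀ ℕ // m.support ⊆ S} :=
      { toFun := fun m => (m.1 k, ⟨m.1.erase k, by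
          intro x hx
          rw [Finsupp.support_erase, Finset.mem_erase] at hx
          exact (Finset.mem_insert.1 (m.2 hx.2)).resolve_left hx.1⟩)
        invFun := fun p => ⟨p.2.1.update k p.1, by
          intro x hx
          rw [Finset.mem_insert]
          by_cases hxk : x = k
          · exact Or.inl hxk
          · right
            apply p.2.2
            simpa [Finsupp.update_apply, hxk] using hx⟩
        left_inv := fun m => by
          ext x; by_cases hxk : x = k <;> simp [hxk]
        right_inv := fun p => by
          refine Prod.ext (by simp) (Subtype.ext ?_)
          ext x; by_cases hxk : x = k
          · subst hxk
            have : x ∉ p.2.1.support := fun h => hk (p.2.2 h)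
            simpa using (Finsupp.notMem_support_iff.1 this).symm
          · simp [hxk] }
    rw [← e.hasSum_iff] at hsum
    refine hsum.congr_fun ?_
    intro m
    exact (Finsupp.mul_prod_erase' m.1 k a (fun i => h1 i)).symm

lemma hasSum_finsupp_prod (a : ℕ → ℕ → ℝ) (h0 : ∀ k j, 0 ≤ a k j) (h1 : ∀ k, a k 0 = 1)
    (hs : ∀ k, Summable (a k)) (c : ℝ) (hc : HasProd (fun k => ∑' j, a k j) c) :
    HasSum (fun m : ℕ →₀ ℕ => m.prod a) c := by
  classical
  have hp0 : ∀ m : ℕ →₀ ℕ, 0 ≤ m.prod a := fun m => Finset.prod_nonneg fun i _ => h0 _ _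
  have hA1 : ∀ k, 1 ≤ ∑' j, a k j := fun k => by
    rw [← h1 k]; exact (hs k).le_tsum 0 (fun j _ => h0 k j)
  have hle : ∀ S : Finset ℕ, ∏ k ∈ S, ∑' j, a k j ≤ c := fun S =>
    ge_of_tendsto hc (by
      filter_upwards [Filter.eventually_ge_atTop S] with T hT
      exact Finset.prod_le_prod_of_subset_of_one_le hT
        (fun i _ => le_trans zero_le_one (hA1 i)) (fun i _ _ => hA1 i))
  have key : ∀ u : Finset (ℕ →₀ ℕ), ∑ m ∈ u, m.prod a ≤ c := by
    intro u
    refine le_trans ?_ (hle (u.biUnion Finsupp.support))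
    have hS := hasSum_finsupp_support a h0 h1 hs (u.biUnion Finsupp.support)
    have := sum_le_hasSum (u.subtype fun m => m.support ⊆ u.biUnion Finsupp.support)
      (fun m _ => hp0 m.1) hS
    rw [Finset.sum_subtype_of_mem (fun m : ℕ →₀ ℕ => m.prod a)] at this
    · exact this
    · intro m hm
      exact Finset.subset_biUnion_of_mem Finsupp.support hm
  have hsum : Summable (fun m : ℕ →₀ ℕ => m.prod a) := summable_of_sum_le hp0 key
  have : ∑' m : ℕ →₀ ℕ, m.prod a = c := by
    apply le_antisymm
    · exact hsum.tsum_le_of_sum_le key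
    · refine le_of_tendsto' hc fun S => ?_
      rw [← (hasSum_finsupp_support a h0 h1 hs S).tsum_eq]
      exact hsum.tsum_subtype_le (fun m : ℕ →₀ ℕ => m.prod a) {m | m.support ⊆ S} hp0
  rw [← this]; exact hsum.hasSum

end A
end FFU

end file_PA1

section file_PA2
open Finset Filter Topology
namespace FFU
section A
variable {Q : ℝ}

lemma phi_summable (hQ : 2 ≤ Q) {v : ℝ} (hv : |v| ≤ 1 / 2) :
    Summable fun j : ℕ => v ^ j / poch Q j := by
  obtain ⟨a, b, ha, hb, h⟩ := poch_bounds hQ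
  have hg : Summable (fun j : ℕ => |v| ^ j * a⁻¹) :=
    (summable_geometric_of_lt_one (abs_nonneg v) (by linarith)).mul_right _
  refine Summable.of_norm_bounded hg fun j => ?_
  rw [norm_div, norm_pow, Real.norm_eq_abs, Real.norm_eq_abs, abs_of_pos (poch_pos hQ j),
    div_eq_mul_inv]
  gcongr
  exact (h j).1

noncomputable def phi (Q v : ℝ) : ℝ := ∑' j : ℕ, v ^ j / poch Q j

lemma phi_rec (hQ : 2 ≤ Q) {v : ℝ} (hv : |v| ≤ 1 / 2) :
    phi Q v * (1 - v) = phi Q ((-Q⁻¹) * v) := by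
  have hs := phi_summable hQ hv
  have htv : |(-Q⁻¹) * v| ≤ 1 / 2 := by
    rw [abs_mul]
    have := abs_t_le hQ
    nlinarith [abs_nonneg v, abs_nonneg (-Q⁻¹)]
  have hs' := phi_summable hQ htv
  have e1 : phi Q v * v = ∑' j : ℕ, v ^ (j + 1) / poch Q j := by
    rw [phi, ← tsum_mul_right]; congr 1; funext j; ring
  have hs1 : Summable fun j : ℕ => v ^ (j + 1) / poch Q j := by
    refine (hs.mul_right v).congr fun j => ?_
    ring
  rw [mul_sub, mul_one, e1, phi, phi, hs.tsum_eq_zero_add, hs'.tsum_eq_zero_add, add_sub_assoc,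
    ← Summable.tsum_sub ((summable_nat_add_iff 1).2 hs) hs1]
  simp only [pow_zero, add_right_inj]
  congr 1; funext j
  rw [poch_succ]
  have h1 := (poch_pos hQ j).ne'
  have h2 := (fac_pos hQ j).ne'
  rw [mul_pow]
  generalize (-Q⁻¹) ^ (j + 1) = u at *
  field_simp
  ring

lemma abs_tpow_le (hQ : 2 ≤ Q) {v : ℝ} (hv : |v| ≤ 1 / 2) (N : ℕ) :
    |(-Q⁻¹) ^ N * v| ≤ 1 / 2 := by
  rw [abs_mul, abs_pow]
  have := abs_t_le hQ
  have h0 := abs_nonneg (-Q⁻¹)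
  have : |(-Q⁻¹)| ^ N ≤ 1 := pow_le_one₀ h0 (by linarith)
  nlinarith [abs_nonneg v, pow_nonneg h0 N]

lemma phi_prod (hQ : 2 ≤ Q) {v : ℝ} (hv : |v| ≤ 1 / 2) (N : ℕ) :
    phi Q v = phi Q ((-Q⁻¹) ^ N * v) * ∏ l ∈ Finset.range N, (1 - (-Q⁻¹) ^ l * v)⁻¹ := by
  induction N with
  | zero => simp
  | succ N ih =>
    have hN := abs_tpow_le hQ hv N
    have hne : 1 - (-Q⁻¹) ^ N * v ≠ 0 := by
      have := (abs_le.1 hN).2; linarith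
    rw [ih, Finset.prod_range_succ, pow_succ', mul_assoc (-Q⁻¹), ← phi_rec hQ hN]
    generalize phi Q ((-Q⁻¹) ^ N * v) = A
    generalize ∏ l ∈ Finset.range N, (1 - (-Q⁻¹) ^ l * v)⁻¹ = B
    generalize 1 - (-Q⁻¹) ^ N * v = u at hne ⊢
    field_simp

lemma phi_tendsto (hQ : 2 ≤ Q) {v : ℝ} (hv : |v| ≤ 1 / 2) :
    Tendsto (fun N : ℕ => phi Q ((-Q⁻¹) ^ N * v)) atTop (𝓝 1) := by
  have h : (1 : ℝ) = ∑' j : ℕ, (if j = 0 then 1 else 0 : ℝ) := by simp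
  obtain ⟨a, b, ha, hb, hab⟩ := poch_bounds hQ
  have hg : Summable (fun j : ℕ => (1 / 2 : ℝ) ^ j * a⁻¹) :=
    (summable_geometric_of_lt_one (by norm_num) (by norm_num)).mul_right _
  rw [h]
  refine tendsto_tsum_of_dominated_convergence hg (fun j => ?_) (Eventually.of_forall fun N j => ?_)
  · have ht : Tendsto (fun N : ℕ => (-Q⁻¹) ^ N * v) atTop (𝓝 0) := by
      have := (tendsto_pow_atTop_nhds_zero_of_abs_lt_one
        (lt_of_le_of_lt (abs_t_le hQ) (by norm_num))).mul_const v
      simpa using this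
    by_cases hj : j = 0
    · subst hj; simp [poch_zero]
    · have := (ht.pow j).div_const (poch Q j)
      simpa [hj] using this
  · rw [norm_div, norm_pow, Real.norm_eq_abs, Real.norm_eq_abs, abs_of_pos (poch_pos hQ j),
      div_eq_mul_inv]
    gcongr
    · exact (inv_pos.2 (poch_pos hQ j)).le
    · exact abs_tpow_le hQ hv N
    · exact (hab j).1

lemma inv_sub_one_bound {x : ℝ} (hx : |x| ≤ 1 / 2) : |(1 - x)⁻¹ - 1| ≤ 2 * |x| := by
  have := (abs_le.1 hx).2
  have h : (1 - x)⁻¹ - 1 = x * (1 - x)⁻¹ := by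
    have : 1 - x ≠ 0 := by linarith
    field_simp; ring
  have h2 : |(1 - x)⁻¹| ≤ 2 := by
    rw [abs_of_pos (inv_pos.2 (by linarith))]
    rw [inv_le_comm₀ (by linarith) (by norm_num)]; linarith
  rw [h, abs_mul]
  nlinarith [abs_nonneg x]

lemma multipliable_inv_sub {ι : Type*} (x : ι → ℝ) (hx : ∀ i, |x i| ≤ 1 / 2)
    (hs : Summable fun i => |x i|) : Multipliable fun i => (1 - x i)⁻¹ := by
  have : Summable fun i => (1 - x i)⁻¹ - 1 :=
    Summable.of_norm_bounded (hs.mul_left 2) fun i => inv_sub_one_bound (hx i)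
  convert Real.multipliable_one_add_of_summable this using 2
  ring

lemma phi_hasProd (hQ : 2 ≤ Q) {v : ℝ} (hv : |v| ≤ 1 / 2) :
    HasProd (fun l : ℕ => (1 - (-Q⁻¹) ^ l * v)⁻¹) (phi Q v) := by
  have hm : Multipliable (fun l : ℕ => (1 - (-Q⁻¹) ^ l * v)⁻¹) := by
    apply multipliable_inv_sub _ (fun l => abs_tpow_le hQ hv l)
    simp only [abs_mul, abs_pow]
    exact (summable_geometric_of_lt_one (abs_nonneg _)
        (lt_of_le_of_lt (abs_t_le hQ) (by norm_num))).mul_right _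
  have h1 := (phi_tendsto hQ hv).mul hm.hasProd.tendsto_prod_nat
  have h2 : Tendsto (fun N : ℕ => phi Q ((-Q⁻¹) ^ N * v) *
      ∏ l ∈ Finset.range N, (1 - (-Q⁻¹) ^ l * v)⁻¹) atTop (𝓝 (phi Q v)) :=
    tendsto_const_nhds.congr fun N => phi_prod hQ hv N
  have := tendsto_nhds_unique h1 h2
  rw [one_mul] at this
  rw [← this]; exact hm.hasProd

lemma abs_v_le (hQ : 2 ≤ Q) (k : ℕ) : |(Q⁻¹) ^ (k + 1)| ≤ 1 / 2 := by
  have := abs_t_pow_le hQ k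
  rwa [abs_pow, abs_neg, ← abs_pow] at this

lemma dbl_multipliable (hQ : 2 ≤ Q) :
    Multipliable fun p : ℕ × ℕ => (1 - (-Q⁻¹) ^ p.2 * (Q⁻¹) ^ (p.1 + 1))⁻¹ := by
  apply multipliable_inv_sub (fun p : ℕ × ℕ => (-Q⁻¹) ^ p.2 * (Q⁻¹) ^ (p.1 + 1))
    (fun p => abs_tpow_le hQ (abs_v_le hQ p.1) p.2)
  have hlt := lt_of_le_of_lt (abs_t_le hQ) (by norm_num : (1/2 : ℝ) < 1)
  have h1 : Summable (fun l : ℕ => |(-Q⁻¹)| ^ l) := summable_geometric_of_lt_one (abs_nonneg _) hlt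
  have h2 : Summable (fun l : ℕ => |(Q⁻¹)| ^ (l + 1)) := by
    rw [abs_neg] at hlt
    exact (summable_nat_add_iff 1).2 (summable_geometric_of_lt_one (abs_nonneg _) hlt)
  have := h2.mul_of_nonneg h1 (fun _ => by positivity) (fun _ => by positivity)
  refine this.congr fun p => ?_
  rw [abs_mul, abs_pow, abs_pow, mul_comm]

lemma inner_prod (y : ℝ) (s : ℕ) : ∏ l ∈ Finset.range (s + 1), (1 - (-1) ^ l * y)⁻¹ =
    (if Even s then (1 - y)⁻¹ else 1) * ((1 - y ^ 2)⁻¹) ^ ((s + 1) / 2) := by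
  induction s using Nat.twoStepInduction with
  | zero => simp
  | one =>
    simp [Finset.prod_range_succ]
    rw [← mul_inv]; congr 1; ring
  | more s ih _ =>
    rw [Finset.prod_range_succ, Finset.prod_range_succ, ih]
    have e : (s + 2 + 1) / 2 = (s + 1) / 2 + 1 := by omega
    have e2 : Even (s + 2) ↔ Even s := by simp [Nat.even_add]
    have e3 : (1 - (-1) ^ (s + 1) * y)⁻¹ * (1 - (-1) ^ (s + 1 + 1) * y)⁻¹ = (1 - y ^ 2)⁻¹ := by
      rw [← mul_inv]; congr 1
      rcases Nat.even_or_odd s with h | h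
      · simp only [pow_succ, h.neg_one_pow]; ring
      · simp only [pow_succ, h.neg_one_pow]; ring
    rw [e, pow_succ, mul_assoc, e3]
    simp only [e2]
    ring

lemma first_multipliable (hQ : 2 ≤ Q) :
    Multipliable (fun j : ℕ => (1 - (Q : ℝ) ^ (-(2 * j + 1 : ℤ)))⁻¹) := by
  have e : ∀ j : ℕ, (Q : ℝ) ^ (-(2 * j + 1 : ℤ)) = Q⁻¹ ^ (2 * j + 1) := fun j => by
    rw [_root_.zpow_neg, inv_pow]; norm_cast
  simp only [e]
  apply multipliable_inv_sub _ (fun j => abs_v_le hQ (2 * j))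
  have hlt := lt_of_le_of_lt (abs_t_le hQ) (by norm_num : (1/2 : ℝ) < 1)
  rw [abs_neg] at hlt
  have h := (summable_nat_add_iff 1).2 (summable_geometric_of_lt_one (abs_nonneg _) hlt)
  simp only [abs_pow]
  exact h.comp_injective (i := fun j : ℕ => 2 * j) (fun a b h => by simpa using h)

lemma second_multipliable (hQ : 2 ≤ Q) :
    Multipliable (fun j : ℕ => ((1 - (Q : ℝ) ^ (-(2 * j + 2 : ℤ)))⁻¹) ^ ((2 * j + 2) / 4)) := by
  have e : ∀ j : ℕ, (Q : ℝ) ^ (-(2 * j + 2 : ℤ)) = Q⁻¹ ^ (2 * j + 1 + 1) := fun j => by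
    rw [_root_.zpow_neg, inv_pow]; norm_cast
  simp only [e]
  have hx : ∀ j : ℕ, 0 < Q⁻¹ ^ (2 * j + 1 + 1) ∧ Q⁻¹ ^ (2 * j + 1 + 1) ≤ 1 / 2 := fun j =>
    ⟨by positivity, (abs_le.1 (abs_v_le hQ (2 * j + 1))).2⟩
  apply Real.multipliable_of_summable_log
  · intro j
    have := hx j
    exact pow_pos (inv_pos.2 (by linarith)) _
  · have hsum : Summable (fun j : ℕ => 2 * (((j : ℝ) ^ 1 * (1 / 4 : ℝ) ^ j) + (1 / 4 : ℝ) ^ j)) :=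
      ((summable_pow_mul_geometric_of_norm_lt_one 1 (by norm_num)).add
        (summable_geometric_of_lt_one (by norm_num) (by norm_num))).mul_left 2
    refine Summable.of_norm_bounded hsum fun j => ?_
    obtain ⟨h1, h2⟩ := hx j
    set x := Q⁻¹ ^ (2 * j + 1 + 1) with hxdef
    have hw : 1 ≤ (1 - x)⁻¹ := by
      rw [one_le_inv₀ (by linarith)]; linarith
    have hlog0 : 0 ≤ Real.log (1 - x)⁻¹ := Real.log_nonneg hw
    have hlog : Real.log (1 - x)⁻¹ ≤ 2 * x := by
      refine (Real.log_le_sub_one_of_pos (by linarith)).trans ?_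
      have := inv_sub_one_bound (x := x) (by rw [abs_of_pos h1]; exact h2)
      rw [abs_of_pos h1] at this
      exact (le_abs_self _).trans this
    have hx4 : x ≤ (1 / 4) ^ j := by
      have : x ≤ (Q⁻¹ ^ 2) ^ j := by
        rw [hxdef, ← pow_mul]
        apply pow_le_pow_of_le_one (by positivity) _ (by omega)
        exact inv_le_one_of_one_le₀ (by linarith)
      refine this.trans ?_
      gcongr
      have : Q⁻¹ ≤ 1 / 2 := by simpa using (abs_le.1 (abs_v_le hQ 0)).2
      have h0 : 0 ≤ Q⁻¹ := by positivity
      nlinarith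
    rw [Real.log_pow, norm_mul, Real.norm_eq_abs, Real.norm_eq_abs, abs_of_nonneg hlog0,
      abs_of_nonneg (by positivity)]
    have hn : (((2 * j + 2) / 4 : ℕ) : ℝ) ≤ j + 1 := by
      have : (2 * j + 2) / 4 ≤ j + 1 := by omega
      exact_mod_cast this
    calc (((2 * j + 2) / 4 : ℕ) : ℝ) * Real.log (1 - x)⁻¹ ≤ (j + 1) * (2 * (1 / 4) ^ j) := by
          gcongr; linarith
      _ = _ := by ring

lemma hasProd_antidiag (f : ℕ × ℕ → ℝ) (D : ℝ) (h : HasProd f D) :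
    HasProd (fun s : ℕ => ∏ p ∈ Finset.HasAntidiagonal.antidiagonal s, f p) D := by
  have h2 : HasProd (fun x : (Σ n : ℕ, Finset.HasAntidiagonal.antidiagonal n) => f x.2.1) D :=
    (Finset.HasAntidiagonal.sigmaAntidiagonalEquivProd (A := ℕ)).hasProd_iff.2 h
  refine h2.sigma (fun s => ?_)
  have := hasProd_fintype (fun c : Finset.HasAntidiagonal.antidiagonal s => f c.1)
  rwa [Finset.prod_coe_sort (Finset.HasAntidiagonal.antidiagonal s) f] at this

lemma antidiag_inner (s : ℕ) :
    ∏ p ∈ Finset.HasAntidiagonal.antidiagonal s, (1 - (-Q⁻¹) ^ p.2 * (Q⁻¹) ^ (p.1 + 1))⁻¹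
      = (if Even s then (1 - Q⁻¹ ^ (s + 1))⁻¹ else 1) *
          ((1 - Q⁻¹ ^ (2 * s + 2))⁻¹) ^ ((s + 1) / 2) := by
  have := inner_prod (Q⁻¹ ^ (s + 1)) s
  rw [← pow_mul, show (s + 1) * 2 = 2 * s + 2 by ring] at this
  rw [← this, ← Finset.prod_range_reflect,
    Finset.Nat.prod_antidiagonal_eq_prod_range_succ_mk]
  refine Finset.prod_congr rfl fun l hl => ?_
  have hl' : l ≤ s := by simpa [Nat.lt_succ_iff] using hl
  obtain ⟨r, rfl⟩ := Nat.exists_eq_add_of_le hl'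
  have e1 : l + r - l = r := by omega
  have e2 : l + r + 1 - 1 - l = r := by omega
  simp only [e1, e2]
  congr 2
  rw [neg_pow]; ring

lemma hasProd_fib (f : ℕ × ℕ → ℝ) (D : ℝ) (h : HasProd f D) (g : ℕ → ℝ)
    (hg : ∀ k, HasProd (fun l => f (k, l)) (g k)) : HasProd g D :=
  h.prod_fiberwise hg

lemma phi_prod_hasProd (hQ : 2 ≤ Q) :
    HasProd (fun k : ℕ => phi Q (Q⁻¹ ^ (k + 1)))
      ((∏' j : ℕ, (1 - (Q : ℝ) ^ (-(2 * j + 1 : ℤ)))⁻¹) *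
        ∏' j : ℕ, ((1 - (Q : ℝ) ^ (-(2 * j + 2 : ℤ)))⁻¹) ^ ((2 * j + 2) / 4)) := by
  obtain ⟨D, hd⟩ := dbl_multipliable hQ
  have h1 : HasProd (fun k : ℕ => phi Q (Q⁻¹ ^ (k + 1))) D :=
    by
    refine hasProd_fib _ D hd _ (fun k => ?_)
    have hk := phi_hasProd hQ (v := Q⁻¹ ^ (k + 1)) (abs_v_le hQ k)
    dsimp only
    exact hk
  have h2 := hasProd_antidiag _ D hd
  simp only [antidiag_inner] at h2
  obtain ⟨X, hX⟩ := first_multipliable hQ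
  obtain ⟨Y, hY⟩ := second_multipliable hQ
  rw [hX.tprod_eq, hY.tprod_eq]
  have h4 : HasProd (fun s : ℕ => if Even s then (1 - Q⁻¹ ^ (s + 1))⁻¹ else (1 : ℝ)) (X * 1) := by
    apply HasProd.even_mul_odd
    · refine hX.congr_fun fun j => ?_
      rw [if_pos (even_two_mul j), _root_.zpow_neg, inv_pow]; norm_cast
    · refine hasProd_one.congr_fun fun j => ?_
      rw [if_neg (by simp)]
  have h5 := h4.mul hY
  rw [mul_one] at h5
  have h6 : D = X * Y := h2.unique (h5.congr_fun fun s => by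
    congr 1
    have e : (2 * s + 2) / 4 = (s + 1) / 2 := by omega
    have e' : (Q : ℝ) ^ (-(2 * s + 2 : ℤ)) = Q⁻¹ ^ (2 * s + 2) := by
      rw [_root_.zpow_neg, inv_pow]; norm_cast
    rw [e, e'])
  rw [← h6]
  exact h1
end A
end FFU

end file_PA2

section file_PA3
open Finset Filter Topology
namespace FFU
section A
variable {Q : ℝ}

/-- weight with shift `c`: `∑ (e + c) m_e`. -/
noncomputable def wt (c : ℕ) (m : ℕ →₀ ℕ) : ℕ := m.sum fun e k => (e + c) * k

noncomputable def consFs (a : ℕ) (m : ℕ →₀ ℕ) : ℕ →₀ ℕ :=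
  Finsupp.single 0 a + m.embDomain ⟨Nat.succ, Nat.succ_injective⟩

noncomputable def tailFs (m : ℕ →₀ ℕ) : ℕ →₀ ℕ := m.comapDomain Nat.succ Nat.succ_injective.injOn

lemma consFs_zero (a m) : consFs a m 0 = a := by
  simp only [consFs, Finsupp.add_apply, Finsupp.single_eq_same]
  rw [Finsupp.embDomain_of_notMem_range]; · simp
  rintro ⟨x, hx⟩; exact Nat.succ_ne_zero x hx

lemma consFs_succ (a m k) : consFs a m (k + 1) = m k := by
  simp only [consFs, Finsupp.add_apply]
  have := Finsupp.embDomain_apply_self ⟨Nat.succ, Nat.succ_injective⟩ m k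
  simp only [Function.Embedding.coeFn_mk, Nat.succ_eq_add_one] at this
  rw [this]; simp

lemma tail_cons (a m) : tailFs (consFs a m) = m := by
  ext k; simp [tailFs, Finsupp.comapDomain_apply, consFs_succ]

lemma cons_tail (m : ℕ →₀ ℕ) : consFs (m 0) (tailFs m) = m := by
  ext k; cases k with
  | zero => rw [consFs_zero]
  | succ k => rw [consFs_succ]; simp [tailFs, Finsupp.comapDomain_apply]

lemma consFs_prod (f : ℕ → ℕ → ℝ) (hf : ∀ i, f i 0 = 1) (a : ℕ) (m : ℕ →₀ ℕ) :
    (consFs a m).prod f = f 0 a * m.prod (fun e => f (e + 1)) := by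
  classical
  rw [consFs, Finsupp.prod_add_index_of_disjoint, Finsupp.prod_single_index (hf 0),
    Finsupp.prod_embDomain]
  · rfl
  · rw [Finset.disjoint_left]
    intro x hx hx2
    have : x = 0 := by simpa using Finsupp.support_single_subset hx
    subst this
    simp at hx2

lemma consFs_wt (a : ℕ) (m : ℕ →₀ ℕ) : wt 1 (consFs a m) = a + wt 2 m := by
  classical
  rw [wt, consFs, Finsupp.sum_add_index', Finsupp.sum_single_index (by simp),
    Finsupp.sum_embDomain]
  · simp only [wt, zero_add, one_mul]; rfl
  · simp
  · intros; ring

noncomputable def wtEquiv (n : ℕ) : {m : ℕ →₀ ℕ // wt 1 m = n} ≃ {m : ℕ →₀ ℕ // wt 2 m ≤ n} where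
  toFun m := ⟨tailFs m.1, by
    have h := m.2
    rw [← cons_tail m.1, consFs_wt] at h; omega⟩
  invFun m := ⟨consFs (n - wt 2 m.1) m.1, by rw [consFs_wt]; have := m.2; omega⟩
  left_inv m := by
    apply Subtype.ext
    have h := m.2
    rw [← cons_tail m.1, consFs_wt] at h
    have : n - wt 2 (tailFs m.1) = m.1 0 := by omega
    simp only [this, cons_tail]
  right_inv m := by
    apply Subtype.ext
    simp only [tail_cons]

noncomputable def partSum (Q : ℝ) (n : ℕ) : ℝ :=
  ∑' m : {m : ℕ →₀ ℕ // wt 1 m = n}, m.1.prod fun _ k => Q ^ k / poch Q k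

noncomputable def aCoef (Q : ℝ) (k j : ℕ) : ℝ := (Q⁻¹ ^ (k + 1)) ^ j / poch Q j

lemma pow_wt (hQ : 0 < Q) (m : ℕ →₀ ℕ) : (m.prod fun _ k => Q ^ k / poch Q k) * Q⁻¹ ^ wt 2 m =
    m.prod (aCoef Q) := by
  rw [wt, Finsupp.sum, ← Finset.prod_pow_eq_pow_sum, Finsupp.prod, Finsupp.prod,
    ← Finset.prod_mul_distrib]
  refine Finset.prod_congr rfl fun e _ => ?_
  rw [aCoef, div_mul_eq_mul_div, ← pow_mul]
  congr 1
  rw [show (e + 2) * m e = (e + 1) * m e + m e by ring, pow_add, mul_comm, mul_assoc, ← mul_pow]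
  rw [inv_mul_cancel₀ hQ.ne']; simp

lemma partSum_eq (hQ : 2 ≤ Q) (n : ℕ) : poch Q n * partSum Q n / Q ^ n =
    ∑' m : ℕ →₀ ℕ, if wt 2 m ≤ n then (poch Q n / poch Q (n - wt 2 m)) * m.prod (aCoef Q) else 0 := by
  have hQ0 : 0 < Q := by linarith
  have : partSum Q n = ∑' m : {m : ℕ →₀ ℕ // wt 2 m ≤ n},
      Q ^ (n - wt 2 m.1) / poch Q (n - wt 2 m.1) * (m.1.prod fun _ k => Q ^ k / poch Q k) := by
    rw [partSum, ← (wtEquiv n).symm.tsum_eq]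
    refine tsum_congr fun m => ?_
    change (consFs (n - wt 2 m.1) m.1).prod _ = _
    rw [consFs_prod _ (fun i => by simp [poch_zero])]
  rw [this, ← tsum_mul_left, ← tsum_div_const]
  have h2 := tsum_subtype {m : ℕ →₀ ℕ | wt 2 m ≤ n}
    (fun m => (poch Q n / poch Q (n - wt 2 m)) * m.prod (aCoef Q))
  refine Eq.trans ?_ (h2.trans (tsum_congr fun m => by simp [Set.indicator_apply]))
  refine tsum_congr fun m => ?_
  have hm : wt 2 m.1 ≤ n := m.2
  rw [← pow_wt hQ0]
  have hp := (poch_pos hQ (n - wt 2 m.1)).ne'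
  obtain ⟨r, hr⟩ := Nat.exists_eq_add_of_le hm
  have e : n - wt 2 m.1 = r := by omega
  rw [e] at hp ⊢
  rw [inv_pow]
  have : Q ^ n = Q ^ (wt 2 m.1) * Q ^ r := by rw [← pow_add, ← hr]
  rw [this]
  field_simp

lemma partSum_tendsto (hQ : 2 ≤ Q) : Tendsto (fun n => poch Q n * partSum Q n / Q ^ n) atTop
    (𝓝 ((∏' j : ℕ, (1 - (Q : ℝ) ^ (-(2 * j + 1 : ℤ)))⁻¹) *
        ∏' j : ℕ, ((1 - (Q : ℝ) ^ (-(2 * j + 2 : ℤ)))⁻¹) ^ ((2 * j + 2) / 4))) := by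
  have hQ0 : 0 < Q := by linarith
  have ha0 : ∀ k j, 0 ≤ aCoef Q k j := fun k j =>
    div_nonneg (by positivity) (poch_pos hQ j).le
  have hs : HasSum (fun m : ℕ →₀ ℕ => m.prod (aCoef Q)) _ :=
    hasSum_finsupp_prod (aCoef Q) ha0 (fun k => by simp [aCoef, poch_zero])
      (fun k => phi_summable hQ (abs_v_le hQ k)) _ (phi_prod_hasProd hQ)
  rw [← hs.tsum_eq]
  simp only [partSum_eq hQ]
  obtain ⟨a, b, ha, hb, hab⟩ := poch_bounds hQ
  obtain ⟨c, hc, htc⟩ := poch_tendsto hQ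
  refine tendsto_tsum_of_dominated_convergence (hs.summable.mul_left (b / a)) (fun m => ?_)
    (Eventually.of_forall fun n m => ?_)
  · have h1 : Tendsto (fun n => poch Q n / poch Q (n - wt 2 m)) atTop (𝓝 (c / c)) :=
      htc.div (htc.comp (tendsto_sub_atTop_nat _)) hc.ne'
    rw [div_self hc.ne'] at h1
    have h2 := h1.mul_const (m.prod (aCoef Q))
    rw [one_mul] at h2
    refine h2.congr' ?_
    filter_upwards [eventually_ge_atTop (wt 2 m)] with n hn
    rw [if_pos hn]
  · have hp : 0 ≤ m.prod (aCoef Q) := Finset.prod_nonneg fun i _ => ha0 _ _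
    split_ifs with h
    · rw [norm_mul, Real.norm_of_nonneg hp, Real.norm_of_nonneg
        (div_nonneg (poch_pos hQ n).le (poch_pos hQ _).le)]
      gcongr
      · exact (hab n).2
      · exact (hab _).1
    · simp only [norm_zero]; positivity
end A
end FFU

end file_PA3

section file_P2a
open Finset
namespace FFU
section W
variable {P : Type} (dg : P → ℕ) (Q : ℝ)

noncomputable def fdeg (ν : P →₀ ℕ) : ℕ := ν.sum fun p k => k * dg p

/-- local weight -/
noncomputable def wloc (d k : ℕ) : ℝ := ∏ j ∈ Finset.range k, (1 - (-Q⁻¹) ^ (d * (j + 1)))⁻¹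

lemma wloc_zero (d : ℕ) : wloc Q d 0 = 1 := by simp [wloc]

variable {Q}
lemma wfac_ne (hQ : 2 ≤ Q) {d : ℕ} (hd : 0 < d) (j : ℕ) : 1 - (-Q⁻¹) ^ (d * (j + 1)) ≠ 0 := by
  obtain ⟨r, hr⟩ : ∃ r, d * (j + 1) = r + 1 := ⟨d * (j + 1) - 1, by
    have : 0 < d * (j + 1) := by positivity
    omega⟩
  rw [hr]; exact (fac_pos hQ r).ne'

lemma wloc_sum (hQ : 2 ≤ Q) {d : ℕ} (hd : 0 < d) (k : ℕ) :
    wloc Q d k = ∑ j ∈ Finset.range (k + 1), (-Q⁻¹) ^ (d * j) * wloc Q d j := by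
  induction k with
  | zero => simp
  | succ k ih =>
    rw [Finset.sum_range_succ, ← ih]
    have h := wfac_ne hQ hd k
    have e : wloc Q d (k + 1) = wloc Q d k * (1 - (-Q⁻¹) ^ (d * (k + 1)))⁻¹ := by
      rw [wloc, Finset.prod_range_succ, wloc]
    rw [e]
    generalize (-Q⁻¹) ^ (d * (k + 1)) = u at h ⊢
    field_simp
    ring

lemma finsupp_prod_sum {ι α : Type} [DecidableEq ι] [Zero α] [DecidableEq α] (s : Finset ι)
    (t : ι → Finset α) (g : ι → α → ℝ) :
    ∑ μ ∈ s.finsupp t, ∏ i ∈ s, g i (μ i) = ∏ i ∈ s, ∑ j ∈ t i, g i j := by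
  rw [Finset.finsupp, Finset.sum_map, Finset.prod_sum]
  refine Finset.sum_congr (by congr!) fun f _ => ?_
  rw [← Finset.prod_attach]
  refine Finset.prod_congr rfl fun i _ => ?_
  congr 1
  simp [Finsupp.indicator_of_mem i.2]

variable (Q) in
noncomputable def wtot (ν : P →₀ ℕ) : ℝ := ν.prod fun p k => wloc Q (dg p) k

lemma fdeg_add (μ ν : P →₀ ℕ) : fdeg dg (μ + ν) = fdeg dg μ + fdeg dg ν := by
  classical
  rw [fdeg, Finsupp.sum_add_index']; · rfl
  · simp
  · intros; ring

lemma wtot_sum [DecidableEq P] (hQ : 2 ≤ Q) (hd : ∀ p, 0 < dg p) (ν : P →₀ ℕ) :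
    wtot dg Q ν = ∑ x ∈ Finset.HasAntidiagonal.antidiagonal ν, (-Q⁻¹) ^ fdeg dg x.1 * wtot dg Q x.1 := by
  have h1 : wtot dg Q ν = ∏ p ∈ ν.support, ∑ j ∈ Finset.range (ν p + 1),
      (-Q⁻¹) ^ (dg p * j) * wloc Q (dg p) j :=
    Finset.prod_congr rfl fun p _ => wloc_sum hQ (hd p) _
  rw [h1, ← finsupp_prod_sum]
  have hmem : ∀ μ : P →₀ ℕ, μ ∈ ν.support.finsupp (fun p => Finset.range (ν p + 1)) ↔ μ ≤ ν := by
    intro μ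
    rw [Finset.mem_finsupp_iff]
    constructor
    · rintro ⟨hs, h⟩ p
      by_cases hp : p ∈ ν.support
      · have := h p hp; simp at this; omega
      · have : p ∉ μ.support := fun h => hp (hs h)
        rw [Finsupp.notMem_support_iff.1 this]; exact Nat.zero_le _
    · intro h
      refine ⟨fun p hp => ?_, fun p hp => ?_⟩
      · have := h p
        rw [Finsupp.mem_support_iff] at hp ⊢; omega
      · have := h p
        simp; omega
  symm
  refine Finset.sum_bij' (fun x _ => x.1) (fun μ _ => (μ, ν - μ)) ?_ ?_ ?_ ?_ ?_
  · intro x hx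
    rw [Finset.HasAntidiagonal.mem_antidiagonal] at hx
    rw [hmem, ← hx]; exact le_self_add
  · intro μ hμ
    rw [hmem] at hμ
    rw [Finset.HasAntidiagonal.mem_antidiagonal]; exact add_tsub_cancel_of_le hμ
  · intro x hx
    rw [Finset.HasAntidiagonal.mem_antidiagonal] at hx
    ext1
    · rfl
    · simp [← hx]
  · intro μ _; rfl
  · intro x hx
    rw [Finset.HasAntidiagonal.mem_antidiagonal] at hx
    have hsub : x.1.support ⊆ ν.support := by
      have := ((hmem x.1).2 (by rw [← hx]; exact le_self_add))
      exact (Finset.mem_finsupp_iff.1 this).1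
    rw [Finset.prod_mul_distrib, wtot, fdeg, Finsupp.prod_of_support_subset _ hsub _
      (fun i _ => wloc_zero Q _), Finsupp.sum_of_support_subset _ hsub _ (fun i _ => by simp),
      Finset.prod_pow_eq_pow_sum]
    congr 2
    exact Finset.sum_congr rfl fun p _ => mul_comm _ _

lemma W_eq (hQ : 2 ≤ Q) (hd : ∀ p, 0 < dg p) (S : ℕ → Finset (P →₀ ℕ))
    (hS : ∀ k ν, ν ∈ S k ↔ fdeg dg ν = k) (hc : ∀ k, ((S k).card : ℝ) = Q ^ k) (m : ℕ) :
    ∑ ν ∈ S m, wtot dg Q ν = Q ^ m / poch Q m := by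
  classical
  have hrec : ∀ m, ∑ ν ∈ S m, wtot dg Q ν =
      ∑ j ∈ Finset.range (m + 1), (-Q⁻¹) ^ j * Q ^ (m - j) * ∑ ν ∈ S j, wtot dg Q ν := by
    intro m
    calc ∑ ν ∈ S m, wtot dg Q ν
        = ∑ ν ∈ S m, ∑ x ∈ Finset.HasAntidiagonal.antidiagonal ν, (-Q⁻¹) ^ fdeg dg x.1 * wtot dg Q x.1 :=
          Finset.sum_congr rfl fun ν _ => wtot_sum dg hQ hd ν
      _ = ∑ y ∈ (Finset.range (m + 1)).sigma (fun j => S j ×ˢ S (m - j)),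
            (-Q⁻¹) ^ fdeg dg y.2.1 * wtot dg Q y.2.1 := by
          rw [Finset.sum_sigma']
          refine Finset.sum_bij' (fun z _ => ⟨fdeg dg z.2.1, z.2⟩)
            (fun y _ => ⟨y.2.1 + y.2.2, y.2⟩) ?_ ?_ ?_ ?_ ?_
          · rintro ⟨ν, x⟩ h
            simp only [Finset.mem_sigma, hS, Finset.HasAntidiagonal.mem_antidiagonal, Finset.mem_range,
              Finset.mem_product] at h ⊢
            have := fdeg_add dg x.1 x.2
            rw [h.2] at this
            refine ⟨by omega, trivial, by omega⟩
          · rintro ⟨j, x⟩ h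
            simp only [Finset.mem_sigma, hS, Finset.HasAntidiagonal.mem_antidiagonal, Finset.mem_range,
              Finset.mem_product, and_true] at h ⊢
            rw [fdeg_add]; omega
          · rintro ⟨ν, x⟩ h
            simp only [Finset.mem_sigma, Finset.HasAntidiagonal.mem_antidiagonal] at h
            simp only [h.2]
          · rintro ⟨j, x⟩ h
            simp only [Finset.mem_sigma, hS, Finset.mem_product] at h
            simp only [h.2.1]
          · rintro ⟨ν, x⟩ h; rfl
      _ = _ := by
          rw [Finset.sum_sigma]
          refine Finset.sum_congr rfl fun j _ => ?_
          rw [Finset.sum_product, Finset.mul_sum]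
          refine Finset.sum_congr rfl fun μ hμ => ?_
          dsimp only
          rw [(hS _ _).1 hμ, Finset.sum_const, nsmul_eq_mul, hc]
          ring
  have hQ0 : Q ≠ 0 := by linarith
  -- the claimed values satisfy the same recursion
  have hval : ∀ m, Q ^ m / poch Q m = ∑ j ∈ Finset.range (m + 1),
      (-Q⁻¹) ^ j * Q ^ (m - j) * (Q ^ j / poch Q j) := by
    intro m
    have h1 : ∀ k, (poch Q k)⁻¹ = wloc Q 1 k := fun k => by
      simp [poch, wloc, Finset.prod_inv_distrib]
    rw [div_eq_mul_inv, h1, wloc_sum hQ one_pos, Finset.mul_sum]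
    refine Finset.sum_congr rfl fun j hj => ?_
    have : j ≤ m := by simpa [Nat.lt_succ_iff] using hj
    rw [div_eq_mul_inv, h1, one_mul]
    have e : Q ^ m = Q ^ (m - j) * Q ^ j := by rw [← pow_add]; congr 1; omega
    rw [e]; ring
  induction m using Nat.strong_induction_on with
  | _ m ih =>
    have h1 := hrec m
    have h2 := hval m
    have hih : ∑ j ∈ Finset.range m, (-Q⁻¹) ^ j * Q ^ (m - j) * ∑ ν ∈ S j, wtot dg Q ν =
        ∑ j ∈ Finset.range m, (-Q⁻¹) ^ j * Q ^ (m - j) * (Q ^ j / poch Q j) :=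
      Finset.sum_congr rfl (fun j hj => by rw [ih j (Finset.mem_range.1 hj)])
    rw [Finset.sum_range_succ, hih] at h1
    rw [Finset.sum_range_succ] at h2
    rcases m with _ | m
    · have hS0 : S 0 = {0} := by
        have hc0 : (S 0).card = 1 := by have := hc 0; simpa using this
        obtain ⟨x, hx⟩ := Finset.card_eq_one.1 hc0
        have : (0 : P →₀ ℕ) ∈ S 0 := by rw [hS]; simp [fdeg]
        rw [hx, Finset.mem_singleton] at this
        rw [hx, this]
      rw [hS0]; simp [wtot, poch_zero]
    · simp only [Nat.sub_self, pow_zero, mul_one] at h1 h2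
      have hne := (fac_pos hQ m).ne'
      generalize (∑ j ∈ Finset.range (m + 1), (-Q⁻¹) ^ j * Q ^ (m + 1 - j) * (Q ^ j / poch Q j)) = A
        at h1 h2
      generalize (-Q⁻¹) ^ (m + 1) = u at h1 h2 hne
      have : (1 - u) * (∑ ν ∈ S (m + 1), wtot dg Q ν) = (1 - u) * (Q ^ (m + 1) / poch Q (m + 1)) := by
        linarith
      exact mul_left_cancel₀ hne this
end W
end FFU

end file_P2a

section file_P2b
open Finset
namespace FFU
section W
variable {P : Type} (dg : P → ℕ) {Q : ℝ}

noncomputable def tdeg (τ : ℕ × P →₀ ℕ) : ℕ := τ.sum fun i k => k * ((i.1 + 1) * dg i.2)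

lemma fdeg_zero : fdeg dg (0 : P →₀ ℕ) = 0 := by simp [fdeg]

lemma fdeg_eq_zero (hd : ∀ p, 0 < dg p) (ν : P →₀ ℕ) : fdeg dg ν = 0 ↔ ν = 0 := by
  constructor
  · intro h
    ext p
    rw [fdeg, Finsupp.sum, Finset.sum_eq_zero_iff] at h
    by_contra hp
    have := h p (Finsupp.mem_support_iff.2 hp)
    have h2 := hd p
    rcases Nat.mul_eq_zero.1 this with h3 | h3
    · exact hp h3
    · omega
  · rintro rfl; exact fdeg_zero dg

noncomputable def degs (T : ℕ →₀ P →₀ ℕ) : ℕ →₀ ℕ := T.mapRange (fdeg dg) (fdeg_zero dg)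

lemma degs_support (hd : ∀ p, 0 < dg p) (T : ℕ →₀ P →₀ ℕ) : (degs dg T).support = T.support := by
  ext e
  simp [degs, Finsupp.mem_support_iff, fdeg_eq_zero dg hd]

lemma wt_degs (τ : ℕ × P →₀ ℕ) : wt 1 (degs dg τ.curry) = tdeg dg τ := by
  rw [wt, degs, Finsupp.sum_mapRange_index (by simp), tdeg,
    ← Finsupp.sum_curry_index τ (fun e p k => k * ((e + 1) * dg p))]
  refine Finsupp.sum_congr fun e _ => ?_
  rw [fdeg, Finsupp.sum, Finsupp.sum, Finset.mul_sum]
  exact Finset.sum_congr rfl fun p _ => by ring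

lemma prod_curry (τ : ℕ × P →₀ ℕ) (g : ℕ → P → ℕ → ℝ) :
    (τ.curry.prod fun a f => f.prod (g a)) = τ.prod fun p c => g p.1 p.2 c :=
  Finsupp.sum_curry_index (N := Additive ℝ) τ g

lemma wt_bound {n : ℕ} {m : ℕ →₀ ℕ} (h : wt 1 m = n) (e : ℕ) (he : m e ≠ 0) :
    (e + 1) * m e ≤ n := by
  rw [← h, wt, Finsupp.sum]
  exact Finset.single_le_sum (f := fun e => (e + 1) * m e) (fun _ _ => Nat.zero_le _)
    (Finsupp.mem_support_iff.2 he)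

lemma exists_M (n : ℕ) : ∃ M : Finset (ℕ →₀ ℕ), ∀ m, m ∈ M ↔ wt 1 m = n := by
  classical
  refine ⟨((Finset.range n).finsupp (fun _ => Finset.range (n + 1))).filter (fun m => wt 1 m = n),
    fun m => ?_⟩
  rw [Finset.mem_filter, and_iff_right_iff_imp, Finset.mem_finsupp_iff]
  intro h
  constructor
  · intro e he
    have := wt_bound h e (Finsupp.mem_support_iff.1 he)
    have h2 : 0 < m e := Nat.pos_of_ne_zero (Finsupp.mem_support_iff.1 he)
    rw [Finset.mem_range]; nlinarith
  · intro e _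
    rw [Finset.mem_range]
    by_cases he : m e = 0
    · omega
    · have := wt_bound h e he
      nlinarith

theorem types_sum (hQ : 2 ≤ Q) (hd : ∀ p, 0 < dg p) (S : ℕ → Finset (P →₀ ℕ))
    (hS : ∀ k ν, ν ∈ S k ↔ fdeg dg ν = k) (hc : ∀ k, ((S k).card : ℝ) = Q ^ k) (n : ℕ) :
    Finite {τ : ℕ × P →₀ ℕ // tdeg dg τ = n} ∧
    ∑' τ : {τ : ℕ × P →₀ ℕ // tdeg dg τ = n}, τ.1.prod (fun i k => wloc Q (dg i.2) k) =
      partSum Q n := by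
  classical
  obtain ⟨M, hM⟩ := exists_M n
  let B : Finset (Σ _ : ℕ →₀ ℕ, ℕ →₀ P →₀ ℕ) :=
    M.sigma (fun m => m.support.finsupp (fun e => S (m e)))
  have hB : ∀ m T, (⟨m, T⟩ : Σ _ : ℕ →₀ ℕ, ℕ →₀ P →₀ ℕ) ∈ B ↔ wt 1 m = n ∧ degs dg T = m := by
    intro m T
    rw [Finset.mem_sigma, hM, Finset.mem_finsupp_iff]
    refine and_congr_right fun _ => ?_
    constructor
    · rintro ⟨h1, h2⟩
      ext e
      simp only [degs, Finsupp.mapRange_apply]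
      by_cases he : e ∈ m.support
      · exact (hS _ _).1 (h2 e he)
      · have : e ∉ T.support := fun h => he (h1 h)
        rw [Finsupp.notMem_support_iff.1 he, Finsupp.notMem_support_iff.1 this, fdeg_zero]
    · rintro rfl
      refine ⟨(degs_support dg hd T).ge, fun e _ => ?_⟩
      rw [hS]; rfl
  have hmem : ∀ τ : {τ : ℕ × P →₀ ℕ // tdeg dg τ = n},
      (⟨degs dg τ.1.curry, τ.1.curry⟩ : Σ _ : ℕ →₀ ℕ, ℕ →₀ P →₀ ℕ) ∈ B := fun τ => by
    rw [hB]; exact ⟨by rw [wt_degs]; exact τ.2, rfl⟩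
  have hfin : Finite {τ : ℕ × P →₀ ℕ // tdeg dg τ = n} := by
    refine Finite.of_injective (β := B) (fun τ => ⟨_, hmem τ⟩) ?_
    intro τ τ' h
    have h1 := congrArg (fun x => x.1.2) h
    exact Subtype.ext (Finsupp.curryEquiv.injective h1)
  refine ⟨hfin, ?_⟩
  have := Fintype.ofFinite {τ : ℕ × P →₀ ℕ // tdeg dg τ = n}
  have hM' : partSum Q n = ∑ m ∈ M, m.prod fun _ k => Q ^ k / poch Q k := by
    have e : (Finset.subtype (fun m => wt 1 m = n) M).map (Function.Embedding.subtype _) = M := by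
      ext m; simp [hM]
    have : Fintype {m : ℕ →₀ ℕ // wt 1 m = n} := Fintype.subtype M hM
    rw [partSum, tsum_fintype, Finset.sum_subtype M hM]
  rw [tsum_fintype, hM']
  have h2 : ∀ m ∈ M, (m.prod fun _ k => Q ^ k / poch Q k) =
      ∑ T ∈ m.support.finsupp (fun e => S (m e)), T.prod (fun _ ν => wtot dg Q ν) := by
    intro m hm
    have : (m.prod fun _ k => Q ^ k / poch Q k) =
        ∏ e ∈ m.support, ∑ ν ∈ S (m e), wtot dg Q ν :=
      Finset.prod_congr rfl fun e _ => (W_eq dg hQ hd S hS hc (m e)).symm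
    rw [this, ← finsupp_prod_sum]
    refine Finset.sum_congr rfl fun T hT => ?_
    have : degs dg T = m := ((hB m T).1 (Finset.mem_sigma.2 ⟨hm, hT⟩)).2
    rw [← this, degs_support dg hd]; rfl
  rw [Finset.sum_congr rfl h2, Finset.sum_sigma' M]
  change _ = ∑ x ∈ B, _
  refine Finset.sum_bij' (fun τ _ => ⟨degs dg τ.1.curry, τ.1.curry⟩)
    (fun x hx => ⟨x.2.uncurry, ?_⟩) ?_ ?_ ?_ ?_ ?_
  · have h := (hB x.1 x.2).1 hx
    rw [← wt_degs, Finsupp.curry_uncurry, h.2, h.1]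
  · intro τ _; exact hmem τ
  · intros; exact Finset.mem_univ _
  · intro τ _; apply Subtype.ext; simp
  · rintro ⟨m, T⟩ hx
    have h := (hB m T).1 hx
    simp [h.2]
  · intro τ _
    exact (prod_curry τ.1 (fun _ p k => wloc Q (dg p) k)).symm
end W
end FFU

end file_P2b

section file_P2c
open Finset Polynomial
namespace FFU
section UF
variable (F : Type) [Field F]

abbrev PI : Type := {p : F[X] // p.Monic ∧ Irreducible p}

noncomputable def pdeg (p : PI F) : ℕ := p.1.natDegree

variable {F}
lemma pdeg_pos (p : PI F) : 0 < pdeg F p := p.2.2.natDegree_pos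

noncomputable def evp (ν : PI F →₀ ℕ) : F[X] := ν.prod fun p k => p.1 ^ k

lemma evp_monic (ν : PI F →₀ ℕ) : (evp ν).Monic :=
  monic_prod_of_monic _ _ fun p _ => p.2.1.pow _

lemma evp_natDegree (ν : PI F →₀ ℕ) : (evp ν).natDegree = fdeg (pdeg F) ν := by
  rw [evp, Finsupp.prod, natDegree_prod_of_monic _ _ fun p _ => p.2.1.pow _, fdeg, Finsupp.sum]
  exact Finset.sum_congr rfl fun p _ => p.2.1.natDegree_pow _

lemma evp_eq (ν : PI F →₀ ℕ) : evp ν = ((Finsupp.toMultiset ν).map Subtype.val).prod := by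
  rw [Finsupp.toMultiset_map, Finsupp.prod_toMultiset, Finsupp.prod_mapDomain_index]
  · rfl
  · simp
  · intros; rw [pow_add]

lemma evp_injective : Function.Injective (evp (F := F)) := by
  intro ν ν' h
  rw [evp_eq, evp_eq] at h
  have hirr : ∀ ν : PI F →₀ ℕ, ∀ x ∈ (Finsupp.toMultiset ν).map Subtype.val, Irreducible x := by
    intro ν x hx
    obtain ⟨p, _, rfl⟩ := Multiset.mem_map.1 hx
    exact p.2.2
  have := UniqueFactorizationMonoid.factors_unique (hirr ν) (hirr ν') (h ▸ Associated.refl _)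
  rw [Multiset.rel_map] at this
  have h2 : Multiset.Rel Eq (Finsupp.toMultiset ν) (Finsupp.toMultiset ν') :=
    this.mono fun a _ b _ hab => Subtype.ext (eq_of_monic_of_associated a.2.1 b.2.1 hab)
  classical
  have h3 := congrArg Multiset.toFinsupp (Multiset.rel_eq.1 h2)
  simpa using h3

lemma evp_surjective (f : F[X]) (hf : f.Monic) : ∃ ν : PI F →₀ ℕ, evp ν = f := by
  classical
  have hN : ∀ x ∈ UniqueFactorizationMonoid.normalizedFactors f, x.Monic ∧ Irreducible x := by
    intro x hx
    have h1 := UniqueFactorizationMonoid.irreducible_of_normalized_factor x hx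
    refine ⟨?_, h1⟩
    rw [← UniqueFactorizationMonoid.normalize_normalized_factor x hx]
    exact monic_normalize h1.ne_zero
  refine ⟨Multiset.toFinsupp
    ((UniqueFactorizationMonoid.normalizedFactors f).pmap Subtype.mk hN), ?_⟩
  rw [evp_eq, Multiset.toFinsupp_toMultiset, Multiset.map_pmap, Multiset.pmap_eq_map, Multiset.map_id',
    UniqueFactorizationMonoid.prod_normalizedFactors_eq hf.ne_zero, hf.normalize_eq_self]

noncomputable def evpEquiv (k : ℕ) : {ν : PI F →₀ ℕ // fdeg (pdeg F) ν = k} ≃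
    {f : F[X] // f.Monic ∧ f.natDegree = k} :=
  Equiv.ofBijective (fun ν => ⟨evp ν.1, evp_monic _, by rw [evp_natDegree, ν.2]⟩) <| by
    constructor
    · intro ν ν' h
      exact Subtype.ext (evp_injective (congrArg Subtype.val h))
    · rintro ⟨f, hf, hk⟩
      obtain ⟨ν, rfl⟩ := evp_surjective f hf
      exact ⟨⟨ν, by rw [← evp_natDegree, hk]⟩, rfl⟩

lemma exists_S [Fintype F] : ∃ S : ℕ → Finset (PI F →₀ ℕ),
    (∀ k ν, ν ∈ S k ↔ fdeg (pdeg F) ν = k) ∧ ∀ k, (S k).card = Fintype.card F ^ k := by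
  classical
  have h : ∀ k, ∃ S : Finset (PI F →₀ ℕ), (∀ ν, ν ∈ S ↔ fdeg (pdeg F) ν = k) ∧
      S.card = Fintype.card F ^ k := by
    intro k
    let e : {ν : PI F →₀ ℕ // fdeg (pdeg F) ν = k} ≃ (Fin k → F) :=
      (evpEquiv k).trans ((monicEquivDegreeLT k).trans (degreeLTEquiv F k).toEquiv)
    have : Fintype {ν : PI F →₀ ℕ // fdeg (pdeg F) ν = k} := Fintype.ofEquiv _ e.symm
    refine ⟨(Finset.univ : Finset {ν : PI F →₀ ℕ // fdeg (pdeg F) ν = k}).map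
      (Function.Embedding.subtype _), fun ν => by simp, ?_⟩
    rw [Finset.card_map, Finset.card_univ, Fintype.card_congr e]; simp
  choose S h1 h2 using h
  exact ⟨S, h1, h2⟩

theorem types_sum_F [Fintype F] (hF : 2 ≤ Fintype.card F) (n : ℕ) :
    Finite {τ : ℕ × PI F →₀ ℕ // tdeg (pdeg F) τ = n} ∧
    ∑' τ : {τ : ℕ × PI F →₀ ℕ // tdeg (pdeg F) τ = n},
      τ.1.prod (fun i k => wloc (Fintype.card F : ℝ) (pdeg F i.2) k) =
      partSum (Fintype.card F : ℝ) n := by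
  obtain ⟨S, h1, h2⟩ := exists_S (F := F)
  exact types_sum (pdeg F) (by exact_mod_cast hF) pdeg_pos S h1 (fun k => by rw [h2]; push_cast; rfl) n
end UF
end FFU

end file_P2c

section file_P3a
open Finset Matrix
namespace FFU
set_option linter.unusedSectionVars false
set_option linter.style.haveILetI false
section Herm
variable {κ : Type} [Field κ] [StarRing κ]

/-- invertible Hermitian matrices -/
abbrev HU (κ : Type) [Field κ] [StarRing κ] (n : Type) [Fintype n] [DecidableEq n] : Type :=
  {X : Matrix n n κ // X.IsHermitian ∧ IsUnit X}

variable {r n k : Type} [Fintype n] [DecidableEq n] [Fintype r] [DecidableEq r]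
  [Fintype k] [DecidableEq k]

lemma exists_unit_col (i0 : n) (B : Matrix n Unit κ) (hB : B ≠ 0) :
    ∃ g : Matrix n n κ, IsUnit g ∧ g * Matrix.single i0 () (1 : κ) = B := by
  obtain ⟨i, hi⟩ : ∃ i, B i () ≠ 0 := by
    by_contra! h
    exact hB (by ext i j; exact h i)
  let s := Equiv.swap i0 i
  let w : n → κ := fun j => B (s j) ()
  let h : Matrix n n κ := (1 : Matrix n n κ).updateCol i0 w
  have hh : IsUnit h := by
    rw [Matrix.isUnit_iff_isUnit_det, isUnit_iff_ne_zero, ← Matrix.cramer_apply, Matrix.cramer_one]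
    simpa [w, s] using hi
  refine ⟨h.submatrix s id, ?_, ?_⟩
  · have : h.submatrix s id = (h.submatrix s s).submatrix id s := by
      ext a b; simp [s]
    have h2 : h.submatrix s id = (s.toPEquiv.toMatrix : Matrix n n κ) * h := by
      rw [PEquiv.toMatrix_toPEquiv_mul]
    rw [h2]
    refine IsUnit.mul ?_ hh
    rw [Matrix.isUnit_iff_isUnit_det]
    rw [← Equiv.Perm.permMatrix, Matrix.det_permutation]
    exact ((Equiv.Perm.sign s).isUnit.map (Int.castRingHom κ))
  · ext a b
    rw [Matrix.mul_apply, Finset.sum_eq_single i0]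
    · simp [h, w, s]
    · intro j _ hj; simp [Matrix.single, hj.symm]
    · simp

lemma isUnit_blocks {A : Matrix r r κ} (hA : IsUnit A) (B : Matrix r n κ) (C : Matrix n r κ)
    (D : Matrix n n κ) : IsUnit (fromBlocks A B C D) ↔ IsUnit (D - C * A⁻¹ * B) := by
  letI := hA.invertible
  rw [isUnit_fromBlocks_iff_of_invertible₁₁, Matrix.invOf_eq_nonsing_inv]

lemma isHerm_blocks {A : Matrix r r κ} {B : Matrix r n κ} {C : Matrix n r κ}
    {D : Matrix n n κ} : (fromBlocks A B C D).IsHermitian ↔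
      A.IsHermitian ∧ B = Cᴴ ∧ D.IsHermitian := by
  rw [Matrix.isHermitian_fromBlocks_iff]
  constructor
  · rintro ⟨a, b, c, d⟩; exact ⟨a, by rw [← b, conjTranspose_conjTranspose], d⟩
  · rintro ⟨a, b, d⟩
    refine ⟨a, by rw [b, conjTranspose_conjTranspose], b.symm, d⟩

/-- Schur complement parametrisation -/
noncomputable def schurEquiv : HU κ r × Matrix n r κ × HU κ n ≃
    {X : HU κ (r ⊕ n) // IsUnit X.1.toBlocks₁₁} where
  toFun p := ⟨⟨fromBlocks p.1.1 p.2.1ᴴ p.2.1 (p.2.2.1 + p.2.1 * p.1.1⁻¹ * p.2.1ᴴ), by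
      refine ⟨isHerm_blocks.2 ⟨p.1.2.1, rfl, ?_⟩, ?_⟩
      · exact p.2.2.2.1.add (Matrix.isHermitian_mul_mul_conjTranspose _ p.1.2.1.inv)
      · rw [isUnit_blocks p.1.2.2]; simpa using p.2.2.2.2⟩, by simpa using p.1.2.2⟩
  invFun X := ⟨⟨X.1.1.toBlocks₁₁, by
      have := X.1.2.1; rw [← fromBlocks_toBlocks X.1.1, isHerm_blocks] at this
      exact this.1, X.2⟩, X.1.1.toBlocks₂₁,
      ⟨X.1.1.toBlocks₂₂ - X.1.1.toBlocks₂₁ * X.1.1.toBlocks₁₁⁻¹ * X.1.1.toBlocks₂₁ᴴ, by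
        have h := X.1.2.1; rw [← fromBlocks_toBlocks X.1.1, isHerm_blocks] at h
        refine ⟨h.2.2.sub (Matrix.isHermitian_mul_mul_conjTranspose _ h.1.inv), ?_⟩
        have h2 := X.1.2.2
        rw [← fromBlocks_toBlocks X.1.1, isUnit_blocks X.2, h.2.1] at h2
        exact h2⟩⟩
  left_inv p := by
    obtain ⟨⟨A, hA⟩, C, ⟨E, hE⟩⟩ := p
    simp
  right_inv X := by
    obtain ⟨⟨X, hX⟩, hX'⟩ := X
    have h := hX.1; rw [← fromBlocks_toBlocks X, isHerm_blocks] at h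
    refine Subtype.ext (Subtype.ext ?_)
    simp only [sub_add_cancel]
    rw [← h.2.1, fromBlocks_toBlocks]

abbrev Fib (κ : Type) [Field κ] [StarRing κ] (n : Type) [Fintype n] [DecidableEq n]
    (B : Matrix n Unit κ) : Type :=
  {D : Matrix n n κ // D.IsHermitian ∧ IsUnit (fromBlocks (0 : Matrix Unit Unit κ) Bᴴ B D)}

noncomputable def zeroEquiv : {X : HU κ (Unit ⊕ n) // ¬ IsUnit X.1.toBlocks₁₁} ≃
    Σ B : Matrix n Unit κ, Fib κ n B where
  toFun X := ⟨X.1.1.toBlocks₂₁, X.1.1.toBlocks₂₂, by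
    have h := X.1.2.1; rw [← fromBlocks_toBlocks X.1.1, isHerm_blocks] at h
    refine ⟨h.2.2, ?_⟩
    have h2 := X.1.2.2
    rw [← fromBlocks_toBlocks X.1.1] at h2
    have h3 : X.1.1.toBlocks₁₁ = 0 := by
      have := X.2
      rw [Matrix.isUnit_iff_isUnit_det, isUnit_iff_ne_zero, not_not, Matrix.det_unique] at this
      ext i j; exact this
    rwa [h3, h.2.1] at h2⟩
  invFun p := ⟨⟨fromBlocks 0 p.1ᴴ p.1 p.2.1, isHerm_blocks.2 ⟨by simp, rfl, p.2.2.1⟩, p.2.2.2⟩,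
    by simp⟩
  left_inv X := by
    refine Subtype.ext (Subtype.ext ?_)
    have h := X.1.2.1; rw [← fromBlocks_toBlocks X.1.1, isHerm_blocks] at h
    have h3 : X.1.1.toBlocks₁₁ = 0 := by
      have := X.2
      rw [Matrix.isUnit_iff_isUnit_det, isUnit_iff_ne_zero, not_not, Matrix.det_unique] at this
      ext i j; exact this
    simp only
    rw [← h3, ← h.2.1, fromBlocks_toBlocks]
  right_inv p := by simp

lemma fib_zero_empty : IsEmpty (Fib κ n 0) := by
  refine ⟨fun D => ?_⟩
  have h := D.2.2
  rw [Matrix.isUnit_iff_isUnit_det, isUnit_iff_ne_zero] at h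
  apply h
  apply Matrix.det_eq_zero_of_row_eq_zero (Sum.inl ())
  rintro (j | j) <;> simp

lemma isUnit_conj_iff {X g : Matrix n n κ} (hg : IsUnit g) : IsUnit (g * X * gᴴ) ↔ IsUnit X := by
  have hg' : IsUnit gᴴ := (Matrix.isUnit_conjTranspose g).2 hg
  rw [IsUnit.mul_right_iff hg', IsUnit.mul_left_iff hg]

lemma fib_iff (g : Matrix n n κ) (hg : IsUnit g) (B : Matrix n Unit κ) (D : Matrix n n κ) :
    IsUnit (fromBlocks (0 : Matrix Unit Unit κ) (g * B)ᴴ (g * B) (g * D * gᴴ)) ↔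
    IsUnit (fromBlocks (0 : Matrix Unit Unit κ) Bᴴ B D) := by
  have hG : IsUnit (fromBlocks (1 : Matrix Unit Unit κ) 0 0 g) := by
    rw [Matrix.isUnit_fromBlocks_zero₂₁]; exact ⟨isUnit_one, hg⟩
  rw [← isUnit_conj_iff (X := fromBlocks (0 : Matrix Unit Unit κ) Bᴴ B D) hG]
  simp [fromBlocks_conjTranspose, fromBlocks_multiply]

lemma fib_card (g : Matrix n n κ) (hg : IsUnit g) (B : Matrix n Unit κ) :
    Nat.card (Fib κ n (g * B)) = Nat.card (Fib κ n B) := by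
  refine (Nat.card_congr ?_).symm
  have hgd := (Matrix.isUnit_iff_isUnit_det g).1 hg
  have hgd' := (Matrix.isUnit_iff_isUnit_det gᴴ).1 ((Matrix.isUnit_conjTranspose g).2 hg)
  refine Equiv.ofBijective (fun D => ⟨g * D.1 * gᴴ,
    Matrix.isHermitian_mul_mul_conjTranspose _ D.2.1, (fib_iff g hg B D.1).2 D.2.2⟩) ⟨?_, ?_⟩
  · intro D D' h
    have := congrArg Subtype.val h
    simp only at this
    exact Subtype.ext (hg.mul_left_cancel
      (((Matrix.isUnit_conjTranspose g).2 hg).mul_right_cancel this))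
  · rintro ⟨E, hE, hE'⟩
    have h1 : g * (g⁻¹ * E * g⁻¹ᴴ) * gᴴ = E := by
      rw [conjTranspose_nonsing_inv]
      rw [Matrix.mul_assoc (g⁻¹), Matrix.mul_nonsing_inv_cancel_left _ _ hgd,
        Matrix.nonsing_inv_mul_cancel_right _ _ hgd']
    refine ⟨⟨g⁻¹ * E * g⁻¹ᴴ, Matrix.isHermitian_mul_mul_conjTranspose _ hE, ?_⟩,
      Subtype.ext h1⟩
    rw [← fib_iff g hg, h1]; exact hE'

lemma fib_e0_iff (α : Matrix Unit Unit κ) (β : Matrix k Unit κ) (δ : Matrix k k κ) :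
    IsUnit (fromBlocks (0 : Matrix Unit Unit κ) (Matrix.single (Sum.inl () : Unit ⊕ k) () 1)ᴴ
      (Matrix.single (Sum.inl () : Unit ⊕ k) () 1) (fromBlocks α βᴴ β δ)) ↔ IsUnit δ := by
  let A : Matrix (Unit ⊕ Unit) (Unit ⊕ Unit) κ := fromBlocks 0 1 1 α
  let A' : Matrix (Unit ⊕ Unit) (Unit ⊕ Unit) κ := fromBlocks (-α) 1 1 0
  have hAA : A * A' = 1 := by
    simp [A, A', fromBlocks_multiply, ← fromBlocks_one]
  have hA : IsUnit A := IsUnit.of_mul_eq_one _ hAA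
  have hAi : A⁻¹ = A' := Matrix.inv_eq_right_inv hAA
  rw [← Matrix.isUnit_submatrix_equiv (Equiv.sumAssoc Unit Unit k)]
  have : (fromBlocks (0 : Matrix Unit Unit κ) (Matrix.single (Sum.inl () : Unit ⊕ k) () 1)ᴴ
      (Matrix.single (Sum.inl () : Unit ⊕ k) () 1) (fromBlocks α βᴴ β δ)).submatrix
      (Equiv.sumAssoc Unit Unit k) (Equiv.sumAssoc Unit Unit k) =
      fromBlocks A (fromRows 0 βᴴ) (fromCols 0 β) δ := by
    ext ((i | i) | i) ((j | j) | j) <;> simp [A]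
  rw [this, isUnit_blocks hA, hAi]
  have h0 : (fromCols 0 β : Matrix k (Unit ⊕ Unit) κ) * A' *
      (fromRows 0 βᴴ : Matrix (Unit ⊕ Unit) k κ) = 0 := by
    simp [A', fromCols_mul_fromBlocks, fromCols_mul_fromRows]
  rw [h0, sub_zero]

noncomputable def fibE0 : Fib κ (Unit ⊕ k) (Matrix.single (Sum.inl ()) () (1 : κ)) ≃
    {a : κ // star a = a} × Matrix k Unit κ × HU κ k where
  toFun D := ⟨⟨D.1 (Sum.inl ()) (Sum.inl ()), D.2.1.apply _ _⟩, D.1.toBlocks₂₁, D.1.toBlocks₂₂, by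
    have h := D.2.1; rw [← fromBlocks_toBlocks D.1, isHerm_blocks] at h
    have h2 := D.2.2; rw [← fromBlocks_toBlocks D.1, h.2.1, fib_e0_iff] at h2
    exact ⟨h.2.2, h2⟩⟩
  invFun p := ⟨fromBlocks (Matrix.of fun _ _ => p.1.1) p.2.1ᴴ p.2.1 p.2.2.1, by
    refine ⟨isHerm_blocks.2 ⟨?_, rfl, p.2.2.2.1⟩, ?_⟩
    · ext i j; simpa using p.1.2
    · rw [fib_e0_iff]; exact p.2.2.2.2⟩
  left_inv D := by
    refine Subtype.ext ?_
    have h := D.2.1; rw [← fromBlocks_toBlocks D.1, isHerm_blocks] at h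
    ext (i | i) (j | j)
    · rfl
    · exact (congrFun (congrFun h.2.1 i) j).symm
    · rfl
    · rfl
  right_inv p := by simp

end Herm
end FFU

end file_P3a

section file_P3b
open Finset Matrix
namespace FFU
set_option linter.unusedSectionVars false
set_option linter.style.haveILetI false
section Herm
variable {κ : Type} [Field κ] [StarRing κ]
variable {r n k : Type} [Fintype n] [DecidableEq n] [Fintype r] [DecidableEq r]
  [Fintype k] [DecidableEq k]

lemma HU_card_congr (e : n ≃ k) : Nat.card (HU κ n) = Nat.card (HU κ k) := by
  refine Nat.card_congr ?_
  refine Equiv.subtypeEquiv (Matrix.reindex e e) fun X => ?_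
  rw [Matrix.reindex_apply, Matrix.isHermitian_submatrix_equiv, Matrix.isUnit_submatrix_equiv]

variable [Finite κ]

lemma HU_unit {Q : ℕ} (hF : Nat.card {a : κ // star a = a} = Q) :
    Nat.card (HU κ Unit) = Q - 1 := by
  classical
  have e : HU κ Unit ≃ {a : {a : κ // star a = a} // a ≠ ⟨0, star_zero κ⟩} :=
    { toFun := fun X => ⟨⟨X.1 () (), X.2.1.apply _ _⟩, fun h => by
        have h2 := X.2.2
        rw [Matrix.isUnit_iff_isUnit_det, isUnit_iff_ne_zero, Matrix.det_unique] at h2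
        exact h2 (congrArg Subtype.val h)⟩
      invFun := fun a => ⟨Matrix.of fun _ _ => a.1.1, by
        ext i j; simpa using a.1.2, by
        rw [Matrix.isUnit_iff_isUnit_det, isUnit_iff_ne_zero, Matrix.det_unique]
        exact fun h => a.2 (Subtype.ext h)⟩
      left_inv := fun X => by ext i j; rfl
      right_inv := fun a => by rfl }
  rw [Nat.card_congr e]
  haveI := Fintype.ofFinite κ
  haveI := Fintype.ofFinite {a : κ // star a = a}
  rw [← hF, Nat.card_eq_fintype_card, Nat.card_eq_fintype_card, Fintype.card_subtype_compl,
    Fintype.card_subtype_eq]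

lemma card_mat {Q : ℕ} (hQ : Nat.card κ = Q ^ 2) : Nat.card (Matrix n Unit κ) =
    Q ^ (2 * Fintype.card n) := by
  change Nat.card (n → Unit → κ) = _
  rw [Nat.card_fun, Nat.card_fun, hQ]
  simp [pow_mul]

lemma sigma_card {Q : ℕ} (hQ : Nat.card κ = Q ^ 2) (hF : Nat.card {a : κ // star a = a} = Q) :
    Nat.card (Σ B : Matrix (Unit ⊕ k) Unit κ, Fib κ (Unit ⊕ k) B) =
    (Q ^ (2 * (Fintype.card k + 1)) - 1) * (Q * (Q ^ (2 * Fintype.card k) * Nat.card (HU κ k))) := by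
  classical
  haveI := Fintype.ofFinite κ
  rw [Nat.card_sigma, ← Finset.add_sum_erase _ _ (Finset.mem_univ 0)]
  have h0 : Nat.card (Fib κ (Unit ⊕ k) 0) = 0 := by
    haveI := fib_zero_empty (κ := κ) (n := Unit ⊕ k)
    exact Nat.card_of_isEmpty
  rw [h0, zero_add, Finset.sum_congr rfl (g := fun _ => (Q * (Q ^ (2 * Fintype.card k) *
    Nat.card (HU κ k)))), Finset.sum_const, Finset.card_erase_of_mem (Finset.mem_univ _),
    Finset.card_univ, ← Nat.card_eq_fintype_card, card_mat hQ, smul_eq_mul]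
  · simp [add_comm]
  · intro B hB
    obtain ⟨g, hg, rfl⟩ := exists_unit_col (Sum.inl ()) B (Finset.ne_of_mem_erase hB)
    rw [fib_card g hg, Nat.card_congr fibE0, Nat.card_prod, Nat.card_prod, hF, card_mat hQ]

lemma HU_rec {Q : ℕ} (hQ : Nat.card κ = Q ^ 2) (hF : Nat.card {a : κ // star a = a} = Q) (m : ℕ) :
    Nat.card (HU κ (Fin (m + 2))) =
    (Q - 1) * (Q ^ (2 * (m + 1)) * Nat.card (HU κ (Fin (m + 1)))) +
    (Q ^ (2 * (m + 1)) - 1) * (Q * (Q ^ (2 * m) * Nat.card (HU κ (Fin m)))) := by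
  classical
  haveI := Fintype.ofFinite κ
  have e1 : Fin (m + 1) ≃ Unit ⊕ Fin m := Fintype.equivOfCardEq (by simp [add_comm])
  have e2 : Fin (m + 2) ≃ Unit ⊕ (Unit ⊕ Fin m) := Fintype.equivOfCardEq (by simp; ring)
  rw [HU_card_congr e2, HU_card_congr e1,
    ← Nat.card_congr (Equiv.sumCompl fun X : HU κ (Unit ⊕ (Unit ⊕ Fin m)) => IsUnit X.1.toBlocks₁₁),
    Nat.card_sum]
  congr 1
  · rw [← Nat.card_congr schurEquiv, Nat.card_prod, Nat.card_prod, HU_unit hF, card_mat hQ]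
    simp [add_comm]
  · rw [Nat.card_congr zeroEquiv, sigma_card hQ hF]; simp

theorem HU_card {Q : ℕ} (hQ : Nat.card κ = Q ^ 2) (hF : Nat.card {a : κ // star a = a} = Q)
    (m : ℕ) : (Nat.card (HU κ (Fin m)) : ℝ) =
      (Q : ℝ) ^ (m ^ 2) * ∏ j ∈ range m, (1 + (-(Q : ℝ)⁻¹) ^ (j + 1)) := by
  have hQ1 : 1 ≤ Q := by
    rw [← hF, Nat.succ_le_iff]
    haveI : Nonempty {a : κ // star a = a} := ⟨0, star_zero κ⟩
    exact Nat.card_pos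
  have hQ0 : (Q : ℝ) ≠ 0 := by positivity
  induction m using Nat.strong_induction_on with
  | _ m ih =>
  match m with
  | 0 =>
    have : Nat.card (HU κ (Fin 0)) = 1 := by
      haveI : Subsingleton (HU κ (Fin 0)) := ⟨fun a b => Subtype.ext (Subsingleton.elim _ _)⟩
      haveI : Nonempty (HU κ (Fin 0)) := ⟨1, by simp [Matrix.IsHermitian], isUnit_one⟩
      exact Nat.card_unique
    simp [this]
  | 1 =>
    rw [HU_card_congr (Equiv.ofUnique (Fin 1) Unit), HU_unit hF, Nat.cast_sub hQ1]
    simp; field_simp; ring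
  | m + 2 =>
    rw [HU_rec hQ hF]
    have h1 : 1 ≤ Q ^ (2 * (m + 1)) := Nat.one_le_pow _ _ hQ1
    push_cast [Nat.cast_sub hQ1, Nat.cast_sub h1]
    rw [ih m (by omega), ih (m + 1) (by omega), prod_range_succ _ (m + 1), prod_range_succ _ m]
    generalize ∏ j ∈ range m, (1 + (-(Q : ℝ)⁻¹) ^ (j + 1)) = P
    have hs : (-(Q : ℝ)⁻¹) ^ (m + 1) * (-(Q : ℝ)⁻¹) ^ (m + 1) * (Q : ℝ) ^ (2 * (m + 1)) = 1 := by
      rw [← mul_pow, mul_comm 2, mul_comm (m + 1) 2, pow_mul, ← mul_pow]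
      field_simp
      simp
    rw [pow_succ _ (m + 1)]
    have e1 : (Q : ℝ) ^ ((m + 1) ^ 2) = (Q : ℝ) ^ (m ^ 2) * Q ^ (2 * m) * Q := by ring
    have e2 : (Q : ℝ) ^ ((m + 2) ^ 2) = (Q : ℝ) ^ (m ^ 2) * Q ^ (2 * m) * Q ^ (2 * m) * Q ^ 4 := by
      ring
    have e3 : (Q : ℝ) ^ (2 * (m + 1)) = Q ^ (2 * m) * Q ^ 2 := by ring
    rw [e1, e2]
    rw [e3] at hs ⊢
    revert hs
    generalize (-(Q : ℝ)⁻¹) ^ (m + 1) = s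
    generalize (Q : ℝ) ^ (2 * m) = y
    generalize (Q : ℝ) ^ (m ^ 2) = z
    intro hs
    field_simp
    linear_combination (y * z * P) * hs
end Herm
end FFU

end file_P3b

section file_P3c
open Finset Matrix
namespace FFU
set_option linter.unusedSectionVars false
set_option linter.style.haveILetI false
section GLs
variable {κ : Type} [Field κ] [Finite κ]

lemma unit_mat_card {N : ℕ} (hN : Nat.card κ = N) (m : ℕ) :
    (Nat.card {g : Matrix (Fin m) (Fin m) κ // IsUnit g} : ℝ) =
      (N : ℝ) ^ (m ^ 2) * ∏ j ∈ range m, (1 - ((N : ℝ)⁻¹) ^ (j + 1)) := by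
  haveI := Fintype.ofFinite κ
  have hN0 : 0 < N := by rw [← hN]; exact Nat.card_pos
  have e : {g : Matrix (Fin m) (Fin m) κ // IsUnit g} ≃ GL (Fin m) κ :=
    { toFun := fun g => g.2.unit
      invFun := fun g => ⟨g.1, g.isUnit⟩
      left_inv := fun g => rfl
      right_inv := fun g => Units.ext rfl }
  rw [Nat.card_congr e, Matrix.card_GL_field, ← Nat.card_eq_fintype_card, hN,
    Fin.prod_univ_eq_prod_range (fun i => N ^ m - N ^ i) m, ← Finset.prod_range_reflect]
  push_cast
  have hp : (N : ℝ) ^ (m ^ 2) = ∏ _j ∈ range m, (N : ℝ) ^ m := by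
    rw [Finset.prod_const, Finset.card_range, sq, pow_mul]
  rw [hp, ← Finset.prod_mul_distrib]
  refine Finset.prod_congr rfl fun j hj => ?_
  have hj' := Finset.mem_range.1 hj
  rw [Nat.cast_sub (Nat.pow_le_pow_right hN0 (by omega))]
  push_cast
  have h0 : (N : ℝ) ≠ 0 := by positivity
  have : (N : ℝ) ^ m = (N : ℝ) ^ (m - 1 - j) * (N : ℝ) ^ (j + 1) := by
    rw [← pow_add]; congr 1; omega
  rw [mul_sub, mul_one, inv_pow]
  congr 1
  rw [this]; field_simp

variable [StarRing κ]

theorem GL_HU {Q : ℕ} (hQ : Nat.card κ = Q ^ 2) (hF : Nat.card {a : κ // star a = a} = Q) (m : ℕ) :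
    (Nat.card {g : Matrix (Fin m) (Fin m) κ // IsUnit g} : ℝ) =
      (Q : ℝ) ^ (m ^ 2) * poch Q m * Nat.card (HU κ (Fin m)) := by
  rw [unit_mat_card hQ, HU_card hQ hF, poch]
  have : ∏ j ∈ range m, (1 - (((Q ^ 2 : ℕ) : ℝ)⁻¹) ^ (j + 1)) =
      (∏ j ∈ range m, (1 - (-(Q : ℝ)⁻¹) ^ (j + 1))) *
      ∏ j ∈ range m, (1 + (-(Q : ℝ)⁻¹) ^ (j + 1)) := by
    rw [← Finset.prod_mul_distrib]
    refine Finset.prod_congr rfl fun j _ => ?_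
    have : (((Q ^ 2 : ℕ) : ℝ)⁻¹) ^ (j + 1) = ((-(Q : ℝ)⁻¹) ^ (j + 1)) ^ 2 := by
      rw [← pow_mul, mul_comm (j + 1), pow_mul, neg_sq]; simp
    rw [this]; ring
  rw [this]; push_cast; ring
end GLs

section trans
variable {κ : Type} [Field κ] [StarRing κ]
variable {r n k : Type} [Fintype n] [DecidableEq n] [Fintype r] [DecidableEq r]
  [Fintype k] [DecidableEq k]

/-- polarisation -/
lemma polar {V : Type*} [AddCommGroup V] [Module κ V] (hs : ∃ x : κ, star x ≠ x)
    (s : V → V → κ) (hl : ∀ v v' w, s (v + v') w = s v w + s v' w)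
    (hr : ∀ v w w', s v (w + w') = s v w + s v w')
    (hsl : ∀ a v w, s (a • v) w = a * s v w) (hsr : ∀ a v w, s v (a • w) = star a * s v w)
    (h0 : ∀ v, s v v = 0) (v w : V) : s v w = 0 := by
  obtain ⟨x, hx⟩ := hs
  have h1 : ∀ v w, s v w + s w v = 0 := by
    intro v w
    have := h0 (v + w)
    rw [hl, hr, hr, h0, h0] at this
    simpa using this
  have h2 := h1 (x • v) w
  rw [hsl, hsr] at h2
  have h3 : (x - star x) * s v w = 0 := by linear_combination h2 - star x * h1 v w
  exact (mul_eq_zero.1 h3).resolve_left (sub_ne_zero.2 (Ne.symm hx))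

def Trans (κ : Type) [Field κ] [StarRing κ] (n : Type) [Fintype n] [DecidableEq n] : Prop :=
  ∀ X : Matrix n n κ, X.IsHermitian → IsUnit X → ∃ g : Matrix n n κ, IsUnit g ∧ X = g * gᴴ

lemma trans_congr (e : n ≃ k) (h : Trans κ k) : Trans κ n := by
  intro X hX hX'
  obtain ⟨g, hg, h2⟩ := h (X.submatrix e.symm e.symm) (hX.submatrix _)
    ((Matrix.isUnit_submatrix_equiv _ _).2 hX')
  refine ⟨g.submatrix e e, (Matrix.isUnit_submatrix_equiv _ _).2 hg, ?_⟩
  rw [conjTranspose_submatrix, Matrix.submatrix_mul_equiv, ← h2]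
  ext; simp

lemma trans_step1 (hN : ∀ a : κ, star a = a → a ≠ 0 → ∃ b, b * star b = a) (h : Trans κ k)
    (X : Matrix (Unit ⊕ k) (Unit ⊕ k) κ) (hX : X.IsHermitian) (hX' : IsUnit X)
    (h11 : X (Sum.inl ()) (Sum.inl ()) ≠ 0) :
    ∃ g : Matrix (Unit ⊕ k) (Unit ⊕ k) κ, IsUnit g ∧ X = g * gᴴ := by
  have hu : IsUnit X.toBlocks₁₁ := by
    rw [Matrix.isUnit_iff_isUnit_det, isUnit_iff_ne_zero, Matrix.det_unique]; exact h11
  have hh := hX; rw [← fromBlocks_toBlocks X, isHerm_blocks] at hh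
  have hx := hX'; rw [← fromBlocks_toBlocks X, isUnit_blocks hu] at hx
  rw [← fromBlocks_toBlocks X] 
  revert hh hx hu
  have hA : ∃ b : Matrix Unit Unit κ, IsUnit X.toBlocks₁₁ → IsUnit b ∧ X.toBlocks₁₁ = b * bᴴ := by
    obtain ⟨b, hb⟩ := hN _ (hX.apply (Sum.inl ()) (Sum.inl ())) h11
    refine ⟨Matrix.of fun _ _ => b, fun _ => ⟨?_, ?_⟩⟩
    · rw [Matrix.isUnit_iff_isUnit_det, isUnit_iff_ne_zero, Matrix.det_unique]
      rintro h; simp only [of_apply] at h; rw [h, zero_mul] at hb; exact h11 hb.symm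
    · ext i j; simp [Matrix.mul_apply, hb, toBlocks₁₁]
  revert hA
  generalize X.toBlocks₁₁ = A
  generalize X.toBlocks₁₂ = B
  generalize X.toBlocks₂₁ = C
  generalize X.toBlocks₂₂ = D
  rintro ⟨b, hb⟩ hA ⟨hA', rfl, hD⟩ hE
  obtain ⟨hb, hb2⟩ := hb hA
  obtain ⟨g, hg, hg2⟩ := h (D - C * A⁻¹ * Cᴴ)
    (hD.sub (Matrix.isHermitian_mul_mul_conjTranspose _ hA'.inv)) hE
  have hAd := (Matrix.isUnit_iff_isUnit_det A).1 hA
  have hbd := (Matrix.isUnit_iff_isUnit_det b).1 hb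
  have hbd' := (Matrix.isUnit_iff_isUnit_det bᴴ).1 ((Matrix.isUnit_conjTranspose b).2 hb)
  refine ⟨fromBlocks b 0 (C * bᴴ⁻¹) g, Matrix.isUnit_fromBlocks_zero₁₂.2 ⟨hb, hg⟩, ?_⟩
  rw [fromBlocks_conjTranspose, fromBlocks_multiply]
  have hAi : A⁻¹ = bᴴ⁻¹ * b⁻¹ := by rw [hb2, Matrix.mul_inv_rev]
  rw [← hg2, hAi, hb2]
  have e1 : b * (C * bᴴ⁻¹)ᴴ = Cᴴ := by
    rw [conjTranspose_mul, conjTranspose_nonsing_inv, conjTranspose_conjTranspose,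
      Matrix.mul_nonsing_inv_cancel_left _ _ hbd]
  have e2 : C * bᴴ⁻¹ * bᴴ = C := Matrix.nonsing_inv_mul_cancel_right _ _ hbd'
  congr 1
  · simp
  · rw [e1]; simp
  · rw [e2]; simp
  · rw [conjTranspose_mul, conjTranspose_nonsing_inv, conjTranspose_conjTranspose]
    simp only [Matrix.mul_assoc]; abel

theorem trans_all (hs : ∃ x : κ, star x ≠ x)
    (hN : ∀ a : κ, star a = a → a ≠ 0 → ∃ b, b * star b = a) (m : ℕ) : Trans κ (Fin m) := by
  induction m with
  | zero => exact fun X _ _ => ⟨1, isUnit_one, Subsingleton.elim _ _⟩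
  | succ m ih =>
    have e1 : Fin (m + 1) ≃ Unit ⊕ Fin m := Fintype.equivOfCardEq (by simp [add_comm])
    refine trans_congr e1 fun X hX hX' => ?_
    obtain ⟨v, hv⟩ : ∃ v : Unit ⊕ Fin m → κ, star v ⬝ᵥ X *ᵥ v ≠ 0 := by
      by_contra! h
      have := polar hs (fun v w : Unit ⊕ Fin m → κ => star w ⬝ᵥ X *ᵥ v)
        (by intros; simp [Matrix.mulVec_add, dotProduct_add])
        (by intros; simp [add_dotProduct])
        (by intros; simp [Matrix.mulVec_smul])
        (by intros; simp [smul_dotProduct]) h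
      have h2 : X = 0 := by
        ext i j
        have := this (Pi.single j 1) (Pi.single i 1)
        simpa using this
      rw [h2] at hX'
      simp at hX'
    let B : Matrix (Unit ⊕ Fin m) Unit κ := Matrix.of fun i _ => v i
    have hB : B ≠ 0 := by
      intro h
      apply hv
      have : v = 0 := by ext i; exact congrFun (congrFun h i) ()
      simp [this]
    obtain ⟨g, hg, hgB⟩ := exists_unit_col (Sum.inl ()) B hB
    have hgv : ∀ i, g i (Sum.inl ()) = v i := by
      intro i
      have := congrFun (congrFun hgB i) ()
      simpa [B] using this
    have hg' := (Matrix.isUnit_conjTranspose g).2 hg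
    have hgd := (Matrix.isUnit_iff_isUnit_det g).1 hg
    have hgd' := (Matrix.isUnit_iff_isUnit_det gᴴ).1 hg'
    obtain ⟨f, hf, hf2⟩ := trans_step1 hN ih (gᴴ * X * g)
      (Matrix.isHermitian_conjTranspose_mul_mul _ hX) ((hg'.mul hX').mul hg) (by
        convert hv using 1
        rw [Matrix.mul_assoc, Matrix.mul_apply, dotProduct]
        refine Finset.sum_congr rfl fun i _ => ?_
        rw [conjTranspose_apply, hgv, Matrix.mul_apply]
        simp [Matrix.mulVec, dotProduct, hgv])
    refine ⟨gᴴ⁻¹ * f, IsUnit.mul ?_ hf, ?_⟩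
    · exact (Matrix.isUnit_nonsing_inv_iff).2 hg'
    · rw [conjTranspose_mul, conjTranspose_nonsing_inv, conjTranspose_conjTranspose,
        Matrix.mul_assoc, ← Matrix.mul_assoc f, ← hf2, Matrix.mul_assoc, Matrix.mul_assoc,
        Matrix.mul_nonsing_inv _ hgd, Matrix.mul_one,
        Matrix.nonsing_inv_mul_cancel_left _ _ hgd']
end trans
end FFU

end file_P3c

section file_P4a
open Finset
namespace FFU
set_option linter.unusedSectionVars false
set_option linter.style.haveILetI false
section absD
variable {R P : Type} [CommRing R] [DecidableEq P] (pp : P → R)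

abbrev Lam (i : ℕ × P) : Type := R ⧸ Ideal.span {pp i.2 ^ (i.1 + 1)}
abbrev kap (p : P) : Type := R ⧸ Ideal.span {pp p}

lemma span_le (i : ℕ × P) : Ideal.span {pp i.2 ^ (i.1 + 1)} ≤ Ideal.span {pp i.2} := by
  rw [Ideal.span_singleton_le_span_singleton]
  exact dvd_pow_self _ (by omega)

noncomputable def res (i : ℕ × P) : Lam pp i →+* kap pp i.2 := Ideal.Quotient.factor (span_le pp i)

lemma res_mk (i : ℕ × P) (x : R) : res pp i (Ideal.Quotient.mk _ x) = Ideal.Quotient.mk _ x := rfl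

lemma res_smul (i : ℕ × P) (x : R) (y : Lam pp i) :
    res pp i (x • y) = Ideal.Quotient.mk _ x * res pp i y := by
  rw [Algebra.smul_def, map_mul]; rfl

lemma res_zero {i : ℕ × P} (x : Lam pp i) (h : res pp i x = 0) : ∃ w, x = pp i.2 • w := by
  obtain ⟨x, rfl⟩ := Ideal.Quotient.mk_surjective x
  rw [res_mk, Ideal.Quotient.eq_zero_iff_mem, Ideal.mem_span_singleton] at h
  obtain ⟨w, rfl⟩ := h
  exact ⟨Ideal.Quotient.mk _ w, by rw [Algebra.smul_def, map_mul]; rfl⟩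

lemma mk_pp (p : P) : (Ideal.Quotient.mk (Ideal.span {pp p}) (pp p)) = 0 :=
  Ideal.Quotient.eq_zero_iff_mem.2 (Ideal.mem_span_singleton_self _)

noncomputable def rep {i : ℕ × P} (x : Lam pp i) : R := Function.surjInv Ideal.Quotient.mk_surjective x

lemma mk_rep {i : ℕ × P} (x : Lam pp i) : Ideal.Quotient.mk _ (rep pp x) = x :=
  Function.surjInv_eq Ideal.Quotient.mk_surjective x

lemma rep_smul_one {i : ℕ × P} (x : Lam pp i) : rep pp x • (1 : Lam pp i) = x := by
  rw [Algebra.smul_def, mul_one]; exact mk_rep pp x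

variable {ι ι' ι'' : Type} [Fintype ι] [DecidableEq ι] [Fintype ι'] [DecidableEq ι']
  [Fintype ι''] [DecidableEq ι'']
variable {c : ι → ℕ × P} {c' : ι' → ℕ × P} {c'' : ι'' → ℕ × P}

abbrev Md (c : ι → ℕ × P) : Type := ∀ a, Lam pp (c a)

variable {pp}
def ent (r : Md pp c →ₗ[R] Md pp c') (a : ι') (b : ι) : Lam pp (c' a) := r (Pi.single b 1) a

lemma apply_single (r : Md pp c →ₗ[R] Md pp c') (a : ι') (b : ι) (x : Lam pp (c b)) :
    r (Pi.single b x) a = rep pp x • ent r a b := by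
  conv_lhs => rw [← rep_smul_one pp x]
  rw [Pi.single_smul, map_smul]; rfl

lemma apply_eq_sum (r : Md pp c →ₗ[R] Md pp c') (m : Md pp c) (a : ι') :
    r m a = ∑ b, r (Pi.single b (m b)) a := by
  conv_lhs => rw [← Finset.univ_sum_single m]
  rw [map_sum, Finset.sum_apply]

/-- the matrix of residues -/
noncomputable def DD (i : ℕ × P) (r : Md pp c →ₗ[R] Md pp c') :
    Matrix {a : ι' // c' a = i} {b : ι // c b = i} (kap pp i.2) :=
  Matrix.of fun a b => Ideal.Quotient.mk _ (rep pp (ent r a.1 b.1))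

lemma DD_apply (r : Md pp c →ₗ[R] Md pp c') (a : ι') (b : {b : ι // c b = c' a}) :
    DD (c' a) r ⟨a, rfl⟩ b = res pp _ (ent r a b.1) := by
  conv_rhs => rw [← mk_rep pp (ent r a b.1)]
  rfl

lemma DD_add (i : ℕ × P) (r s : Md pp c →ₗ[R] Md pp c') : DD i (r + s) = DD i r + DD i s := by
  ext ⟨a, rfl⟩ b
  rw [Matrix.add_apply, DD_apply, DD_apply, DD_apply, ← map_add]; rfl

lemma DD_smul (i : ℕ × P) (x : R) (r : Md pp c →ₗ[R] Md pp c') :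
    DD i (x • r) = (Ideal.Quotient.mk _ x : kap pp i.2) • DD i r := by
  ext ⟨a, rfl⟩ b
  rw [Matrix.smul_apply, DD_apply, DD_apply, smul_eq_mul, ← res_smul]; rfl

lemma DD_id (i : ℕ × P) : DD i (LinearMap.id : Md pp c →ₗ[R] Md pp c) = 1 := by
  ext ⟨a, rfl⟩ ⟨b, hb⟩
  rw [DD_apply, ent, Matrix.one_apply]
  by_cases h : a = b
  · subst h; simp
  · rw [if_neg (by simpa using h)]; simp [Pi.single_eq_of_ne h]

variable (hc : ∀ p q, p ≠ q → IsCoprime (pp p) (pp q))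
variable [IsDomain R] (h0 : ∀ p, pp p ≠ 0)

lemma pow_smul_zero (i : ℕ × P) (x : Lam pp i) : pp i.2 ^ (i.1 + 1) • x = 0 := by
  rw [← rep_smul_one pp x, smul_comm, Algebra.smul_def (pp i.2 ^ (i.1 + 1))]
  have : algebraMap R (Lam pp i) (pp i.2 ^ (i.1 + 1)) = 0 :=
    Ideal.Quotient.eq_zero_iff_mem.2 (Ideal.mem_span_singleton_self _)
  rw [this, zero_mul, smul_zero]

lemma pow_smul_ent (r : Md pp c →ₗ[R] Md pp c') (a : ι') (b : ι) :
    pp (c b).2 ^ ((c b).1 + 1) • ent r a b = 0 := by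
  have : pp (c b).2 ^ ((c b).1 + 1) • (Pi.single b 1 : Md pp c) = 0 := by
    rw [← Pi.single_smul, pow_smul_zero, Pi.single_zero]
  have h := congrFun (map_smul r (pp (c b).2 ^ ((c b).1 + 1)) (Pi.single b 1 : Md pp c)) a
  rw [this, map_zero] at h
  exact h.symm

include hc in
lemma ent_ne (r : Md pp c →ₗ[R] Md pp c') (a : ι') (b : ι) (h : (c' a).2 ≠ (c b).2) :
    ent r a b = 0 := by
  obtain ⟨u, v, huv⟩ := ((hc _ _ h).pow (m := (c' a).1 + 1) (n := (c b).1 + 1))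
  rw [← one_smul R (ent r a b), ← huv, add_smul, mul_smul, mul_smul, pow_smul_ent, pow_smul_zero]
  simp

include h0 in
lemma ent_eq (r : Md pp c →ₗ[R] Md pp c') (a : ι') (b : ι) (h : (c' a).2 = (c b).2) :
    ∃ w, ent r a b = pp (c' a).2 ^ ((c' a).1 - (c b).1) • w := by
  by_cases hle : (c' a).1 ≤ (c b).1
  · rw [Nat.sub_eq_zero_of_le hle]; exact ⟨_, by rw [pow_zero, one_smul]⟩
  have h1 := pow_smul_ent r a b
  rw [← h, ← mk_rep pp (ent r a b), Algebra.smul_def] at h1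
  have h2 : pp (c' a).2 ^ ((c b).1 + 1) * rep pp (ent r a b) ∈
    Ideal.span {pp (c' a).2 ^ ((c' a).1 + 1)} := by
    rw [← Ideal.Quotient.eq_zero_iff_mem, map_mul]; exact h1
  rw [Ideal.mem_span_singleton, show (c' a).1 + 1 = ((c b).1 + 1) + ((c' a).1 - (c b).1) by omega,
    pow_add _ ((c b).1 + 1), mul_dvd_mul_iff_left (pow_ne_zero _ (h0 _))] at h2
  obtain ⟨w, hw⟩ := h2
  refine ⟨Ideal.Quotient.mk _ w, ?_⟩
  rw [← mk_rep pp (ent r a b), hw, map_mul, Algebra.smul_def]; rfl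

include hc h0 in
lemma res_ent (r : Md pp c →ₗ[R] Md pp c') (a : ι') (b : ι)
    (h : (c' a).2 ≠ (c b).2 ∨ (c b).1 < (c' a).1) : res pp _ (ent r a b) = 0 := by
  by_cases h2 : (c' a).2 = (c b).2
  · obtain ⟨w, hw⟩ := ent_eq h0 r a b h2
    rw [hw, res_smul, map_pow, mk_pp, zero_pow (by
      have := h.resolve_left (not_not.2 h2)
      omega), zero_mul]
  · rw [ent_ne hc r a b h2, map_zero]

include hc h0 in
lemma DD_comp (i : ℕ × P) (r : Md pp c' →ₗ[R] Md pp c'') (s : Md pp c →ₗ[R] Md pp c') :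
    DD i (r ∘ₗ s) = DD i r * DD i s := by
  classical
  ext ⟨a, rfl⟩ ⟨b, hb⟩
  rw [DD_apply, Matrix.mul_apply]
  have h1 : ent (r ∘ₗ s) a b = ∑ x, rep pp (ent s x b) • ent r a x := by
    rw [ent, LinearMap.comp_apply, apply_eq_sum]
    exact Finset.sum_congr rfl fun x _ => apply_single r a x _
  rw [h1, map_sum]
  rw [← Finset.sum_subset (Finset.subset_univ (Finset.univ.filter fun x => c' x = c'' a))]
  · rw [Finset.sum_subtype _ (p := fun x => c' x = c'' a) (by simp)]
    refine Finset.sum_congr rfl fun x _ => ?_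
    rw [DD_apply, res_smul, mul_comm]; rfl
  · intro x _ hx
    have hx' : c' x ≠ c'' a := by simpa using hx
    rw [res_smul]
    by_cases h2 : (c'' a).2 ≠ (c' x).2 ∨ (c' x).1 < (c'' a).1
    · rw [res_ent hc h0 r a x h2, mul_zero]
    · push Not at h2
      have hlt : (c b).1 < (c' x).1 := by
        rw [hb]
        refine lt_of_le_of_ne h2.2 fun h => hx' (Prod.ext h.symm h2.1.symm)
      have h3 := res_ent hc h0 s x b (Or.inr hlt)
      rw [← mk_rep pp (ent s x b), res_mk, Ideal.Quotient.eq_zero_iff_mem, ← h2.1,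
        ← Ideal.Quotient.eq_zero_iff_mem] at h3
      rw [h3, zero_mul]

include hc h0 in
/-- nilpotence of the kernel -/
lemma DD_nil (r : Md pp c →ₗ[R] Md pp c) (hr : ∀ i, DD i r = 0) (m : Md pp c) (hm : r m = m) :
    m = 0 := by
  obtain ⟨E, hE⟩ : ∃ E, ∀ a, (c a).1 ≤ E := ⟨Finset.univ.sup fun a => (c a).1, fun a =>
    Finset.le_sup (f := fun a => (c a).1) (Finset.mem_univ a)⟩
  have key : ∀ L, ∀ a j, 2 * j + E ≤ L + (c a).1 → ∃ y, m a = pp (c a).2 ^ j • y := by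
    intro L
    induction L with
    | zero =>
      intro a j h
      have := hE a
      obtain rfl : j = 0 := by omega
      exact ⟨m a, by simp⟩
    | succ L ih =>
      intro a j h
      have hsum : m a = ∑ b, r (Pi.single b (m b)) a := by
        conv_lhs => rw [← hm]
        exact apply_eq_sum r m a
      have hterm : ∀ b, ∃ y, r (Pi.single b (m b)) a = pp (c a).2 ^ j • y := by
        intro b
        by_cases hp : (c a).2 = (c b).2
        · obtain ⟨k, j', hk, hj, w, hw⟩ : ∃ k j', j ≤ k + j' ∧
              (2 * j' + E ≤ L + (c b).1 ∨ j' = 0) ∧ ∃ w, ent r a b = pp (c a).2 ^ k • w := by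
            rcases lt_trichotomy (c b).1 (c a).1 with hlt | heq | hgt
            · refine ⟨(c a).1 - (c b).1, j - ((c a).1 - (c b).1), by omega, by omega, ?_⟩
              exact ent_eq h0 r a b hp
            · refine ⟨1, j - 1, by omega, by omega, ?_⟩
              have hcol : c b = c a := Prod.ext heq hp.symm
              have h1 : res pp _ (ent r a b) = 0 := by
                rw [← DD_apply r a ⟨b, hcol⟩, hr]; rfl
              rw [pow_one]
              exact res_zero pp _ h1
            · refine ⟨0, j, by omega, by omega, ?_⟩
              exact ⟨_, by rw [pow_zero, one_smul]⟩
          obtain ⟨y, hy⟩ : ∃ y, m b = pp (c b).2 ^ j' • y := by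
            rcases hj with hj | rfl
            · exact ih b j' hj
            · exact ⟨m b, by simp⟩
          refine ⟨pp (c a).2 ^ (k + j' - j) • rep pp y • w, ?_⟩
          rw [hy, Pi.single_smul, map_smul, Pi.smul_apply, apply_single, hw, ← hp, smul_comm (rep pp y),
            ← mul_smul, ← mul_smul (pp (c a).2 ^ j), ← pow_add, ← pow_add]
          congr 2; omega
        · exact ⟨0, by rw [apply_single, ent_ne hc r a b hp]; simp⟩
      choose y hy using hterm
      exact ⟨∑ b, y b, by rw [hsum, Finset.smul_sum]; exact Finset.sum_congr rfl fun b _ => hy b⟩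
  funext a
  obtain ⟨y, hy⟩ := key (2 * E + 2) a ((c a).1 + 1) (by have := hE a; omega)
  rw [hy, pow_smul_zero]; rfl

end absD
end FFU

end file_P4a

section file_P4b
open Finset
namespace FFU
set_option linter.unusedSectionVars false
set_option linter.style.haveILetI false

lemma card_fiber {A B : Type*} [AddCommGroup A] [AddCommGroup B] [Finite A] (f : A →+ B)
    (hf : Function.Surjective f) (S : B → Prop) :
    Nat.card {a // S (f a)} * Nat.card B = Nat.card A * Nat.card {b // S b} := by
  have key : ∀ S : B → Prop, Nat.card {a // S (f a)} = Nat.card f.ker * Nat.card {b // S b} := by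
    intro S
    rw [← Nat.card_prod]
    let s := Function.surjInv hf
    have hs : ∀ b, f (s b) = b := Function.surjInv_eq hf
    refine Nat.card_congr
      { toFun := fun a => ⟨⟨a.1 - s (f a.1), by simp [AddMonoidHom.mem_ker, hs]⟩, f a.1, a.2⟩
        invFun := fun p => ⟨p.1.1 + s p.2.1, by
          have h : f p.1.1 = 0 := p.1.2
          rw [map_add, hs, h, zero_add]; exact p.2.2⟩
        left_inv := fun a => by simp
        right_inv := fun p => by
          have h : f p.1.1 = 0 := p.1.2
          simp [hs, h] }
  have h1 := key fun _ => True
  have h2 : Nat.card {a : A // True} = Nat.card A := Nat.card_congr (Equiv.subtypeUnivEquiv fun _ => trivial)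
  have h3 : Nat.card {b : B // True} = Nat.card B := Nat.card_congr (Equiv.subtypeUnivEquiv fun _ => trivial)
  rw [h2, h3] at h1
  rw [key S, h1]; ring

section absD
variable {R P : Type} [CommRing R] [DecidableEq P] {pp : P → R}
variable {ι ι' : Type} [Fintype ι] [DecidableEq ι] [Fintype ι'] [DecidableEq ι']
variable {c : ι → ℕ × P} {c' : ι' → ℕ × P}

noncomputable def castL (pp : P → R) {i j : ℕ × P} (h : i = j) : Lam pp i →ₗ[R] Lam pp j :=
  h ▸ LinearMap.id

lemma castL_one {i j : ℕ × P} (h : i = j) : castL pp h 1 = 1 := by subst h; rfl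

lemma DD_surj (Z : ∀ i : ℕ × P, Matrix {a : ι' // c' a = i} {b : ι // c b = i} (kap pp i.2)) :
    ∃ r : Md pp c →ₗ[R] Md pp c', ∀ i, DD i r = Z i := by
  let z : ∀ a : ι', {b : ι // c b = c' a} → R := fun a b =>
    Function.surjInv Ideal.Quotient.mk_surjective (Z (c' a) ⟨a, rfl⟩ b)
  have hz : ∀ a b, Ideal.Quotient.mk _ (z a b) = Z (c' a) ⟨a, rfl⟩ b := fun a b =>
    Function.surjInv_eq Ideal.Quotient.mk_surjective _
  refine ⟨LinearMap.pi fun a => ∑ b : {b : ι // c b = c' a},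
    z a b • (castL pp b.2 ∘ₗ LinearMap.proj b.1), fun i => ?_⟩
  ext ⟨a, rfl⟩ b
  rw [DD_apply, ← hz, ent, LinearMap.pi_apply, LinearMap.sum_apply, Finset.sum_eq_single b]
  · rw [LinearMap.smul_apply, LinearMap.comp_apply, LinearMap.proj_apply, Pi.single_eq_same, castL_one,
      res_smul, map_one, mul_one]
  · intro x _ hx
    rw [LinearMap.smul_apply, LinearMap.comp_apply, LinearMap.proj_apply, Pi.single_eq_of_ne
      (fun h => hx (Subtype.ext h)), map_zero, smul_zero]
  · simp

variable (hc : ∀ p q, p ≠ q → IsCoprime (pp p) (pp q))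
variable [IsDomain R] (h0 : ∀ p, pp p ≠ 0)

include hc h0 in
lemma DD_card_eq [∀ p, Nontrivial (kap pp p)] (e : Md pp c ≃ₗ[R] Md pp c') (i : ℕ × P) :
    Fintype.card {a : ι // c a = i} = Fintype.card {a : ι' // c' a = i} := by
  have h1 : DD i e.symm.toLinearMap * DD i e.toLinearMap = 1 := by
    rw [← DD_comp hc h0, ← DD_id]; congr 1; ext; simp
  have h2 : DD i e.toLinearMap * DD i e.symm.toLinearMap = 1 := by
    rw [← DD_comp hc h0, ← DD_id]; congr 1; ext; simp
  exact card_eq_of_linearEquiv (kap pp i.2) (Matrix.toLin'OfInv h1 h2)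

variable [Finite (Md pp c)]

include hc h0 in
lemma bij_iff (r : Md pp c →ₗ[R] Md pp c) :
    Function.Bijective r ↔ ∀ i, IsUnit (DD i r) := by
  constructor
  · intro h i
    let e := LinearEquiv.ofBijective r h
    have h1 : DD i e.symm.toLinearMap * DD i e.toLinearMap = 1 := by
      rw [← DD_comp hc h0, ← DD_id]; congr 1; ext; simp
    exact IsUnit.of_mul_eq_one_right _ h1
  · intro h
    choose u hu using fun i => (h i).exists_left_inv
    obtain ⟨s, hs⟩ := DD_surj (c := c) (c' := c) u
    rw [← Finite.injective_iff_bijective]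
    rw [injective_iff_map_eq_zero]
    intro m hm
    refine DD_nil hc h0 (LinearMap.id - s ∘ₗ r) (fun i => ?_) m ?_
    · rw [sub_eq_add_neg, DD_add, ← neg_one_smul R, DD_smul, DD_comp hc h0, hs, hu, DD_id]
      simp
    · simp [hm]

/-- total residue map -/
noncomputable def DDall (c : ι → ℕ × P) : (Md pp c →ₗ[R] Md pp c) →+
    (∀ i : Set.range c, Matrix {a : ι // c a = i.1} {b : ι // c b = i.1} (kap pp i.1.2)) where
  toFun r i := DD i.1 r
  map_add' r s := by funext i; exact DD_add _ _ _
  map_zero' := by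
    funext i
    have := DD_add i.1 (0 : Md pp c →ₗ[R] Md pp c) 0
    rw [add_zero] at this
    exact left_eq_add.1 this

lemma DDall_surj : Function.Surjective (DDall (pp := pp) c) := by
  classical
  intro Z
  obtain ⟨r, hr⟩ := DD_surj (pp := pp) (c := c) (c' := c)
    (fun i => if h : i ∈ Set.range c then Z ⟨i, h⟩ else 0)
  refine ⟨r, ?_⟩
  funext i
  change DD i.1 r = _
  rw [hr, dif_pos i.2]

include hc h0 in
lemma bij_iff' (r : Md pp c →ₗ[R] Md pp c) :
    Function.Bijective r ↔ ∀ i, IsUnit (DDall c r i) := by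
  rw [bij_iff hc h0]
  refine ⟨fun h i => h i.1, fun h i => ?_⟩
  by_cases hi : i ∈ Set.range c
  · exact h ⟨i, hi⟩
  · haveI : IsEmpty {a : ι // c a = i} := ⟨fun a => hi ⟨a.1, a.2⟩⟩
    exact isUnit_of_subsingleton _

instance finEnd : Finite (Md pp c →ₗ[R] Md pp c) :=
  Finite.of_injective (fun r => (r : Md pp c → Md pp c)) DFunLike.coe_injective

include hc h0 in
lemma aut_card : Nat.card {r : Md pp c →ₗ[R] Md pp c // Function.Bijective r} *
    (∏ i : Set.range c, Nat.card (Matrix {a : ι // c a = i.1} {b : ι // c b = i.1} (kap pp i.1.2))) =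
    Nat.card (Md pp c →ₗ[R] Md pp c) *
    ∏ i : Set.range c, Nat.card {g : Matrix {a : ι // c a = i.1} {b : ι // c b = i.1} (kap pp i.1.2) //
      IsUnit g} := by
  have h := card_fiber (DDall (pp := pp) c) DDall_surj (fun Z => ∀ i, IsUnit (Z i))
  rw [Nat.card_pi] at h
  have e : {Z : ∀ i : Set.range c, Matrix {a : ι // c a = i.1} {b : ι // c b = i.1} (kap pp i.1.2) //
      ∀ i, IsUnit (Z i)} ≃ ∀ i : Set.range c,
      {g : Matrix {a : ι // c a = i.1} {b : ι // c b = i.1} (kap pp i.1.2) // IsUnit g} :=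
    Equiv.subtypePiEquivPi
  rw [Nat.card_congr e, Nat.card_pi] at h
  rw [← h]
  congr 1
  exact Nat.card_congr (Equiv.subtypeEquivRight fun r => bij_iff' hc h0 r)

end absD
end FFU

end file_P4b

section file_P4c
open Finset Polynomial
namespace FFU
set_option linter.unusedSectionVars false
set_option linter.style.haveILetI false

/-- `K/F` is a quadratic extension with involution `star`. -/
class HermPair (F K : Type) [Field F] [Field K] [Algebra F K] [StarRing K] : Prop where
  fix : ∀ x : K, star x = x ↔ x ∈ Set.range (algebraMap F K)
  ne : ∃ x : K, star x ≠ x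

section base
variable {K : Type} [Field K] [StarRing K]

noncomputable instance polyStar : StarRing K[X] where
  star f := f.map (starRingEnd K)
  star_involutive f := by
    change (f.map (starRingEnd K)).map (starRingEnd K) = f
    rw [Polynomial.map_map, show (starRingEnd K).comp (starRingEnd K) = RingHom.id K from by ext; simp,
      Polynomial.map_id]
  star_mul f g := by rw [Polynomial.map_mul, mul_comm]
  star_add f g := Polynomial.map_add _

lemma poly_star_def (f : K[X]) : star f = f.map (starRingEnd K) := rfl
lemma poly_star_C (a : K) : star (C a : K[X]) = C (star a) := by
  rw [poly_star_def, map_C]; rfl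
lemma poly_star_X : star (X : K[X]) = X := by simp [poly_star_def]

variable {R : Type} [CommRing R] [StarRing R]

/-- quotient of a star ring by a star-stable ideal -/
noncomputable abbrev quotStar (I : Ideal R) (hI : ∀ x ∈ I, star x ∈ I) : StarRing (R ⧸ I) where
  star := Ideal.quotientMap I (starRingEnd R) (show I ≤ I.comap (starRingEnd R) from fun x hx => hI x hx)
  star_involutive x := by
    obtain ⟨x, rfl⟩ := Ideal.Quotient.mk_surjective x
    rw [Ideal.quotientMap_mk, Ideal.quotientMap_mk]; simp
  star_mul x y := by rw [map_mul, mul_comm]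
  star_add x y := map_add _ _ _

lemma span_star {x : R} (hx : star x = x) : ∀ y ∈ Ideal.span {x}, star y ∈ Ideal.span {x} := by
  intro y hy
  rw [Ideal.mem_span_singleton] at hy ⊢
  obtain ⟨z, rfl⟩ := hy
  exact ⟨star z, by rw [star_mul, hx, mul_comm]⟩
end base

section conc
variable (F K : Type) [Field F] [Field K] [Algebra F K] [StarRing K]

noncomputable def ppF (p : PI F) : K[X] := p.1.map (algebraMap F K)

variable {F K}
lemma ppF_monic (p : PI F) : (ppF F K p).Monic := p.2.1.map _
lemma ppF_ne (p : PI F) : ppF F K p ≠ 0 := (ppF_monic p).ne_zero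
lemma ppF_deg (p : PI F) : (ppF F K p).natDegree = pdeg F p := natDegree_map _
lemma ppF_cop (p q : PI F) (h : p ≠ q) : IsCoprime (ppF F K p) (ppF F K q) := by
  have : IsCoprime p.1 q.1 := by
    rw [p.2.2.coprime_iff_not_dvd]
    intro hd
    exact h (Subtype.ext (eq_of_monic_of_associated p.2.1 q.2.1
      ((p.2.2.dvd_irreducible_iff_associated q.2.2).1 hd)))
  exact this.map (mapRingHom (algebraMap F K))

variable [HermPair F K]
lemma ppF_star (p : PI F) : star (ppF F K p) = ppF F K p := by
  rw [poly_star_def, ppF, Polynomial.map_map]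
  congr 1
  refine RingHom.ext fun x => ?_
  exact (HermPair.fix (F := F) (algebraMap F K x)).2 ⟨x, rfl⟩

noncomputable instance lamStar (p : PI F) (k : ℕ) : StarRing (K[X] ⧸ Ideal.span {ppF F K p ^ k}) :=
  quotStar _ (span_star (by rw [star_pow, ppF_star]))

noncomputable instance kapStar (p : PI F) : StarRing (K[X] ⧸ Ideal.span {ppF F K p}) :=
  quotStar _ (span_star (ppF_star p))

lemma star_mk_lam (i : ℕ × PI F) (x : K[X]) :
    star (Ideal.Quotient.mk _ x : Lam (ppF F K) i) = Ideal.Quotient.mk _ (star x) := rfl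
lemma star_mk_kap (p : PI F) (x : K[X]) :
    star (Ideal.Quotient.mk _ x : kap (ppF F K) p) = Ideal.Quotient.mk _ (star x) := rfl

noncomputable instance piDec (F : Type) [Field F] : DecidableEq (PI F) := Classical.decEq _

/-- the functional top coefficient of the remainder -/
noncomputable def LL (g f : K[X]) : K := (f %ₘ g).coeff (g.natDegree - 1)

lemma LL_add (g : K[X]) (f f' : K[X]) : LL g (f + f') = LL g f + LL g f' := by
  rw [LL, add_modByMonic, coeff_add]; rfl

lemma LL_smul (g : K[X]) (a : K) (f : K[X]) : LL g (C a * f) = a * LL g f := by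
  rw [LL, ← smul_eq_C_mul, smul_modByMonic, coeff_smul]; rfl

lemma LL_star {g : K[X]} (hg : g.Monic) (hs : star g = g) (f : K[X]) : LL g (star f) = star (LL g f) := by
  rw [LL, LL, poly_star_def]
  conv_lhs => rw [← hs, poly_star_def]
  rw [← map_modByMonic _ hg, coeff_map, natDegree_map]; rfl

lemma LL_mem {g : K[X]} (hg : g.Monic) {f : K[X]} (hf : g ∣ f) : LL g f = 0 := by
  rw [LL, (modByMonic_eq_zero_iff_dvd hg).2 hf, coeff_zero]

lemma LL_nondeg {g : K[X]} (hg : g.Monic) (f : K[X]) (h : ∀ z, LL g (z * f) = 0) : g ∣ f := by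
  rw [← modByMonic_eq_zero_iff_dvd hg]
  by_contra hne
  set f' := f %ₘ g with hf'
  have hd : f'.natDegree < g.natDegree := by
    apply natDegree_modByMonic_lt _ hg
    rintro rfl
    simp at hf'; exact hne hf'
  have h1 := h (X ^ (g.natDegree - 1 - f'.natDegree))
  have h2 : (X ^ (g.natDegree - 1 - f'.natDegree) * f) %ₘ g =
      X ^ (g.natDegree - 1 - f'.natDegree) * f' := by
    have : X ^ (g.natDegree - 1 - f'.natDegree) * f = X ^ (g.natDegree - 1 - f'.natDegree) * f' +
        g * (X ^ (g.natDegree - 1 - f'.natDegree) * (f /ₘ g)) := by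
      conv_lhs => rw [← modByMonic_add_div f g]
      ring
    rw [this, add_modByMonic, (modByMonic_eq_zero_iff_dvd hg).2 (dvd_mul_right _ _), add_zero,
      modByMonic_eq_self_iff hg]
    apply degree_lt_degree
    rw [natDegree_mul (by simp) hne, natDegree_X_pow]
    omega
  rw [LL, h2, coeff_X_pow_mul', if_pos (by omega)] at h1
  rw [show g.natDegree - 1 - (g.natDegree - 1 - f'.natDegree) = f'.natDegree by omega] at h1
  exact hne (leadingCoeff_eq_zero.1 h1)

noncomputable def gg (F K : Type) [Field F] [Field K] [Algebra F K] (i : ℕ × PI F) : K[X] :=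
  ppF F K i.2 ^ (i.1 + 1)
lemma gg_monic (i : ℕ × PI F) : (gg F K i).Monic := (ppF_monic i.2).pow _
lemma gg_star (i : ℕ × PI F) : star (gg F K i) = gg F K i := by rw [gg, star_pow, ppF_star]

noncomputable def ell (i : ℕ × PI F) (x : Lam (ppF F K) i) : K := LL (gg F K i) (rep _ x)

lemma ell_mk (i : ℕ × PI F) (f : K[X]) : ell i (Ideal.Quotient.mk _ f : Lam (ppF F K) i) =
    LL (gg F K i) f := by
  have h : (Ideal.Quotient.mk _ (rep (ppF F K) (Ideal.Quotient.mk _ f : Lam (ppF F K) i)) :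
      Lam (ppF F K) i) = Ideal.Quotient.mk _ f := mk_rep _ _
  rw [Ideal.Quotient.eq, Ideal.mem_span_singleton] at h
  have h2 := LL_mem (gg_monic i) h
  have h3 := LL_add (gg F K i) (rep (ppF F K) (Ideal.Quotient.mk _ f : Lam (ppF F K) i) - f) f
  rw [h2, sub_add_cancel, zero_add] at h3
  exact h3

lemma ell_add (i : ℕ × PI F) (x y : Lam (ppF F K) i) : ell i (x + y) = ell i x + ell i y := by
  obtain ⟨x, rfl⟩ := Ideal.Quotient.mk_surjective x
  obtain ⟨y, rfl⟩ := Ideal.Quotient.mk_surjective y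
  rw [← map_add, ell_mk, ell_mk, ell_mk, LL_add]

lemma ell_smul (i : ℕ × PI F) (a : K) (x : Lam (ppF F K) i) :
    ell i ((C a : K[X]) • x) = a * ell i x := by
  obtain ⟨x, rfl⟩ := Ideal.Quotient.mk_surjective x
  rw [Algebra.smul_def, Ideal.Quotient.algebraMap_eq, ← map_mul, ell_mk, ell_mk, LL_smul]

lemma ell_star (i : ℕ × PI F) (x : Lam (ppF F K) i) : ell i (star x) = star (ell i x) := by
  obtain ⟨x, rfl⟩ := Ideal.Quotient.mk_surjective x
  rw [star_mk_lam, ell_mk, ell_mk, LL_star (gg_monic i) (gg_star i)]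

lemma ell_nondeg (i : ℕ × PI F) (x : Lam (ppF F K) i) (h : ∀ z, ell i (z * x) = 0) : x = 0 := by
  obtain ⟨x, rfl⟩ := Ideal.Quotient.mk_surjective x
  rw [Ideal.Quotient.eq_zero_iff_mem, Ideal.mem_span_singleton]
  refine LL_nondeg (gg_monic i) x fun z => ?_
  rw [← ell_mk, map_mul]; exact h _

end conc
end FFU

end file_P4c

section file_P4d
open Finset Polynomial
namespace FFU
set_option linter.unusedSectionVars false
set_option linter.style.haveILetI false

section sa
variable {K : Type} [Field K] [StarRing K]

lemma sa_sq {E : Type*} [AddCommGroup E] [Module K E] [Finite E] (hs : ∃ x : K, star x ≠ x)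
    (st : E → E) (hadd : ∀ u v, st (u + v) = st u + st v) (hinv : ∀ u, st (st u) = u)
    (hsm : ∀ (a : K) u, st (a • u) = star a • st u) :
    Nat.card E = Nat.card {u : E // st u = u} ^ 2 := by
  obtain ⟨x, hx⟩ := hs
  have hx0 : x - star x ≠ 0 := sub_ne_zero.2 (Ne.symm hx)
  have hx1 : star x - x ≠ 0 := sub_ne_zero.2 hx
  rw [sq, ← Nat.card_prod]
  symm
  refine Nat.card_congr (Equiv.ofBijective (fun p => p.1.1 + x • p.2.1) ⟨?_, ?_⟩)
  · rintro ⟨⟨u, hu⟩, ⟨v, hv⟩⟩ ⟨⟨u', hu'⟩, ⟨v', hv'⟩⟩ h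
    simp only at h
    have h2 := congrArg st h
    rw [hadd, hadd, hsm, hsm, hu, hu', hv, hv'] at h2
    have h3 : (x - star x) • (v - v') = 0 := by
      have : (u + x • v) - (u + star x • v) = (u' + x • v') - (u' + star x • v') := by rw [h, h2]
      rw [add_sub_add_left_eq_sub, add_sub_add_left_eq_sub, ← sub_smul, ← sub_smul] at this
      rw [smul_sub, this, sub_self]
    have h4 : v = v' := by
      rcases smul_eq_zero.1 h3 with h | h
      · exact absurd h hx0
      · exact sub_eq_zero.1 h
    subst h4
    have h5 := add_right_cancel h
    subst h5
    rfl
  · intro r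
    have hneg : ∀ u, st (-u) = -st u := by
      intro u; have := hsm (-1) u; simpa using this
    have hsub : ∀ u v, st (u - v) = st u - st v := fun u v => by
      rw [sub_eq_add_neg, hadd, hneg, ← sub_eq_add_neg]
    refine ⟨⟨⟨(x - star x)⁻¹ • (x • st r - star x • r), ?_⟩, ⟨(x - star x)⁻¹ • (r - st r), ?_⟩⟩, ?_⟩
    · rw [hsm, hsub, hsm, hsm, hinv, star_star, star_inv₀, star_sub, star_star,
        ← neg_sub x (star x), inv_neg, neg_smul, ← smul_neg]
      congr 1; abel
    · rw [hsm, hsub, hinv, star_inv₀, star_sub, star_star,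
        ← neg_sub x (star x), inv_neg, neg_smul, ← smul_neg]
      congr 1; abel
    · simp only
      rw [smul_comm x, ← smul_add, smul_sub x, inv_smul_eq_iff₀ hx0, sub_smul]
      abel

variable {V : Type} [AddCommGroup V] [Module K[X] V]

structure IsHF (h : V → V → K) : Prop where
  add : ∀ u v w, h (u + v) w = h u w + h v w
  smul : ∀ (a : K) v w, h ((C a : K[X]) • v) w = a * h v w
  bal : ∀ (f : K[X]) v w, h (f • v) w = h v (star f • w)
  herm : ∀ v w, star (h v w) = h w v
  nondeg : ∀ v, (∀ w, h v w = 0) → v = 0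

namespace IsHF
variable {h : V → V → K} (H : IsHF h)
include H
lemma add_right (u v w : V) : h u (v + w) = h u v + h u w := by
  rw [← H.herm, H.add, star_add, H.herm, H.herm]
lemma smul_right (a : K) (v w : V) : h v ((C a : K[X]) • w) = star a * h v w := by
  rw [← H.herm, H.smul, star_mul, H.herm, mul_comm]
lemma zero_left (w : V) : h 0 w = 0 := by
  have := H.add 0 0 w; rw [add_zero] at this; exact left_eq_add.1 this
lemma zero_right (w : V) : h w 0 = 0 := by rw [← H.herm, H.zero_left, star_zero]
lemma neg_left (v w : V) : h (-v) w = - h v w := by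
  have := H.add v (-v) w
  rw [add_neg_cancel, H.zero_left] at this
  exact (neg_eq_of_add_eq_zero_right this.symm).symm
lemma sub_left (u v w : V) : h (u - v) w = h u w - h v w := by
  rw [sub_eq_add_neg, H.add, H.neg_left, sub_eq_add_neg]
lemma sub_right (u v w : V) : h u (v - w) = h u v - h u w := by
  rw [← H.herm, H.sub_left, star_sub, H.herm, H.herm]
lemma nondeg_right (v : V) (hv : ∀ w, h w v = 0) : v = 0 :=
  H.nondeg v fun w => by rw [← H.herm, hv, star_zero]
lemma eq_right (v v' : V) (hv : ∀ w, h w v = h w v') : v = v' :=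
  sub_eq_zero.1 (H.nondeg_right _ fun w => by rw [H.sub_right, hv, sub_self])

lemma dual_surj [Finite V] [Finite K] (φ : V → K) (ha : ∀ u v, φ (u + v) = φ u + φ v)
    (hs : ∀ (a : K) v, φ ((C a : K[X]) • v) = a * φ v) : ∃ w, ∀ v, φ v = h v w := by
  letI : Module K V := Module.compHom V (C : K →+* K[X])
  have hsm : ∀ (a : K) (v : V), a • v = (C a : K[X]) • v := fun _ _ => rfl
  let Ψ : V → Module.Dual K V := fun w =>
    { toFun := fun v => h v w
      map_add' := fun u v => H.add u v w
      map_smul' := fun a v => by rw [hsm]; exact H.smul a v w }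
  have hinj : Function.Injective Ψ := fun w w' hw => H.eq_right w w' fun v =>
    congrArg (fun f : Module.Dual K V => f v) hw
  haveI : Module.Finite K V := Module.Finite.of_finite
  have hcard : Nat.card (Module.Dual K V) = Nat.card V := by
    rw [Module.natCard_eq_pow_finrank (K := K), Module.natCard_eq_pow_finrank (K := K) (V := V),
      Subspace.dual_finrank_eq]
  haveI : Finite (Module.Dual K V) := Finite.of_injective (fun f : Module.Dual K V => (f : V → K))
    DFunLike.coe_injective
  have hb : Function.Bijective Ψ := (Nat.bijective_iff_injective_and_card Ψ).2 ⟨hinj, hcard.symm⟩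
  obtain ⟨w, hw⟩ := hb.2 { toFun := φ, map_add' := ha, map_smul' := fun a v => by rw [hsm]; exact hs a v }
  exact ⟨w, fun v => (congrArg (fun f : Module.Dual K V => f v) hw).symm⟩

lemma exists_adj [Finite V] [Finite K] (r : V →ₗ[K[X]] V) :
    ∃ r' : V →ₗ[K[X]] V, ∀ v w, h (r v) w = h v (r' w) := by
  have : ∀ w, ∃ w', ∀ v, h (r v) w = h v w' := fun w =>
    H.dual_surj (fun v => h (r v) w) (fun u v => by rw [map_add, H.add])
      (fun a v => by rw [map_smul, H.smul])
  choose g hg using this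
  refine ⟨{ toFun := g, map_add' := fun u v => ?_, map_smul' := fun f v => ?_ }, fun v w => hg w v⟩
  · refine H.eq_right _ _ fun w => ?_
    rw [← hg, H.add_right, H.add_right, hg, hg]
  · refine H.eq_right _ _ fun w => ?_
    rw [← hg, RingHom.id_apply, ← star_star f, ← H.bal, ← H.bal, ← map_smul, hg]

/-- the adjoint -/
noncomputable def adj [Finite V] [Finite K] (r : V →ₗ[K[X]] V) : V →ₗ[K[X]] V :=
  (H.exists_adj r).choose

lemma adj_spec [Finite V] [Finite K] (r : V →ₗ[K[X]] V) (v w : V) : h (r v) w = h v (H.adj r w) :=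
  (H.exists_adj r).choose_spec v w

lemma adj_unique [Finite V] [Finite K] (r r' : V →ₗ[K[X]] V) (hr : ∀ v w, h (r v) w = h v (r' w)) :
    H.adj r = r' := by
  refine LinearMap.ext fun w => H.eq_right _ _ fun v => ?_
  rw [← H.adj_spec, hr]

lemma adj_adj [Finite V] [Finite K] (r : V →ₗ[K[X]] V) : H.adj (H.adj r) = r := by
  refine H.adj_unique _ _ fun v w => ?_
  rw [← H.herm, ← H.adj_spec, H.herm]

lemma adj_add [Finite V] [Finite K] (r s : V →ₗ[K[X]] V) : H.adj (r + s) = H.adj r + H.adj s := by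
  refine H.adj_unique _ _ fun v w => ?_
  rw [LinearMap.add_apply, LinearMap.add_apply, H.add, H.add_right, H.adj_spec, H.adj_spec]

lemma adj_smul [Finite V] [Finite K] (f : K[X]) (r : V →ₗ[K[X]] V) :
    H.adj (f • r) = star f • H.adj r := by
  refine H.adj_unique _ _ fun v w => ?_
  rw [LinearMap.smul_apply, LinearMap.smul_apply, ← map_smul, ← map_smul, ← H.adj_spec, map_smul, H.bal, ]

lemma sa_iff [Finite V] [Finite K] (r : V →ₗ[K[X]] V) :
    (∀ v w, h (r v) w = h v (r w)) ↔ H.adj r = r :=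
  ⟨H.adj_unique r r, fun h2 v w => by conv_rhs => rw [← h2]
                                      exact H.adj_spec r v w⟩

instance _root_.FFU.finEndV [Finite V] : Finite (V →ₗ[K[X]] V) :=
  Finite.of_injective (fun r => (r : V → V)) DFunLike.coe_injective

lemma end_card [Finite V] [Finite K] (hs : ∃ x : K, star x ≠ x) :
    Nat.card (V →ₗ[K[X]] V) = Nat.card {r : V →ₗ[K[X]] V // H.adj r = r} ^ 2 := by
  letI : Module K (V →ₗ[K[X]] V) := Module.compHom _ (C : K →+* K[X])
  refine sa_sq hs H.adj H.adj_add H.adj_adj fun a u => ?_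
  change H.adj ((C a : K[X]) • u) = (C (star a) : K[X]) • H.adj u
  rw [H.adj_smul, poly_star_C]
end IsHF
end sa
end FFU

end file_P4d

section file_P4e
open Finset Polynomial Matrix
namespace FFU
set_option linter.unusedSectionVars false
set_option linter.style.haveILetI false

/-- local counting identity -/
def LocalId (A : Type) [CommRing A] [StarRing A] (n : Type) [Fintype n] [DecidableEq n] (w : ℝ) : Prop :=
  (Nat.card {X : Matrix n n A // X.IsHermitian ∧ IsUnit X} : ℝ) * Nat.card (Matrix n n A) =
    w * Nat.card {X : Matrix n n A // IsUnit X} * Nat.card {X : Matrix n n A // X.IsHermitian}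

lemma LocalId.congr {A : Type} [CommRing A] [StarRing A] {n k : Type} [Fintype n] [DecidableEq n]
    [Fintype k] [DecidableEq k] (e : k ≃ n) {w : ℝ} (h : LocalId A n w) : LocalId A k w := by
  have hu : ∀ X : Matrix n n A, IsUnit (X.submatrix e e) ↔ IsUnit X := fun X =>
    Matrix.isUnit_submatrix_equiv e e
  have hh : ∀ X : Matrix n n A, (X.submatrix e e).IsHermitian ↔ X.IsHermitian := fun X => by
    constructor
    · intro h
      have := h.submatrix e.symm
      simpa using this
    · intro h; exact h.submatrix e
  let E : Matrix n n A ≃ Matrix k k A := Matrix.reindex e.symm e.symm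
  have hE : ∀ X, E X = X.submatrix e e := fun X => rfl
  have h1 : Nat.card {X : Matrix k k A // X.IsHermitian ∧ IsUnit X} =
      Nat.card {X : Matrix n n A // X.IsHermitian ∧ IsUnit X} :=
    (Nat.card_congr (E.subtypeEquiv fun X => by rw [hE, hu, hh])).symm
  have h2 : Nat.card {X : Matrix k k A // IsUnit X} = Nat.card {X : Matrix n n A // IsUnit X} :=
    (Nat.card_congr (E.subtypeEquiv fun X => by rw [hE, hu])).symm
  have h3 : Nat.card {X : Matrix k k A // X.IsHermitian} =
      Nat.card {X : Matrix n n A // X.IsHermitian} :=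
    (Nat.card_congr (E.subtypeEquiv fun X => by rw [hE, hh])).symm
  have h4 : Nat.card (Matrix k k A) = Nat.card (Matrix n n A) := (Nat.card_congr E).symm
  rw [LocalId, h1, h2, h3, h4]; exact h

lemma card_matF {A : Type} [Finite A] (m : ℕ) : Nat.card (Matrix (Fin m) (Fin m) A) =
    Nat.card A ^ m ^ 2 := by
  haveI := Fintype.ofFinite A
  simp only [Matrix, Nat.card_pi, Finset.prod_const, Finset.card_univ, Fintype.card_fin]
  rw [← pow_mul, sq]

lemma local_field' {A : Type} [Field A] [StarRing A] [Finite A] {Q : ℕ}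
    (hQ : Nat.card A = Q ^ 2) (hF : Nat.card {a : A // star a = a} = Q) (hs : ∃ x : A, star x ≠ x)
    (hp : poch Q m ≠ 0) : LocalId A (Fin m) (poch Q m)⁻¹ := by
  have h1 := GL_HU hQ hF m
  have h2 := sa_sq (E := Matrix (Fin m) (Fin m) A) hs Matrix.conjTranspose
    Matrix.conjTranspose_add Matrix.conjTranspose_conjTranspose
    (fun a u => Matrix.conjTranspose_smul a u)
  rw [card_matF, hQ, ← pow_mul, mul_comm 2, pow_mul] at h2
  have h3 : Nat.card {X : Matrix (Fin m) (Fin m) A // X.IsHermitian} = Q ^ m ^ 2 :=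
    (Nat.pow_left_injective (n := 2) (by norm_num) h2).symm
  have h5 : (Nat.card {X : Matrix (Fin m) (Fin m) A // X.IsHermitian ∧ IsUnit X} : ℝ) =
    Nat.card (HU A (Fin m)) := rfl
  rw [LocalId, h3, h1, card_matF, hQ, h5]
  push_cast
  field_simp
  ring

lemma local_field {A : Type} [CommRing A] [StarRing A] [Finite A] (hA : IsField A) {Q m : ℕ}
    (hQ : Nat.card A = Q ^ 2) (hF : Nat.card {a : A // star a = a} = Q) (hs : ∃ x : A, star x ≠ x)
    (hp : poch Q m ≠ 0) : LocalId A (Fin m) (poch Q m)⁻¹ := by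
  letI : Field A := hA.toField
  exact local_field' hQ hF hs hp

lemma local_split {A B : Type} [CommRing A] [StarRing A] [Finite A] [Field B] [Finite B]
    (φ : A →+* B) (hφ : ∀ a, φ a = 0 → φ (star a) = 0 → a = 0) {N : ℕ} (hB : Nat.card B = N)
    (hA : Nat.card A = N ^ 2) (hN : 2 ≤ N) (m : ℕ) :
    LocalId A (Fin m) (∏ j ∈ range m, (1 - ((N : ℝ)⁻¹) ^ (j + 1)))⁻¹ := by
  let ψ : A →+* B := φ.comp (starRingEnd A)
  have hψ : ∀ a, ψ a = φ (star a) := fun a => rfl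
  have hinj : ∀ a b, φ a = φ b → ψ a = ψ b → a = b := fun a b h1 h2 =>
    sub_eq_zero.1 (hφ _ (by rw [map_sub, h1, sub_self]) (by rw [← hψ, map_sub, h2, sub_self]))
  have hb : Function.Bijective (φ.prod ψ) := by
    rw [Nat.bijective_iff_injective_and_card]
    refine ⟨fun a b h => hinj a b (congrArg Prod.fst h) (congrArg Prod.snd h), ?_⟩
    rw [Nat.card_prod, hB, hA, sq]
  have hunit : ∀ a, IsUnit a ↔ φ a ≠ 0 ∧ ψ a ≠ 0 := fun a => by
    let e := RingEquiv.ofBijective (φ.prod ψ) hb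
    rw [← isUnit_iff_ne_zero, ← isUnit_iff_ne_zero]
    change IsUnit a ↔ IsUnit (e a).1 ∧ IsUnit (e a).2
    rw [← Prod.isUnit_iff, MulEquiv.isUnit_map]
  have hpre : ∀ x y, ∃ a, φ a = x ∧ ψ a = y := fun x y => by
    obtain ⟨a, ha⟩ := hb.2 (x, y)
    exact ⟨a, congrArg Prod.fst ha, congrArg Prod.snd ha⟩
  choose s hs1 hs2 using hpre
  have hmu : ∀ X : Matrix (Fin m) (Fin m) A, IsUnit X ↔ IsUnit (X.map φ) ∧ IsUnit (X.map ψ) := by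
    intro X
    rw [Matrix.isUnit_iff_isUnit_det, hunit, RingHom.map_det, RingHom.map_det,
      Matrix.isUnit_iff_isUnit_det, Matrix.isUnit_iff_isUnit_det, isUnit_iff_ne_zero, isUnit_iff_ne_zero]
    rfl
  have hH : ∀ X : Matrix (Fin m) (Fin m) A, X.IsHermitian → X.map ψ = (X.map φ)ᵀ := by
    intro X hX
    ext i j
    simp only [Matrix.map_apply, Matrix.transpose_apply, hψ]
    rw [hX.apply]
  let E : {X : Matrix (Fin m) (Fin m) A // X.IsHermitian} ≃ Matrix (Fin m) (Fin m) B :=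
    { toFun := fun X => X.1.map φ
      invFun := fun Z => ⟨Matrix.of fun i j => s (Z i j) (Z j i), by
        ext i j
        rw [Matrix.conjTranspose_apply, Matrix.of_apply, Matrix.of_apply]
        apply hinj
        · rw [← hψ, hs2, hs1]
        · rw [hψ, star_star, hs1, hs2]⟩
      left_inv := fun X => by
        apply Subtype.ext
        ext i j
        simp only [Matrix.of_apply, Matrix.map_apply]
        apply hinj
        · rw [hs1]
        · rw [hs2, hψ, X.2.apply]
      right_inv := fun Z => by
        ext i j
        simp [hs1] }
  have h1 : Nat.card {X : Matrix (Fin m) (Fin m) A // X.IsHermitian} = N ^ m ^ 2 := by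
    rw [Nat.card_congr E, card_matF, hB]
  have h2 : Nat.card {X : Matrix (Fin m) (Fin m) A // X.IsHermitian ∧ IsUnit X} =
      Nat.card {X : Matrix (Fin m) (Fin m) B // IsUnit X} := by
    rw [← Nat.card_congr (Equiv.subtypeSubtypeEquivSubtypeInter
      (fun X : Matrix (Fin m) (Fin m) A => X.IsHermitian) IsUnit)]
    refine Nat.card_congr (E.subtypeEquiv fun X => ?_)
    rw [hmu, hH _ X.2, Matrix.isUnit_transpose, and_self]
    rfl
  have h3 : Nat.card {X : Matrix (Fin m) (Fin m) A // IsUnit X} =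
      Nat.card {X : Matrix (Fin m) (Fin m) B // IsUnit X} ^ 2 := by
    rw [sq, ← Nat.card_prod]
    refine Nat.card_congr
      { toFun := fun X => (⟨X.1.map φ, ((hmu _).1 X.2).1⟩, ⟨X.1.map ψ, ((hmu _).1 X.2).2⟩)
        invFun := fun Z => ⟨Matrix.of fun i j => s (Z.1.1 i j) (Z.2.1 i j), (hmu _).2 ⟨by
          convert Z.1.2; ext i j; simp [hs1], by convert Z.2.2; ext i j; simp [hs2]⟩⟩
        left_inv := fun X => by
          apply Subtype.ext
          ext i j
          simp only [Matrix.of_apply, Matrix.map_apply]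
          exact hinj _ _ (hs1 _ _) (hs2 _ _)
        right_inv := fun Z => by
          refine Prod.ext (Subtype.ext ?_) (Subtype.ext ?_)
          · ext i j; simp [hs1]
          · ext i j; simp [hs2] }
  have h4 := unit_mat_card hB m
  have hne : (∏ j ∈ range m, (1 - ((N : ℝ)⁻¹) ^ (j + 1))) ≠ 0 := by
    rw [Finset.prod_ne_zero_iff]
    intro j _
    have : ((N : ℝ)⁻¹) ^ (j + 1) < 1 := by
      apply pow_lt_one₀ (by positivity) _ (by omega)
      apply inv_lt_one_of_one_lt₀
      exact_mod_cast hN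
    linarith
  rw [LocalId, h1, h2, h3, card_matF, hA]
  push_cast
  rw [h4]
  generalize (∏ j ∈ range m, (1 - ((N : ℝ)⁻¹) ^ (j + 1))) = P at hne
  field_simp
  ring

section descent
variable {F K : Type} [Field F] [Field K] [Algebra F K] [StarRing K] [HermPair F K]

lemma descend (f : K[X]) (hf : star f = f) : ∃ g : F[X], g.map (algebraMap F K) = f := by
  rw [← mem_lifts, lifts_iff_coeff_lifts]
  intro n
  rw [← HermPair.fix (F := F)]
  conv_rhs => rw [← hf, poly_star_def, coeff_map]
  rfl

variable (F K) in
lemma card_K [Finite K] : Nat.card K = Nat.card F ^ 2 := by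
  rw [sa_sq (HermPair.ne (F := F) (K := K)) (star : K → K) star_add star_star (fun a u => by
    rw [smul_eq_mul, star_mul, smul_eq_mul, mul_comm])]
  congr 1
  refine (Nat.card_congr (Equiv.ofBijective (fun a : F => (⟨algebraMap F K a,
    (HermPair.fix (F := F) _).2 ⟨a, rfl⟩⟩ : {u : K // star u = u})) ⟨?_, ?_⟩)).symm
  · intro a b h
    exact (algebraMap F K).injective (congrArg Subtype.val h)
  · rintro ⟨u, hu⟩
    obtain ⟨a, ha⟩ := (HermPair.fix (F := F) _).1 hu
    exact ⟨a, Subtype.ext ha⟩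

lemma finite_quot [Finite K] (f : K[X]) (hf : f ≠ 0) : Finite (K[X] ⧸ Ideal.span {f}) ∧
    Nat.card (K[X] ⧸ Ideal.span {f}) = Nat.card K ^ f.natDegree := by
  haveI : Module.Finite K (K[X] ⧸ Ideal.span {f}) := (AdjoinRoot.powerBasis hf).finite
  refine ⟨Module.finite_of_finite K, ?_⟩
  rw [Module.natCard_eq_pow_finrank (K := K), finrank_quotient_span_eq_natDegree]

lemma Qkap [Finite K] (p : PI F) : Nat.card (kap (ppF F K) p) = (Nat.card F ^ pdeg F p) ^ 2 := by
  rw [(finite_quot _ (ppF_ne p)).2, card_K F K, ppF_deg, ← pow_mul, ← pow_mul, mul_comm]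

instance finKap [Finite K] (p : PI F) : Finite (kap (ppF F K) p) := (finite_quot _ (ppF_ne p)).1

instance finLam [Finite K] (i : ℕ × PI F) : Finite (Lam (ppF F K) i) :=
  (finite_quot _ (pow_ne_zero _ (ppF_ne i.2))).1

lemma wloc_odd {q d : ℕ} (hd : Odd d) (m : ℕ) : wloc q d m = (poch ((q ^ d : ℕ) : ℝ) m)⁻¹ := by
  rw [wloc, poch, ← Finset.prod_inv_distrib]
  refine Finset.prod_congr rfl fun j _ => ?_
  rw [pow_mul, hd.neg_pow]; push_cast; rw [inv_pow]

lemma wloc_even {q d : ℕ} (hd : Even d) (m : ℕ) :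
    wloc q d m = (∏ j ∈ range m, (1 - (((q ^ d : ℕ) : ℝ)⁻¹) ^ (j + 1)))⁻¹ := by
  rw [wloc, ← Finset.prod_inv_distrib]
  refine Finset.prod_congr rfl fun j _ => ?_
  rw [pow_mul, hd.neg_pow]; push_cast; rw [inv_pow]


lemma poch_ne {q : ℕ} (hq : 2 ≤ q) (m : ℕ) : poch (q : ℝ) m ≠ 0 :=
  (poch_pos (by exact_mod_cast hq) m).ne'

lemma star_ne_kap [Finite K] (p : PI F) : ∃ x : kap (ppF F K) p, star x ≠ x := by
  obtain ⟨x, hx⟩ := HermPair.ne (F := F) (K := K)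
  refine ⟨Ideal.Quotient.mk _ (C x), fun h => ?_⟩
  rw [star_mk_kap, Ideal.Quotient.eq, Ideal.mem_span_singleton, poly_star_C, ← C_sub] at h
  have h2 := natDegree_le_of_dvd h (by rw [Ne, C_eq_zero, sub_eq_zero]; exact hx)
  rw [natDegree_C, ppF_deg] at h2
  have := pdeg_pos p
  omega

lemma fix_kap [Finite K] (p : PI F) :
    Nat.card {a : kap (ppF F K) p // star a = a} = Nat.card F ^ pdeg F p := by
  have h := sa_sq (E := kap (ppF F K) p) (HermPair.ne (F := F) (K := K))
    (star : kap (ppF F K) p → kap (ppF F K) p) star_add star_star (fun a u => by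
      obtain ⟨u, rfl⟩ := Ideal.Quotient.mk_surjective u
      change star (Ideal.Quotient.mk _ (a • u) : kap (ppF F K) p) =
        Ideal.Quotient.mk _ (star a • star u)
      rw [star_mk_kap, smul_eq_C_mul, smul_eq_C_mul, star_mul, poly_star_C, mul_comm])
  rw [Qkap] at h
  exact (Nat.pow_left_injective (n := 2) (by norm_num) h).symm

lemma odd_of_field {A : Type} [Field A] [StarRing A] [Finite A] {q d : ℕ} (hd : 0 < d) (hq : 2 ≤ q)
    (hF : Nat.card {a : A // star a = a} = q ^ d) (x : A) (hx : star x ≠ x) (hx2 : x ^ (q ^ 2) = x) :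
    Odd d := by
  classical
  haveI := Fintype.ofFinite A
  by_contra hodd
  rw [Nat.not_odd_iff_even] at hodd
  obtain ⟨e, he⟩ := hodd
  let S : Subfield A :=
    { carrier := {a | star a = a}
      mul_mem' := fun {a b} ha hb => by
        change star (a * b) = a * b
        rw [star_mul, show star a = a from ha, show star b = b from hb, mul_comm]
      one_mem' := star_one A
      add_mem' := fun {a b} ha hb => by
        change star (a + b) = a + b
        rw [star_add, show star a = a from ha, show star b = b from hb]
      zero_mem' := star_zero A
      neg_mem' := fun {a} ha => by
        change star (-a) = -a
        rw [star_neg, show star a = a from ha]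
      inv_mem' := fun a ha => by
        change star (a⁻¹) = a⁻¹
        rw [star_inv₀, show star a = a from ha] }
  have hS : Nat.card S = q ^ d := hF
  have hroot : ∀ a : A, star a = a → a ^ (q ^ d) = a := by
    intro a ha
    have := FiniteField.pow_card (⟨a, ha⟩ : S)
    rw [← Nat.card_eq_fintype_card, hS] at this
    exact congrArg Subtype.val this
  have hxr : x ^ (q ^ d) = x := by
    rw [he, ← two_mul, pow_mul]
    clear he
    induction e with
    | zero => simp
    | succ e ih => rw [pow_succ, pow_mul, ih, hx2]
  have hne : (X ^ (q ^ d) - X : A[X]) ≠ 0 := FiniteField.X_pow_card_sub_X_ne_zero _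
    (Nat.one_lt_pow hd.ne' (by omega))
  have hsub : insert x (Finset.univ.filter fun a : A => star a = a) ⊆
      (X ^ (q ^ d) - X : A[X]).roots.toFinset := by
    intro a ha
    rw [Multiset.mem_toFinset, mem_roots hne]
    rw [Finset.mem_insert, Finset.mem_filter] at ha
    have : a ^ (q ^ d) = a := by
      rcases ha with rfl | ha
      · exact hxr
      · exact hroot a ha.2
    simp [this]
  have h1 := Finset.card_le_card hsub
  rw [Finset.card_insert_of_notMem (by simpa using hx)] at h1
  have h2 := (Multiset.toFinset_card_le _).trans (card_roots' (X ^ (q ^ d) - X : A[X]))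
  rw [FiniteField.X_pow_card_sub_X_natDegree_eq _ (Nat.one_lt_pow hd.ne' (by omega))] at h2
  have h3 : (Finset.univ.filter fun a : A => star a = a).card = q ^ d := by
    rw [← hF, Nat.card_eq_fintype_card, Fintype.card_subtype]
  omega

lemma odd_of_isField {A : Type} [CommRing A] [StarRing A] [Finite A] (hA : IsField A) {q d : ℕ} (hd : 0 < d) (hq : 2 ≤ q)
    (hF : Nat.card {a : A // star a = a} = q ^ d) (x : A) (hx : star x ≠ x) (hx2 : x ^ (q ^ 2) = x) :
    Odd d := by
  letI : Field A := hA.toField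
  exact odd_of_field hd hq hF x hx hx2

lemma exists_split (p : PI F) (hp : ¬ Irreducible (ppF F K p)) :
    ∃ π : K[X], π.Monic ∧ Irreducible π ∧ IsCoprime π (star π) ∧ ppF F K p = π * star π := by
  have hnu : ¬ IsUnit (ppF F K p) := by
    intro h
    have := natDegree_eq_zero_of_isUnit h
    rw [ppF_deg] at this
    have := pdeg_pos p
    omega
  obtain ⟨π, hm, hirr, hdvd⟩ := exists_monic_irreducible_factor _ hnu
  have hm' : (star π).Monic := hm.map _
  have hirr' : Irreducible (star π) := by
    have := (MulEquiv.irreducible_iff (Polynomial.mapEquiv (starRingAut : K ≃+* K)) (x := π)).2 hirr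
    exact this
  have hdvd' : star π ∣ ppF F K p := by
    obtain ⟨z, hz⟩ := hdvd
    rw [← ppF_star p, hz, star_mul]
    exact dvd_mul_left _ _
  have hfin : ∀ f : K[X], star f = f → ¬ IsUnit f → f.Monic → f ∣ ppF F K p → f = ppF F K p := by
    intro f hf hu hmo hd
    obtain ⟨g, rfl⟩ := descend (F := F) f hf
    rw [ppF, map_dvd_map'] at hd
    rw [ppF]
    congr 1
    refine eq_of_monic_of_associated ?_ p.2.1 ?_
    · exact (Polynomial.monic_map_iff).1 hmo
    · exact ((p.2.2.dvd_iff.1 hd).resolve_left fun h => hu (h.map (mapRingHom (algebraMap F K)))).symm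
  have hne : π ≠ star π := by
    intro h
    have := hfin π h.symm hirr.not_isUnit hm hdvd
    rw [this] at hirr
    exact hp hirr
  have hcop : IsCoprime π (star π) := by
    rw [hirr.coprime_iff_not_dvd]
    intro hd
    exact hne (eq_of_monic_of_associated hm hm' ((hirr.dvd_irreducible_iff_associated hirr').1 hd))
  refine ⟨π, hm, hirr, hcop, ?_⟩
  refine (hfin _ (by rw [star_mul, star_star]) ?_ (hm.mul hm') (hcop.mul_dvd hdvd hdvd')).symm
  intro h
  exact hirr.not_isUnit (isUnit_of_mul_isUnit_left h)

theorem kap_local [Finite K] [Finite F] (p : PI F) (m : ℕ) :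
    LocalId (kap (ppF F K) p) (Fin m) (wloc (Nat.card F) (pdeg F p) m) := by
  have hq : 2 ≤ Nat.card F := Finite.one_lt_card
  have hd := pdeg_pos p
  have hqd : 2 ≤ Nat.card F ^ pdeg F p := hq.trans (Nat.le_self_pow hd.ne' _)
  by_cases hp : Irreducible (ppF F K p)
  · have hA : IsField (kap (ppF F K) p) := by
      rw [← Ideal.Quotient.maximal_ideal_iff_isField_quotient]
      exact PrincipalIdealRing.isMaximal_of_irreducible hp
    have hodd : Odd (pdeg F p) := by
      obtain ⟨x, hx⟩ := HermPair.ne (F := F) (K := K)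
      refine odd_of_isField hA hd hq (fix_kap p) (Ideal.Quotient.mk _ (C x)) ?_ ?_
      · intro h
        rw [star_mk_kap, Ideal.Quotient.eq, Ideal.mem_span_singleton, poly_star_C, ← C_sub] at h
        have h2 := natDegree_le_of_dvd h (by rw [Ne, C_eq_zero, sub_eq_zero]; exact hx)
        rw [natDegree_C, ppF_deg] at h2
        omega
      · haveI := Fintype.ofFinite K
        rw [← map_pow, ← C_pow, ← card_K F K, Nat.card_eq_fintype_card, FiniteField.pow_card]
    rw [wloc_odd hodd]
    exact local_field hA (Qkap p) (fix_kap p) (star_ne_kap p) (poch_ne hqd m)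
  · obtain ⟨π, hm, hirr, hcop, heq⟩ := exists_split p hp
    have hdeg : pdeg F p = 2 * π.natDegree := by
      rw [← ppF_deg (K := K), heq, poly_star_def, hm.natDegree_mul (hm.map _), natDegree_map]; ring
    rw [wloc_even ⟨π.natDegree, by rw [hdeg]; ring⟩]
    haveI : (Ideal.span {π}).IsMaximal := PrincipalIdealRing.isMaximal_of_irreducible hirr
    letI : Field (K[X] ⧸ Ideal.span {π}) := Ideal.Quotient.field _
    haveI : Finite (K[X] ⧸ Ideal.span {π}) := (finite_quot π hm.ne_zero).1
    have hle : Ideal.span {ppF F K p} ≤ Ideal.span {π} := by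
      rw [Ideal.span_singleton_le_span_singleton, heq]; exact dvd_mul_right _ _
    refine local_split (A := kap (ppF F K) p) (B := K[X] ⧸ Ideal.span {π})
      (Ideal.Quotient.factor hle) ?_ ?_ (Qkap p) hqd m
    · intro a h1 h2
      obtain ⟨a, rfl⟩ := Ideal.Quotient.mk_surjective a
      rw [star_mk_kap] at h2
      rw [Ideal.Quotient.factor_mk, Ideal.Quotient.eq_zero_iff_mem, Ideal.mem_span_singleton] at h1 h2
      rw [Ideal.Quotient.eq_zero_iff_mem, Ideal.mem_span_singleton, heq]
      refine hcop.mul_dvd h1 ?_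
      obtain ⟨z, hz⟩ := h2
      rw [← star_star a, hz, star_mul]
      exact dvd_mul_left _ _
    · rw [(finite_quot π hm.ne_zero).2, card_K F K, hdeg, ← pow_mul]

end descent
end FFU

end file_P4e

section file_P4f
open Finset Polynomial Matrix
namespace FFU
set_option linter.unusedSectionVars false
set_option linter.style.haveILetI false

section form
variable {F K : Type} [Field F] [Field K] [Algebra F K] [StarRing K] [HermPair F K]
variable {ι : Type} [Fintype ι] [DecidableEq ι] (c : ι → ℕ × PI F)

variable (K) in
/-- the base form -/
noncomputable def hb (m m' : Md (ppF F K) c) : K := ∑ a, ell (c a) (m a * star (m' a))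

lemma hb_isHF : IsHF (hb K c) where
  add u v w := by
    simp only [hb, Pi.add_apply, add_mul, ell_add, Finset.sum_add_distrib]
  smul a v w := by
    simp only [hb, Pi.smul_apply, smul_mul_assoc, ell_smul, Finset.mul_sum]
  bal f v w := by
    simp only [hb, Pi.smul_apply]
    refine Finset.sum_congr rfl fun a _ => ?_
    congr 1
    rw [Algebra.smul_def, Algebra.smul_def, star_mul]
    rw [Ideal.Quotient.algebraMap_eq, star_mk_lam, star_star]
    ring
  herm v w := by
    simp only [hb, star_sum]
    refine Finset.sum_congr rfl fun a _ => ?_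
    rw [← ell_star, star_mul, star_star]
  nondeg v hv := by
    funext a
    refine ell_nondeg (c a) _ fun z => ?_
    have := hv (Pi.single a (star z))
    rw [hb, Finset.sum_eq_single a] at this
    · rw [Pi.single_eq_same, star_star, mul_comm] at this
      exact this
    · intro b _ hb
      rw [Pi.single_eq_of_ne hb, star_zero, mul_zero]
      have := ell_smul (c b) 0 (0 : Lam (ppF F K) (c b))
      rwa [smul_zero, zero_mul] at this
    · simp

lemma ell_zero (i : ℕ × PI F) : ell i (0 : Lam (ppF F K) i) = 0 := by
  have := ell_smul i 0 (0 : Lam (ppF F K) i)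
  rwa [smul_zero, zero_mul] at this

lemma hb_single_right (m : Md (ppF F K) c) (a : ι) : hb K c m (Pi.single a 1) = ell (c a) (m a) := by
  rw [hb, Finset.sum_eq_single a]
  · rw [Pi.single_eq_same, star_one, mul_one]
  · intro b _ hb
    rw [Pi.single_eq_of_ne hb, star_zero, mul_zero, ell_zero]
  · simp

lemma hb_single_left (m : Md (ppF F K) c) (b : ι) (z : K[X]) :
    hb K c (z • Pi.single b 1) m = ell (c b) (z • star (m b)) := by
  rw [hb, Finset.sum_eq_single b]
  · rw [Pi.smul_apply, Pi.single_eq_same, smul_mul_assoc, one_mul]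
  · intro a _ hb
    rw [Pi.smul_apply, Pi.single_eq_of_ne hb, smul_zero, zero_mul, ell_zero]
  · simp

lemma DD_adj {c : ι → ℕ × PI F} (r r' : Md (ppF F K) c →ₗ[K[X]] Md (ppF F K) c)
    (h : ∀ m m', hb K c (r m) m' = hb K c m (r' m')) (i : ℕ × PI F) : DD i r' = (DD i r)ᴴ := by
  ext ⟨b, hb'⟩ ⟨a, ha⟩
  rw [Matrix.conjTranspose_apply]
  set x := rep (ppF F K) (ent r a b) with hx
  set y := rep (ppF F K) (ent r' b a) with hy
  change (Ideal.Quotient.mk _ y : kap (ppF F K) i.2) = star (Ideal.Quotient.mk _ x)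
  rw [star_mk_kap, Ideal.Quotient.eq, Ideal.mem_span_singleton]
  have key : ∀ z : K[X], LL (gg F K i) (z * x) = LL (gg F K i) (z * star y) := by
    intro z
    have h1 := h (z • Pi.single b 1) (Pi.single a 1)
    rw [hb_single_right, hb_single_left, map_smul] at h1
    have e1 : (z • r (Pi.single b 1)) a = z • ent r a b := rfl
    have e2 : r' (Pi.single a 1) b = ent r' b a := rfl
    rw [e1, e2, ← mk_rep (ppF F K) (ent r a b), ← mk_rep (ppF F K) (ent r' b a), star_mk_lam,
      Algebra.smul_def, Algebra.smul_def, Ideal.Quotient.algebraMap_eq,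
      Ideal.Quotient.algebraMap_eq, ← map_mul, ← map_mul, ell_mk, ell_mk] at h1
    rw [← hx, ← hy, ha, hb'] at h1
    exact h1
  have h2 : gg F K i ∣ x - star y := by
    refine LL_nondeg (gg_monic i) _ fun z => ?_
    have h3 := LL_add (gg F K i) (z * (x - star y)) (z * star y)
    rw [← mul_add, sub_add_cancel, key] at h3
    exact right_eq_add.1 h3
  have h4 : ppF F K i.2 ∣ x - star y := (dvd_pow_self _ (by omega)).trans h2
  obtain ⟨w, hw⟩ := h4
  refine ⟨-star w, ?_⟩
  have := congrArg star hw
  rw [star_sub, star_star, star_mul, ppF_star] at this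
  rw [mul_neg, mul_comm, ← this]; ring

lemma exists_half {K : Type} [Field K] [StarRing K] (hs : ∃ x : K, star x ≠ x) :
    ∃ a : K, a + star a = 1 := by
  obtain ⟨x, hx⟩ := hs
  have : ∃ y : K, y + star y ≠ 0 := by
    by_contra hcon
    push Not at hcon
    have h1 := hcon 1
    rw [star_one] at h1
    have h2 := hcon x
    have h3 : x + x = 0 := by rw [← two_mul, ← one_add_one_eq_two, h1, zero_mul]
    exact hx (add_left_cancel (h2.trans h3.symm))
  obtain ⟨y, hy⟩ := this
  refine ⟨y / (y + star y), ?_⟩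
  rw [star_div₀, star_add, star_star, add_comm (star y) y, ← add_div, div_self hy]

variable [Finite K]

/-- self-adjoint endomorphisms -/
noncomputable def Tsa : AddSubgroup (Md (ppF F K) c →ₗ[K[X]] Md (ppF F K) c) where
  carrier := {r | (hb_isHF c).adj r = r}
  add_mem' {r s} hr hs := by
    change (hb_isHF c).adj (r + s) = r + s
    rw [IsHF.adj_add, show (hb_isHF c).adj r = r from hr, show (hb_isHF c).adj s = s from hs]
  zero_mem' := by
    change (hb_isHF c).adj 0 = 0
    have := (hb_isHF (K := K) c).adj_add 0 0
    rw [add_zero] at this; exact left_eq_add.1 this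
  neg_mem' {r} hr := by
    change (hb_isHF c).adj (-r) = -r
    have h := (hb_isHF (K := K) c).adj_add (-r) r
    have h0 := (hb_isHF (K := K) c).adj_add 0 0
    rw [add_zero] at h0
    rw [show (hb_isHF c).adj r = r from hr, neg_add_cancel, left_eq_add.1 h0] at h
    exact eq_neg_of_add_eq_zero_left h.symm

lemma mem_Tsa (r : Md (ppF F K) c →ₗ[K[X]] Md (ppF F K) c) :
    r ∈ Tsa c ↔ (hb_isHF c).adj r = r := Iff.rfl

abbrev MatAll (K : Type) [Field K] [Algebra F K] (c : ι → ℕ × PI F) : Type :=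
  ∀ i : Set.range c, Matrix {a : ι // c a = i.1} {b : ι // c b = i.1} (kap (ppF F K) i.1.2)

lemma DDall_adj (r : Md (ppF F K) c →ₗ[K[X]] Md (ppF F K) c) :
    DDall c ((hb_isHF c).adj r) = star (DDall c r) := by
  funext i
  exact DD_adj r _ (fun m m' => (hb_isHF c).adj_spec r m m') i.1

/-- restricted residue map -/
noncomputable def DDsa : Tsa (F := F) (K := K) c →+ selfAdjoint (MatAll K c) :=
  ((DDall c).comp (Tsa c).subtype).codRestrict _ fun r => by
    rw [selfAdjoint.mem_iff]
    have h := DDall_adj c r.1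
    rw [show (hb_isHF c).adj r.1 = r.1 from r.2] at h
    exact h.symm

lemma DDsa_surj : Function.Surjective (DDsa (F := F) (K := K) c) := by
  rintro ⟨Z, hZ⟩
  obtain ⟨a, ha⟩ := exists_half (HermPair.ne (F := F) (K := K))
  obtain ⟨r, hr⟩ := DDall_surj (pp := ppF F K) (c := c) Z
  have hadj := (hb_isHF c).adj_smul (C a) r
  refine ⟨⟨(C a : K[X]) • r + (hb_isHF c).adj ((C a : K[X]) • r), ?_⟩, ?_⟩
  · rw [mem_Tsa, IsHF.adj_add, IsHF.adj_adj, add_comm]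
  · apply Subtype.ext
    change DDall c ((C a : K[X]) • r + (hb_isHF c).adj ((C a : K[X]) • r)) = Z
    rw [map_add, hadj, poly_star_C]
    have hsm : ∀ (f : K[X]) (r : Md (ppF F K) c →ₗ[K[X]] Md (ppF F K) c) i, DDall c (f • r) i =
        (Ideal.Quotient.mk _ f : kap (ppF F K) i.1.2) • DDall c r i := fun f r i => DD_smul i.1 f r
    funext i
    rw [Pi.add_apply, hsm, hsm, DDall_adj, hr, show star Z = Z from hZ, ← add_smul, ← map_add, ← C_add,
      ha, C_1, map_one, one_smul]

lemma sa_card : Nat.card {r : Tsa (F := F) (K := K) c // Function.Bijective r.1} *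
    (∏ i : Set.range c, Nat.card {X : Matrix {a : ι // c a = i.1} {b : ι // c b = i.1}
      (kap (ppF F K) i.1.2) // X.IsHermitian}) =
    Nat.card (Tsa (F := F) (K := K) c) *
    ∏ i : Set.range c, Nat.card {X : Matrix {a : ι // c a = i.1} {b : ι // c b = i.1}
      (kap (ppF F K) i.1.2) // X.IsHermitian ∧ IsUnit X} := by
  have h := card_fiber (DDsa (F := F) (K := K) c) (DDsa_surj c) (fun Z => ∀ i, IsUnit (Z.1 i))
  have e1 : selfAdjoint (MatAll K c) ≃ ∀ i : Set.range c,
      {X : Matrix {a : ι // c a = i.1} {b : ι // c b = i.1} (kap (ppF F K) i.1.2) // X.IsHermitian} :=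
    (Equiv.subtypeEquivRight (fun Z => by
      rw [selfAdjoint.mem_iff, funext_iff]; rfl)).trans Equiv.subtypePiEquivPi
  have e2 : {Z : selfAdjoint (MatAll K c) // ∀ i, IsUnit (Z.1 i)} ≃ ∀ i : Set.range c,
      {X : Matrix {a : ι // c a = i.1} {b : ι // c b = i.1} (kap (ppF F K) i.1.2) //
        X.IsHermitian ∧ IsUnit X} :=
    (Equiv.subtypeSubtypeEquivSubtypeInter (fun Z : MatAll K c => Z ∈ selfAdjoint (MatAll K c))
      (fun Z => ∀ i, IsUnit (Z i))).trans
    ((Equiv.subtypeEquivRight (fun Z => by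
      rw [selfAdjoint.mem_iff, funext_iff, ← forall_and]; rfl)).trans Equiv.subtypePiEquivPi)
  rw [Nat.card_congr e1, Nat.card_congr e2, Nat.card_pi, Nat.card_pi] at h
  rw [← h]
  congr 1
  exact Nat.card_congr (Equiv.subtypeEquivRight fun r => bij_iff' ppF_cop ppF_ne r.1)

theorem local_global [Finite F] :
    (Nat.card (Tsa (F := F) (K := K) c) : ℝ) * Nat.card {r : Tsa (F := F) (K := K) c // Function.Bijective r.1} =
    Nat.card {r : Md (ppF F K) c →ₗ[K[X]] Md (ppF F K) c // Function.Bijective r} *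
    ∏ i : Set.range c, wloc (Nat.card F) (pdeg F i.1.2) (Fintype.card {a : ι // c a = i.1}) := by
  have h1 := aut_card (c := c) (pp := ppF F K) ppF_cop ppF_ne
  have h2 := sa_card (F := F) (K := K) c
  have h3 : Nat.card (Md (ppF F K) c →ₗ[K[X]] Md (ppF F K) c) = Nat.card (Tsa (F := F) (K := K) c) ^ 2 :=
    (hb_isHF c).end_card (HermPair.ne (F := F))
  have h4 : ∀ i : Set.range c, LocalId (kap (ppF F K) i.1.2) {a : ι // c a = i.1}
      (wloc (Nat.card F) (pdeg F i.1.2) (Fintype.card {a : ι // c a = i.1})) := fun i =>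
    (kap_local i.1.2 _).congr (Fintype.equivFin _)
  have h5 : (∏ i : Set.range c, (Nat.card {X : Matrix {a : ι // c a = i.1} {b : ι // c b = i.1}
      (kap (ppF F K) i.1.2) // X.IsHermitian ∧ IsUnit X} : ℝ)) *
      (∏ i : Set.range c, (Nat.card (Matrix {a : ι // c a = i.1} {b : ι // c b = i.1} (kap (ppF F K) i.1.2)) : ℝ)) =
      (∏ i : Set.range c, wloc (Nat.card F) (pdeg F i.1.2) (Fintype.card {a : ι // c a = i.1})) *
      (∏ i : Set.range c, (Nat.card {g : Matrix {a : ι // c a = i.1} {b : ι // c b = i.1} (kap (ppF F K) i.1.2) //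
      IsUnit g} : ℝ)) * (∏ i : Set.range c, (Nat.card {X : Matrix {a : ι // c a = i.1} {b : ι // c b = i.1}
      (kap (ppF F K) i.1.2) // X.IsHermitian} : ℝ)) := by
    rw [← Finset.prod_mul_distrib, ← Finset.prod_mul_distrib, ← Finset.prod_mul_distrib]
    exact Finset.prod_congr rfl fun i _ => h4 i
  have h6 : (∏ i : Set.range c, (Nat.card {X : Matrix {a : ι // c a = i.1} {b : ι // c b = i.1}
      (kap (ppF F K) i.1.2) // X.IsHermitian} : ℝ)) ≠ 0 := by
    rw [Finset.prod_ne_zero_iff]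
    intro i _
    haveI : Nonempty {X : Matrix {a : ι // c a = i.1} {b : ι // c b = i.1}
      (kap (ppF F K) i.1.2) // X.IsHermitian} := ⟨⟨0, Matrix.isHermitian_zero⟩⟩
    exact_mod_cast Nat.card_pos.ne'
  have h7 : (∏ i : Set.range c, (Nat.card (Matrix {a : ι // c a = i.1} {b : ι // c b = i.1}
      (kap (ppF F K) i.1.2)) : ℝ)) ≠ 0 := by
    rw [Finset.prod_ne_zero_iff]
    intro i _
    exact_mod_cast Nat.card_pos.ne'
  rw [h3] at h1
  have h1' := congrArg (Nat.cast : ℕ → ℝ) h1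
  have h2' := congrArg (Nat.cast : ℕ → ℝ) h2
  push_cast at h1' h2'
  apply mul_right_cancel₀ (mul_ne_zero h6 h7)
  linear_combination (Nat.card (Tsa (F := F) (K := K) c) : ℝ) * (∏ i : Set.range c, (Nat.card (Matrix {a : ι // c a = i.1} {b : ι // c b = i.1}
      (kap (ppF F K) i.1.2)) : ℝ)) * h2' + (Nat.card (Tsa (F := F) (K := K) c) : ℝ) ^ 2 * h5 -
      (∏ i : Set.range c, wloc (Nat.card F) (pdeg F i.1.2) (Fintype.card {a : ι // c a = i.1})) *
      (∏ i : Set.range c, (Nat.card {X : Matrix {a : ι // c a = i.1} {b : ι // c b = i.1}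
      (kap (ppF F K) i.1.2) // X.IsHermitian} : ℝ)) * h1'

end form
end FFU

end file_P4f

section file_P5a
open Finset Polynomial
namespace FFU
set_option linter.unusedVariables false
set_option linter.unusedSectionVars false
set_option linter.style.haveILetI false

section cls
variable {F K : Type} [Field F] [Field K] [Algebra F K] [StarRing K] [HermPair F K] [Finite K]
variable {V : Type} [AddCommGroup V] [Module K[X] V] [Finite V]

lemma IsHF.restrict {h : V → V → K} (H : IsHF h) (W : Submodule K[X] V)
    (hW : ∀ w ∈ W, (∀ w' ∈ W, h w w' = 0) → w = 0) : IsHF (fun a b : W => h a.1 b.1) where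
  add u v w := H.add _ _ _
  smul a v w := H.smul _ _ _
  bal f v w := H.bal _ _ _
  herm v w := H.herm _ _
  nondeg v hv := Subtype.ext (hW v.1 v.2 fun w' hw' => hv ⟨w', hw'⟩)

lemma map_star (u : F[X]) : star (u.map (algebraMap F K)) = u.map (algebraMap F K) := by
  rw [poly_star_def, Polynomial.map_map]
  congr 1
  refine RingHom.ext fun x => ?_
  exact (HermPair.fix (F := F) (algebraMap F K x)).2 ⟨x, rfl⟩

variable (F) in
/-- descent of star-stable ideals -/
lemma ideal_descent (I : Ideal K[X]) (hI : ∀ f ∈ I, star f ∈ I) (p : PI F) (e : ℕ)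
    (h1 : ppF F K p ^ (e + 1) ∈ I) (h2 : ppF F K p ^ e ∉ I) (f : K[X]) (hf : f ∈ I) :
    ppF F K p ^ (e + 1) ∣ f := by
  let J : Ideal F[X] := I.comap (mapRingHom (algebraMap F K))
  have hpow : ∀ k, (p.1 ^ k).map (algebraMap F K) = ppF F K p ^ k := fun k => by
    rw [Polynomial.map_pow]; rfl
  have hJ : ∀ u ∈ J, p.1 ^ (e + 1) ∣ u := by
    intro u hu
    have m1 : p.1 ^ (e + 1) ∈ J := by
      change (p.1 ^ (e + 1)).map (algebraMap F K) ∈ I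
      rw [hpow]; exact h1
    rw [Submodule.IsPrincipal.mem_iff_generator_dvd] at m1 hu
    obtain ⟨j, hj, hass⟩ := (dvd_prime_pow p.2.2.prime _).1 m1
    have : j = e + 1 := by
      by_contra hne
      apply h2
      rw [← hpow]
      change p.1 ^ e ∈ J
      rw [Submodule.IsPrincipal.mem_iff_generator_dvd]
      exact hass.dvd.trans (pow_dvd_pow _ (by omega))
    subst this
    exact hass.symm.dvd.trans hu
  have hsa : ∀ z ∈ I, ppF F K p ^ (e + 1) ∣ z + star z := by
    intro z hz
    obtain ⟨u, hu⟩ := descend (F := F) (z + star z) (by rw [star_add, star_star, add_comm])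
    rw [← hu, ← hpow, map_dvd_map']
    apply hJ
    change u.map (algebraMap F K) ∈ I
    rw [hu]; exact I.add_mem hz (hI z hz)
  obtain ⟨x, hx⟩ := HermPair.ne (F := F) (K := K)
  have a1 := hsa f hf
  have a2 := hsa (C x * f) (I.mul_mem_left _ hf)
  have a3 : ppF F K p ^ (e + 1) ∣ C (x - star x) * f := by
    have : C (x - star x) * f = (C x * f + star (C x * f)) - C (star x) * (f + star f) := by
      rw [star_mul, poly_star_C, C_sub]; ring
    rw [this]
    exact dvd_sub a2 (a1.mul_left _)
  have hu : IsUnit (C (x - star x) : K[X]) :=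
    isUnit_C.2 (isUnit_iff_ne_zero.2 (sub_ne_zero.2 (Ne.symm hx)))
  exact hu.dvd_mul_left.1 a3

variable (F) in
/-- existence of a good cyclic vector -/
lemma exists_cyclic {h : V → V → K} (H : IsHF h) [Nontrivial V] :
    ∃ (p : PI F) (e : ℕ) (v : V), ppF F K p ^ (e + 1) • v = 0 ∧ h (ppF F K p ^ e • v) v ≠ 0 := by
  let J : Ideal F[X] := (Module.annihilator K[X] V).comap (mapRingHom (algebraMap F K))
  have hJ : ∀ u, u ∈ J ↔ ∀ v : V, u.map (algebraMap F K) • v = 0 := fun u => Module.mem_annihilator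
  set g := Submodule.IsPrincipal.generator J with hg
  have hgd : ∀ u, u ∈ J ↔ g ∣ u := fun u => Submodule.IsPrincipal.mem_iff_generator_dvd J
  have hg0 : g ≠ 0 := by
    intro h0
    have hinj : Function.Injective (fun (u : F[X]) (v : V) => u.map (algebraMap F K) • v) := by
      intro u u' huu
      have : u - u' ∈ J := by
        rw [hJ]; intro v
        rw [Polynomial.map_sub, sub_smul, sub_eq_zero]
        exact congrFun huu v
      rw [hgd, h0, zero_dvd_iff, sub_eq_zero] at this
      exact this
    haveI := Finite.of_injective _ hinj
    exact not_finite F[X]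
  have hgu : ¬ IsUnit g := by
    intro hu
    have : (1 : F[X]) ∈ J := by rw [hgd]; exact hu.dvd
    rw [hJ] at this
    obtain ⟨v, hv⟩ := exists_ne (0 : V)
    have := this v
    rw [Polynomial.map_one, one_smul] at this
    exact hv this
  obtain ⟨p, hpm, hpi, hpd⟩ := exists_monic_irreducible_factor g hgu
  have hfm : FiniteMultiplicity p g := FiniteMultiplicity.of_not_isUnit hpi.not_isUnit hg0
  obtain ⟨g', hgg, hng⟩ := hfm.exists_eq_pow_mul_and_not_dvd
  obtain ⟨e, he⟩ : ∃ e, multiplicity p g = e + 1 := by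
    refine ⟨multiplicity p g - 1, ?_⟩
    have : multiplicity p g ≠ 0 := by
      intro h0
      rw [h0, pow_zero, one_mul] at hgg
      exact hng (hgg ▸ hpd)
    omega
  rw [he] at hgg
  have hf0 : p ^ e * g' ^ 2 ∉ J := by
    rw [hgd]
    rw [hgg]
    intro hd
    rw [pow_succ, sq, mul_assoc, mul_dvd_mul_iff_left (pow_ne_zero _ hpi.ne_zero),
      mul_dvd_mul_iff_right (show g' ≠ 0 from fun h0 => hng (by rw [h0]; exact dvd_zero p))] at hd
    exact hng hd
  set f0 := (p ^ e * g' ^ 2).map (algebraMap F K) with hf0d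
  have hex : ∃ v0, h (f0 • v0) v0 ≠ 0 := by
    by_contra hcon
    push Not at hcon
    apply hf0
    rw [hJ]
    intro v
    apply H.nondeg
    intro w
    letI : Module K V := Module.compHom V (C : K →+* K[X])
    have hsm : ∀ (a : K) (v : V), a • v = (C a : K[X]) • v := fun _ _ => rfl
    refine polar (HermPair.ne (F := F) (K := K)) (fun v w => h (f0 • v) w) (fun v v' w => ?_)
      (fun v w w' => H.add_right _ _ _) (fun a v w => ?_) (fun a v w => ?_) hcon v w
    · rw [smul_add, H.add]
    · simp only [hsm]
      rw [smul_comm, H.smul]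
    · simp only [hsm]
      rw [H.smul_right]
  obtain ⟨v0, hv0⟩ := hex
  set G := g'.map (algebraMap F K) with hG
  have hpow : ∀ k, (p ^ k).map (algebraMap F K) = ppF F K ⟨p, hpm, hpi⟩ ^ k := fun k => by
    rw [Polynomial.map_pow]; rfl
  refine ⟨⟨p, hpm, hpi⟩, e, G • v0, ?_, ?_⟩
  · rw [← hpow, ← mul_smul, hG, ← Polynomial.map_mul, ← hgg]
    exact (hJ g).1 ((hgd g).2 dvd_rfl) v0
  · have hGs : star G = G := map_star g'
    rw [← mul_smul, ← hGs, ← H.bal, hGs, ← mul_smul]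
    convert hv0 using 3
    rw [hf0d, Polynomial.map_mul, hpow, Polynomial.map_pow]
    ring

lemma classify_aux : ∀ (N : ℕ) (V : Type) [AddCommGroup V] [Module K[X] V] [Finite V] (h : V → V → K),
    IsHF h → Nat.card V ≤ N →
    ∃ (k : ℕ) (c : Fin k → ℕ × PI F), Nonempty (V ≃ₗ[K[X]] Md (ppF F K) c) := by
  intro N
  induction N with
  | zero => intro V _ _ _ h H hN; have := Nat.card_pos (α := V); omega
  | succ N ih =>
    intro V _ _ _ h H hN
    rcases subsingleton_or_nontrivial V with hV | hV
    · exact ⟨0, Fin.elim0, ⟨LinearEquiv.ofBijective 0 ⟨fun _ _ _ => Subsingleton.elim _ _,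
        fun m => ⟨0, funext fun i => i.elim0⟩⟩⟩⟩
    obtain ⟨p, e, v, hv1, hv2⟩ := exists_cyclic F H
    let I : Ideal K[X] :=
      { carrier := {f | ∀ z : K[X], h ((z * f) • v) v = 0}
        add_mem' := fun {a b} ha hb z => by rw [mul_add, add_smul, H.add, ha z, hb z, add_zero]
        zero_mem' := fun z => by rw [mul_zero, zero_smul, H.zero_left]
        smul_mem' := fun a f hf z => by rw [smul_eq_mul, ← mul_assoc]; exact hf _ }
    have hIs : ∀ f ∈ I, star f ∈ I := by
      intro f hf z
      have := hf (star z)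
      rw [H.bal, star_mul, star_star, ← H.herm, star_eq_zero, mul_comm] at this
      exact this
    have hI1 : ppF F K p ^ (e + 1) ∈ I := fun z => by rw [mul_smul, hv1, smul_zero, H.zero_left]
    have hI2 : ppF F K p ^ e ∉ I := fun hh => hv2 (by have := hh 1; rwa [one_mul] at this)
    have hdvd := ideal_descent F I hIs p e hI1 hI2
    have hI0 : ∀ f ∈ I, f • v = 0 := by
      intro f hf
      obtain ⟨z, hz⟩ := hdvd f hf
      rw [hz, mul_comm, mul_smul, hv1, smul_zero]
    let θ : K[X] →ₗ[K[X]] V := LinearMap.toSpanSingleton K[X] V v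
    have hθ : ∀ f, θ f = f • v := fun f => rfl
    have hker : LinearMap.ker θ = Ideal.span {ppF F K p ^ (e + 1)} := by
      ext f
      rw [LinearMap.mem_ker, hθ, Ideal.mem_span_singleton]
      constructor
      · intro hf
        apply hdvd
        intro z
        rw [mul_smul, hf, smul_zero, H.zero_left]
      · rintro ⟨z, rfl⟩
        rw [mul_comm, mul_smul, hv1, smul_zero]
    let W := LinearMap.range θ
    have hWn : ∀ w ∈ W, (∀ w' ∈ W, h w w' = 0) → w = 0 := by
      rintro _ ⟨f, rfl⟩ hw
      rw [hθ] at hw ⊢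
      apply hI0
      intro z
      have := hw (star z • v) ⟨star z, rfl⟩
      rw [← H.bal, ← mul_smul] at this
      exact this
    have HW := H.restrict W hWn
    let Wp : Submodule K[X] V :=
      { carrier := {w | ∀ w' ∈ W, h w w' = 0}
        add_mem' := fun {a b} ha hb w hw => by rw [H.add, ha w hw, hb w hw, add_zero]
        zero_mem' := fun w hw => H.zero_left w
        smul_mem' := fun f a ha w hw => by rw [H.bal]; exact ha _ (W.smul_mem _ hw) }
    have hcodis : ∀ u : V, ∃ w ∈ W, u - w ∈ Wp := by
      intro u
      obtain ⟨w, hw⟩ := HW.dual_surj (fun w => h w.1 u) (fun a b => H.add _ _ _) (fun a b => H.smul _ _ _)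
      refine ⟨w.1, w.2, fun w' hw' => ?_⟩
      have h3 : h w' u = h w' w.1 := hw ⟨w', hw'⟩
      rw [← H.herm, H.sub_right, h3, sub_self, star_zero]
    have hcompl : IsCompl W Wp := by
      constructor
      · rw [Submodule.disjoint_def]
        exact fun w h1 h2 => hWn w h1 h2
      · rw [codisjoint_iff, eq_top_iff]
        intro u _
        obtain ⟨w, hw, hw2⟩ := hcodis u
        rw [← add_sub_cancel w u]
        exact Submodule.add_mem_sup hw hw2
    have HWp := H.restrict Wp (fun w hw hw2 => by
      apply H.nondeg
      intro u
      obtain ⟨w1, h1, h2⟩ := hcodis u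
      rw [← add_sub_cancel w1 u, H.add_right, hw w1 h1, hw2 _ h2, add_zero])
    have hlt : Nat.card Wp < Nat.card V := by
      refine Finite.card_subtype_lt (p := fun x => x ∈ Wp) (x := v) fun hh => hv2 ?_
      rw [H.bal]
      exact hh _ ⟨_, rfl⟩
    obtain ⟨k, c, ⟨E⟩⟩ := ih Wp _ HWp (by omega)
    let E1 : W ≃ₗ[K[X]] Lam (ppF F K) (e, p) :=
      (LinearMap.quotKerEquivRange θ).symm.trans (Submodule.quotEquivOfEq _ _ hker)
    refine ⟨k + 1, Fin.cons (e, p) c, ⟨?_⟩⟩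
    exact (Submodule.prodEquivOfIsCompl W Wp hcompl).symm.trans
      ((LinearEquiv.prodCongr E1 E).trans
        (Fin.consLinearEquiv K[X] (fun a => Lam (ppF F K) (Fin.cons (α := fun _ => ℕ × PI F) (e, p) c a))))

variable (F) in
theorem classify {h : V → V → K} (H : IsHF h) :
    ∃ (k : ℕ) (c : Fin k → ℕ × PI F), Nonempty (V ≃ₗ[K[X]] Md (ppF F K) c) :=
  classify_aux _ V h H le_rfl

end cls
end FFU

end file_P5a

section file_P6a
open Finset Polynomial Matrix
namespace FFU
set_option linter.unusedSectionVars false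
set_option linter.unusedVariables false
set_option linter.style.haveILetI false

section mat
variable {K : Type} [Field K] [StarRing K] [Finite K] {n : ℕ}

abbrev fA (A : Matrix (Fin n) (Fin n) K) : Type :=
  {x : Matrix (Fin n) (Fin n) K × Matrix (Fin n) (Fin n) K //
    (x.1.IsHermitian ∧ IsUnit x.1) ∧ (x.1 * A).IsHermitian ∧ (x.1 * x.2).IsHermitian ∧ A * x.2 = x.2 * A}

abbrev CP (K : Type) [Field K] [StarRing K] (n : ℕ) : Type :=
  {P : Matrix (Fin n) (Fin n) K × Matrix (Fin n) (Fin n) K //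
    P.1.IsHermitian ∧ P.2.IsHermitian ∧ P.1 * P.2 = P.2 * P.1}

lemma herm_conj {A : Matrix (Fin n) (Fin n) K} (hA : A.IsHermitian) (g : Matrix (Fin n) (Fin n) K) :
    (g * A * gᴴ).IsHermitian := by
  rw [Matrix.IsHermitian, Matrix.conjTranspose_mul, Matrix.conjTranspose_mul,
    Matrix.conjTranspose_conjTranspose, hA.eq, Matrix.mul_assoc]

lemma count1 (ht : Trans K (Fin n)) [Fintype (Matrix (Fin n) (Fin n) K)] :
    Nat.card (CP K n) * Nat.card (HU K (Fin n)) =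
    ∑ A : Matrix (Fin n) (Fin n) K, Nat.card (fA A) := by
  rw [← Nat.card_prod, ← Nat.card_sigma]
  have hg : ∀ h : HU K (Fin n), ∃ g u : Matrix (Fin n) (Fin n) K, h.1 = g * gᴴ ∧ g * u = 1 ∧ u * g = 1 := by
    intro h
    obtain ⟨g, hg, he⟩ := ht h.1 h.2.1 h.2.2
    obtain ⟨u, hu⟩ := hg.exists_right_inv
    exact ⟨g, u, he, hu, mul_eq_one_comm.1 hu⟩
  choose g u hgu hg1 hg2 using hg
  have hu1 : ∀ h, (u h)ᴴ * (g h)ᴴ = 1 := fun h => by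
    rw [← Matrix.conjTranspose_mul, hg1, Matrix.conjTranspose_one]
  have hu2 : ∀ h, (g h)ᴴ * (u h)ᴴ = 1 := fun h => by
    rw [← Matrix.conjTranspose_mul, hg2, Matrix.conjTranspose_one]
  have m1 : ∀ h (A : Matrix (Fin n) (Fin n) K), (g h)ᴴ * ((u h)ᴴ * A) = A := fun h A => by
    rw [← Matrix.mul_assoc, hu2, Matrix.one_mul]
  have m2 : ∀ h (A : Matrix (Fin n) (Fin n) K), (u h)ᴴ * ((g h)ᴴ * A) = A := fun h A => by
    rw [← Matrix.mul_assoc, hu1, Matrix.one_mul]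
  have m3 : ∀ h (A : Matrix (Fin n) (Fin n) K), (u h) * ((g h) * A) = A := fun h A => by
    rw [← Matrix.mul_assoc, hg2, Matrix.one_mul]
  have k1 : ∀ h A, (A : Matrix (Fin n) (Fin n) K).IsHermitian → (h.1 * ((u h)ᴴ * A * (g h)ᴴ)).IsHermitian := by
    intro h A hA
    have := herm_conj hA (g h)
    rw [hgu h]
    convert this using 1
    simp only [Matrix.mul_assoc, m1]
  have k2 : ∀ h A, (h.1 * A).IsHermitian → ((g h)ᴴ * A * (u h)ᴴ).IsHermitian := by
    intro h A hA
    have := herm_conj hA (u h)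
    rw [hgu h] at this
    convert this using 1
    simp only [Matrix.mul_assoc, m3]
  have comm2 : ∀ h (A B : Matrix (Fin n) (Fin n) K), A * B = B * A →
      (g h)ᴴ * A * (u h)ᴴ * ((g h)ᴴ * B * (u h)ᴴ) = (g h)ᴴ * B * (u h)ᴴ * ((g h)ᴴ * A * (u h)ᴴ) := by
    intro h A B this
    simp only [Matrix.mul_assoc, m2]
    rw [← Matrix.mul_assoc A, this, Matrix.mul_assoc]
  refine Nat.card_congr
    { toFun := fun x => ⟨(u x.2)ᴴ * x.1.1.1 * (g x.2)ᴴ, (x.2.1, (u x.2)ᴴ * x.1.1.2 * (g x.2)ᴴ), x.2.2,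
        k1 _ _ x.1.2.1, k1 _ _ x.1.2.2.1, ?_⟩
      invFun := fun y => (⟨((g ⟨y.2.1.1, y.2.2.1⟩)ᴴ * y.1 * (u ⟨y.2.1.1, y.2.2.1⟩)ᴴ,
        (g ⟨y.2.1.1, y.2.2.1⟩)ᴴ * y.2.1.2 * (u ⟨y.2.1.1, y.2.2.1⟩)ᴴ), k2 ⟨y.2.1.1, y.2.2.1⟩ _ y.2.2.2.1,
        k2 ⟨y.2.1.1, y.2.2.1⟩ _ y.2.2.2.2.1, ?_⟩, ⟨y.2.1.1, y.2.2.1⟩)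
      left_inv := ?_
      right_inv := ?_ }
  · have := x.1.2.2.2
    simp only [Matrix.mul_assoc, m1]
    rw [← Matrix.mul_assoc x.1.1.1, this, Matrix.mul_assoc]
  · exact comm2 _ _ _ y.2.2.2.2.2
  · rintro ⟨⟨⟨A, B⟩, h1⟩, ⟨h, h2⟩⟩
    refine Prod.ext (Subtype.ext (Prod.ext ?_ ?_)) rfl
    · simp only [Matrix.mul_assoc, m1, hu2, Matrix.mul_one]
    · simp only [Matrix.mul_assoc, m1, hu2, Matrix.mul_one]
  · rintro ⟨A, ⟨⟨h, B⟩, h2⟩⟩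
    have e1 : ∀ A : Matrix (Fin n) (Fin n) K, (u ⟨h, h2.1⟩)ᴴ * ((g ⟨h, h2.1⟩)ᴴ * A * (u ⟨h, h2.1⟩)ᴴ) * (g ⟨h, h2.1⟩)ᴴ = A := by
      intro A
      simp only [Matrix.mul_assoc, m2, hu1, Matrix.mul_one]
    have aux : ∀ (A A' : Matrix (Fin n) (Fin n) K) (hA : A' = A) (x : fA A') (y : fA A), x.1 = y.1 →
        (⟨A', x⟩ : Σ A : Matrix (Fin n) (Fin n) K, fA A) = ⟨A, y⟩ := by
      rintro A _ rfl x y hxy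
      rw [Subtype.ext hxy]
    exact aux _ _ (e1 A) _ _ (Prod.ext rfl (e1 B))

abbrev TT (A H : Matrix (Fin n) (Fin n) K) : Type :=
  {R : Matrix (Fin n) (Fin n) K // R * A = A * R ∧ (H * R).IsHermitian}

lemma count2 (A H : Matrix (Fin n) (Fin n) K) (hH : H.IsHermitian) (hu : IsUnit H)
    (hA : (H * A).IsHermitian) :
    Nat.card (fA A) = Nat.card {R : TT A H // IsUnit R.1} * Nat.card (TT A H) := by
  rw [← Nat.card_prod]
  obtain ⟨J, hJ⟩ := hu.exists_right_inv
  have hJ2 : J * H = 1 := mul_eq_one_comm.1 hJ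
  have q1 : ∀ Z : Matrix (Fin n) (Fin n) K, J * (H * Z) = Z := fun Z => by
    rw [← Matrix.mul_assoc, hJ2, Matrix.one_mul]
  have q2 : ∀ Z : Matrix (Fin n) (Fin n) K, H * (J * Z) = Z := fun Z => by
    rw [← Matrix.mul_assoc, hJ, Matrix.one_mul]
  have hAH : Aᴴ * H = H * A := by
    have := hA.eq
    rwa [Matrix.conjTranspose_mul, hH.eq] at this
  have hJA : ∀ Z : Matrix (Fin n) (Fin n) K, J * (Aᴴ * Z) = A * (J * Z) := fun Z => by
    have : Aᴴ = H * A * J := by rw [← hAH, Matrix.mul_assoc, hJ, Matrix.mul_one]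
    rw [this]; simp only [Matrix.mul_assoc, q1]
  have hcomm : ∀ Z : Matrix (Fin n) (Fin n) K, Z.IsHermitian → (Z * A).IsHermitian → (J * Z) * A = A * (J * Z) := by
    intro Z hZ hZA
    have h1 := hZA.eq
    rw [Matrix.conjTranspose_mul, hZ.eq] at h1
    rw [Matrix.mul_assoc, ← h1, hJA]
  have hinv : ∀ R : Matrix (Fin n) (Fin n) K, IsUnit R → R⁻¹ * R = 1 ∧ R * R⁻¹ = 1 := fun R hR =>
    ⟨Matrix.nonsing_inv_mul _ ((Matrix.isUnit_iff_isUnit_det _).1 hR),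
      Matrix.mul_nonsing_inv _ ((Matrix.isUnit_iff_isUnit_det _).1 hR)⟩
  refine Nat.card_congr
    { toFun := fun x => (⟨⟨J * x.1.1, hcomm _ x.2.1.1 x.2.2.1, by rw [q2]; exact x.2.1.1⟩,
          (IsUnit.of_mul_eq_one_right _ hJ).mul x.2.1.2⟩,
        ⟨J * (x.1.1 * x.1.2), ?_, by rw [q2]; exact x.2.2.2.1⟩)
      invFun := fun y => ⟨(H * y.1.1.1, (y.1.1.1)⁻¹ * y.2.1), ⟨y.1.1.2.2, hu.mul y.1.2⟩, ?_, ?_, ?_⟩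
      left_inv := ?_
      right_inv := ?_ }
  · have h1 := hcomm _ x.2.1.1 x.2.2.1
    have h2 := x.2.2.2.2
    calc J * (x.1.1 * x.1.2) * A = J * x.1.1 * (x.1.2 * A) := by simp only [Matrix.mul_assoc]
      _ = (J * x.1.1 * A) * x.1.2 := by rw [← h2]; simp only [Matrix.mul_assoc]
      _ = A * (J * (x.1.1 * x.1.2)) := by rw [h1]; simp only [Matrix.mul_assoc]
  · have h1 := y.1.1.2.1
    have h2 := y.1.1.2.2
    simp only
    rw [Matrix.IsHermitian, Matrix.conjTranspose_mul, h2.eq, ← Matrix.mul_assoc, hAH, Matrix.mul_assoc,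
      Matrix.mul_assoc, h1]
  · simp only
    rw [Matrix.mul_assoc, ← Matrix.mul_assoc y.1.1.1, (hinv _ y.1.2).2, Matrix.one_mul]
    exact y.2.2.2
  · have h1 := y.1.1.2.1
    have h2 := y.2.2.1
    obtain ⟨i1, i2⟩ := hinv _ y.1.2
    simp only
    set R := y.1.1.1
    have h3 : A * R⁻¹ = R⁻¹ * A := by
      calc A * R⁻¹ = R⁻¹ * (R * A) * R⁻¹ := by rw [← Matrix.mul_assoc, i1, Matrix.one_mul]
        _ = R⁻¹ * A := by rw [h1, Matrix.mul_assoc, Matrix.mul_assoc, i2, Matrix.mul_one]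
    rw [← Matrix.mul_assoc, h3, Matrix.mul_assoc, ← h2, Matrix.mul_assoc]
  · rintro ⟨⟨h, B⟩, hx⟩
    obtain ⟨i1, i2⟩ := hinv (J * h) ((IsUnit.of_mul_eq_one_right _ hJ).mul hx.1.2)
    refine Subtype.ext (Prod.ext ?_ ?_)
    · exact q2 h
    · simp only
      rw [← Matrix.mul_assoc J, ← Matrix.mul_assoc, i1, Matrix.one_mul]
  · rintro ⟨⟨⟨R, hR⟩, hR2⟩, ⟨S, hS⟩⟩
    obtain ⟨i1, i2⟩ := hinv R hR2
    refine Prod.ext (Subtype.ext (Subtype.ext ?_)) (Subtype.ext ?_)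
    · exact q1 R
    · simp only
      rw [Matrix.mul_assoc, q1, ← Matrix.mul_assoc, i2, Matrix.one_mul]

end mat
end FFU

end file_P6a

section file_P6b
open Finset Polynomial Matrix
namespace FFU
set_option linter.unusedSectionVars false
set_option linter.unusedVariables false
set_option linter.style.haveILetI false

section iso
variable {K : Type} [Field K] {n : ℕ}
variable {V : Type} [AddCommGroup V] [Module K[X] V]

lemma poly_lin {W : Type} [AddCommGroup W] [Module K[X] W] (g : V →+ W)
    (hC : ∀ (a : K) v, g ((C a : K[X]) • v) = (C a : K[X]) • g v)
    (hX : ∀ v, g ((X : K[X]) • v) = (X : K[X]) • g v) (f : K[X]) :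
    ∀ v, g (f • v) = f • g v := by
  induction f using Polynomial.induction_on' with
  | add p q hp hq => intro v; rw [add_smul, map_add, hp, hq, add_smul]
  | monomial k a =>
    intro v
    rw [← C_mul_X_pow_eq_monomial, mul_smul, hC, mul_smul]
    congr 1
    induction k generalizing v with
    | zero => simp
    | succ k ih => rw [pow_succ, mul_smul, ih, hX, mul_smul]

variable (K n V) in
/-- semilinear identifications of `K^n` with `V` -/
structure Sem where
  e : (Fin n → K) ≃+ V
  sm : ∀ (a : K) v, e (a • v) = (C a : K[X]) • e v

namespace Sem
lemma symm_sm (φ : Sem K n V) (a : K) (v : V) : φ.e.symm ((C a : K[X]) • v) = a • φ.e.symm v := by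
  apply φ.e.injective
  rw [φ.sm]; simp

/-- pull back an additive map commuting with constants to a matrix -/
noncomputable def mat {W : Type} [AddCommGroup W] [Module K[X] W] (φ : Sem K n V) (ψ : Sem K n W) (g : V →+ W)
    (hC : ∀ (a : K) v, g ((C a : K[X]) • v) = (C a : K[X]) • g v) : Matrix (Fin n) (Fin n) K :=
  LinearMap.toMatrix' (
    { toFun := fun v => ψ.e.symm (g (φ.e v))
      map_add' := fun v w => by simp
      map_smul' := fun a v => by rw [φ.sm, hC, ψ.symm_sm]; rfl } : (Fin n → K) →ₗ[K] (Fin n → K))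

lemma mat_spec {W : Type} [AddCommGroup W] [Module K[X] W] (φ : Sem K n V) (ψ : Sem K n W) (g : V →+ W)
    (hC : ∀ (a : K) v, g ((C a : K[X]) • v) = (C a : K[X]) • g v) (v : Fin n → K) :
    ψ.e (φ.mat ψ g hC *ᵥ v) = g (φ.e v) := by
  rw [mat, LinearMap.toMatrix'_mulVec]
  simp

noncomputable def matl (φ : Sem K n V) (r : V →ₗ[K[X]] V) : Matrix (Fin n) (Fin n) K :=
  φ.mat φ r.toAddMonoidHom (fun a v => r.map_smul _ _)

lemma matl_spec (φ : Sem K n V) (r : V →ₗ[K[X]] V) (v : Fin n → K) : φ.e (φ.matl r *ᵥ v) = r (φ.e v) :=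
  φ.mat_spec φ _ _ v
end Sem

lemma mat_ext {M N : Matrix (Fin n) (Fin n) K} (h : ∀ v, M *ᵥ v = N *ᵥ v) : M = N := by
  apply Matrix.toLin'.injective
  ext1 v
  ext1
  simp [h]

/-- `φ` carries the action of `A` to that of `X` -/
def Ad (A : Matrix (Fin n) (Fin n) K) (φ : Sem K n V) : Prop := ∀ v, φ.e (A *ᵥ v) = (X : K[X]) • φ.e v

lemma Ad.symm {A : Matrix (Fin n) (Fin n) K} {φ : Sem K n V} (h : Ad A φ) (v : V) :
    φ.e.symm ((X : K[X]) • v) = A *ᵥ φ.e.symm v := by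
  apply φ.e.injective
  rw [h]; simp

noncomputable def Ad.endo {A : Matrix (Fin n) (Fin n) K} {φ : Sem K n V} (h : Ad A φ) :
    {R : Matrix (Fin n) (Fin n) K // R * A = A * R} ≃ (V →ₗ[K[X]] V) where
  toFun R :=
    { toFun := fun v => φ.e (R.1 *ᵥ φ.e.symm v)
      map_add' := fun v w => by rw [map_add, Matrix.mulVec_add, map_add]
      map_smul' := fun f v => by
        refine poly_lin (V := V) (W := V) (K := K) (g := AddMonoidHom.mk' (fun v => φ.e (R.1 *ᵥ φ.e.symm v))
          (fun v w => by rw [map_add, Matrix.mulVec_add, map_add])) ?_ ?_ f v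
        · intro a v
          change φ.e (R.1 *ᵥ φ.e.symm _) = _ • φ.e _
          rw [φ.symm_sm, Matrix.mulVec_smul, φ.sm]
        · intro v
          change φ.e (R.1 *ᵥ φ.e.symm _) = _ • φ.e _
          rw [h.symm, Matrix.mulVec_mulVec, R.2, ← Matrix.mulVec_mulVec, h] }
  invFun r := ⟨φ.matl r, mat_ext fun v => by
    apply φ.e.injective
    rw [← Matrix.mulVec_mulVec, ← Matrix.mulVec_mulVec, h, φ.matl_spec, φ.matl_spec, h, map_smul]⟩
  left_inv R := by
    apply Subtype.ext
    apply mat_ext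
    intro v
    apply φ.e.injective
    refine (φ.matl_spec _ _).trans ?_
    change φ.e (R.1 *ᵥ φ.e.symm _) = _
    simp
  right_inv r := by
    ext v
    change φ.e (_ *ᵥ φ.e.symm _) = _
    refine (φ.matl_spec _ _).trans ?_
    rw [AddEquiv.apply_symm_apply]

lemma Ad.endo_apply {A : Matrix (Fin n) (Fin n) K} {φ : Sem K n V} (h : Ad A φ)
    (R : {R : Matrix (Fin n) (Fin n) K // R * A = A * R}) (v : Fin n → K) :
    h.endo R (φ.e v) = φ.e (R.1 *ᵥ v) := by
  change φ.e (R.1 *ᵥ φ.e.symm _) = _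
  simp

lemma isUnit_iff_bij (R : Matrix (Fin n) (Fin n) K) : IsUnit R ↔ Function.Bijective (fun v => R *ᵥ v) := by
  constructor
  · intro h
    exact ⟨Matrix.mulVec_injective_iff_isUnit.2 h, Matrix.mulVec_surjective_iff_isUnit.2 h⟩
  · intro h
    exact Matrix.mulVec_injective_iff_isUnit.1 h.1

lemma Ad.endo_bij {A : Matrix (Fin n) (Fin n) K} {φ : Sem K n V} (h : Ad A φ)
    (R : {R : Matrix (Fin n) (Fin n) K // R * A = A * R}) :
    Function.Bijective (h.endo R) ↔ IsUnit R.1 := by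
  rw [isUnit_iff_bij]
  have : (h.endo R : V → V) = φ.e ∘ (fun v => R.1 *ᵥ v) ∘ φ.e.symm := by
    funext v; rfl
  rw [this]
  have e1 := φ.e.bijective
  have e2 := φ.e.symm.bijective
  rw [Function.Bijective.of_comp_iff' e1, Function.Bijective.of_comp_iff _ e2]

end iso

section L4
variable {K : Type} [Field K] {n : ℕ}
variable {V : Type} [AddCommGroup V] [Module K[X] V]

lemma orbit_count (φ₀ : Sem K n V) :
    Nat.card {A : Matrix (Fin n) (Fin n) K // ∃ φ : Sem K n V, Ad A φ} *
      Nat.card {r : V →ₗ[K[X]] V // Function.Bijective r} =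
    Nat.card {g : Matrix (Fin n) (Fin n) K // IsUnit g} := by
  rw [← Nat.card_prod]
  have hch : ∀ A : {A : Matrix (Fin n) (Fin n) K // ∃ φ : Sem K n V, Ad A φ}, ∃ φ : Sem K n V, Ad A.1 φ :=
    fun A => A.2
  choose ψ hψ using hch
  let M : {A : Matrix (Fin n) (Fin n) K // ∃ φ : Sem K n V, Ad A φ} × {r : V →ₗ[K[X]] V // Function.Bijective r} →
    Matrix (Fin n) (Fin n) K := fun x => (ψ x.1).mat φ₀ x.2.1.toAddMonoidHom (fun a v => x.2.1.map_smul _ _)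
  have hM : ∀ x v, φ₀.e (M x *ᵥ v) = x.2.1 ((ψ x.1).e v) := fun x v => (ψ x.1).mat_spec _ _ _ v
  have hM' : ∀ x v, M x *ᵥ v = φ₀.e.symm (x.2.1 ((ψ x.1).e v)) := fun x v => by
    rw [← hM]; simp
  have hMu : ∀ x, IsUnit (M x) := by
    intro x
    rw [isUnit_iff_bij]
    have : (fun v => M x *ᵥ v) = φ₀.e.symm ∘ x.2.1 ∘ (ψ x.1).e := by
      funext v; exact hM' x v
    rw [this]
    exact φ₀.e.symm.bijective.comp (x.2.2.comp (ψ x.1).e.bijective)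
  refine Nat.card_congr (Equiv.ofBijective (fun x => ⟨M x, hMu x⟩) ⟨?_, ?_⟩)
  · rintro ⟨A, r⟩ ⟨B, s⟩ hxy
    have hm : M (A, r) = M (B, s) := congrArg Subtype.val hxy
    have h1 : ∀ v, r.1 ((ψ A).e v) = s.1 ((ψ B).e v) := by
      intro v
      rw [← hM (A, r), ← hM (B, s), hm]
    have hAB : A = B := by
      apply Subtype.ext
      apply mat_ext
      intro v
      apply (ψ B).e.injective
      apply s.2.1
      rw [← h1, hψ A, hψ B, map_smul, map_smul, h1]
    subst hAB
    have hrs : r = s := by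
      apply Subtype.ext
      ext v
      have := h1 ((ψ A).e.symm v)
      simpa using this
    rw [hrs]
  · rintro ⟨g, hg⟩
    have hg' := (isUnit_iff_bij g).1 hg
    let G : (Fin n → K) ≃+ (Fin n → K) := AddEquiv.ofBijective
      (AddMonoidHom.mk' (fun v => g *ᵥ v) (fun v w => Matrix.mulVec_add _ _ _)) hg'
    have hG : ∀ v, G v = g *ᵥ v := fun v => rfl
    let φ : Sem K n V := ⟨G.trans φ₀.e, fun a v => by
      simp only [AddEquiv.trans_apply, hG]
      rw [Matrix.mulVec_smul, φ₀.sm]⟩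
    have hφ : ∀ v, φ.e v = φ₀.e (g *ᵥ v) := fun v => rfl
    let A : Matrix (Fin n) (Fin n) K := φ.mat φ (AddMonoidHom.mk' (fun v => (X : K[X]) • v) (fun v w => smul_add _ _ _))
      (fun a v => smul_comm _ _ _)
    have hA : Ad A φ := fun v => φ.mat_spec _ _ _ v
    let A' : {A : Matrix (Fin n) (Fin n) K // ∃ φ : Sem K n V, Ad A φ} := ⟨A, φ, hA⟩
    let r0 : V →+ V := (φ.e.toAddMonoidHom).comp ((ψ A').e.symm.toAddMonoidHom)
    have hr0 : ∀ v, r0 v = φ.e ((ψ A').e.symm v) := fun v => rfl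
    have hr1 : ∀ (f : K[X]) v, r0 (f • v) = f • r0 v := by
      refine poly_lin r0 ?_ ?_
      · intro a v
        rw [hr0, hr0, (ψ A').symm_sm, φ.sm]
      · intro v
        rw [hr0, hr0, (hψ A').symm, hA]
    let r : V →ₗ[K[X]] V := { r0 with map_smul' := hr1 }
    have hr : ∀ v, r v = φ.e ((ψ A').e.symm v) := fun v => rfl
    have hrb : Function.Bijective r := φ.e.bijective.comp (ψ A').e.symm.bijective
    refine ⟨(A', ⟨r, hrb⟩), Subtype.ext (mat_ext fun v => ?_)⟩
    apply φ₀.e.injective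
    rw [hM, hr]
    simp [hφ]

end L4

section L2
variable {K : Type} [Field K] [StarRing K] {n : ℕ}
variable {V : Type} [AddCommGroup V] [Module K[X] V]

lemma sesq_ext {M N : Matrix (Fin n) (Fin n) K} (h : ∀ v w, star w ⬝ᵥ M *ᵥ v = star w ⬝ᵥ N *ᵥ v) : M = N := by
  ext i j
  have := h (Pi.single j 1) (Pi.single i 1)
  simpa [← Pi.single_star] using this

lemma L2 {h : V → V → K} (H : IsHF h) {A : Matrix (Fin n) (Fin n) K} {φ : Sem K n V} (hA : Ad A φ) :
    ∃ J : Matrix (Fin n) (Fin n) K, J.IsHermitian ∧ IsUnit J ∧ (J * A).IsHermitian ∧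
      Nat.card (TT A J) = Nat.card {r : V →ₗ[K[X]] V // ∀ v w, h (r v) w = h v (r w)} ∧
      Nat.card {R : TT A J // IsUnit R.1} =
        Nat.card {r : {r : V →ₗ[K[X]] V // ∀ v w, h (r v) w = h v (r w)} // Function.Bijective r.1} := by
  let b : (Fin n → K) → (Fin n → K) → K := fun v w => h (φ.e v) (φ.e w)
  have hadd : ∀ u v w, b (u + v) w = b u w + b v w := fun u v w => by
    simp only [b]; rw [map_add, H.add]
  have hsm : ∀ (a : K) v w, b (a • v) w = a * b v w := fun a v w => by
    simp only [b]; rw [φ.sm, H.smul]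
  have hst : ∀ v w, star (b v w) = b w v := fun v w => H.herm _ _
  let bl : (Fin n → K) → ((Fin n → K) →ₗ[K] K) := fun w =>
    { toFun := fun v => b v w, map_add' := fun u v => hadd u v w, map_smul' := fun a v => hsm a v w }
  have hbl : ∀ v w, b v w = ∑ j, v j * b (Pi.single j 1) w := by
    intro v w
    change bl w v = ∑ j, v j * bl w (Pi.single j 1)
    rw [LinearMap.pi_apply_eq_sum_univ]
    refine Finset.sum_congr rfl fun j _ => ?_
    rw [smul_eq_mul]
    congr 2
    funext k
    simp [Pi.single_apply, eq_comm]
  let J : Matrix (Fin n) (Fin n) K := Matrix.of fun i j => b (Pi.single j 1) (Pi.single i 1)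
  have hJ : ∀ v w, b v w = star w ⬝ᵥ J *ᵥ v := by
    intro v w
    rw [hbl, dotProduct]
    simp only [mulVec, dotProduct, Finset.mul_sum, J, Matrix.of_apply]
    rw [Finset.sum_comm]
    refine Finset.sum_congr rfl fun j _ => ?_
    rw [← hst, hbl w, star_sum, Finset.mul_sum]
    refine Finset.sum_congr rfl fun i _ => ?_
    rw [star_mul', hst]
    simp only [Pi.star_apply]
    ring
  have hJh : J.IsHermitian := by
    ext i j
    rw [Matrix.conjTranspose_apply]
    exact hst _ _
  have k1 : ∀ (R : Matrix (Fin n) (Fin n) K) v w, b (R *ᵥ v) w = star w ⬝ᵥ (J * R) *ᵥ v := by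
    intro R v w
    rw [hJ, Matrix.mulVec_mulVec]
  have k2 : ∀ (R : Matrix (Fin n) (Fin n) K) v w, b v (R *ᵥ w) = star w ⬝ᵥ (J * R)ᴴ *ᵥ v := by
    intro R v w
    rw [hJ, Matrix.star_mulVec, ← Matrix.dotProduct_mulVec, Matrix.mulVec_mulVec,
      Matrix.conjTranspose_mul, hJh.eq]
  have k3 : ∀ R : Matrix (Fin n) (Fin n) K, (J * R).IsHermitian ↔ ∀ v w, b (R *ᵥ v) w = b v (R *ᵥ w) := by
    intro R
    constructor
    · intro hR v w
      rw [k1, k2, hR.eq]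
    · intro hR
      exact sesq_ext fun v w => by rw [← k1, ← k2, hR]
  have k4 : ∀ R : {R : Matrix (Fin n) (Fin n) K // R * A = A * R}, (J * R.1).IsHermitian ↔
      ∀ v w, h (hA.endo R v) w = h v (hA.endo R w) := by
    intro R
    rw [k3]
    constructor
    · intro hR v w
      have := hR (φ.e.symm v) (φ.e.symm w)
      simp only [b] at this
      rw [← hA.endo_apply, ← hA.endo_apply] at this
      simpa using this
    · intro hR v w
      simp only [b]
      rw [← hA.endo_apply, ← hA.endo_apply, hR]
  let E : TT A J ≃ {r : V →ₗ[K[X]] V // ∀ v w, h (r v) w = h v (r w)} :=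
    (Equiv.subtypeSubtypeEquivSubtypeInter (fun R => R * A = A * R) (fun R => (J * R).IsHermitian)).symm.trans
      (Equiv.subtypeEquiv hA.endo k4)
  refine ⟨J, hJh, ?_, ?_, Nat.card_congr E, Nat.card_congr (Equiv.subtypeEquiv E ?_)⟩
  · rw [← Matrix.mulVec_injective_iff_isUnit]
    intro v w hvw
    have : φ.e (v - w) = 0 := by
      apply H.nondeg
      intro z
      obtain ⟨z, rfl⟩ := φ.e.surjective z
      change b (v - w) z = 0
      have hvw' : J *ᵥ v = J *ᵥ w := hvw
      rw [hJ, Matrix.mulVec_sub, hvw', sub_self, dotProduct_zero]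
    rw [← sub_eq_zero]
    exact φ.e.injective (by rw [this, map_zero])
  · rw [k3]
    intro v w
    simp only [b]
    rw [hA, hA, H.bal, poly_star_X]
  · intro R
    exact (hA.endo_bij ⟨R.1, R.2.1⟩).symm

/-- from a hermitian pair to a form on `AEval'` -/
lemma L3 [Finite K] {F : Type} [Field F] [Algebra F K] [HermPair F K] {A J : Matrix (Fin n) (Fin n) K}
    (hJ : J.IsHermitian) (hu : IsUnit J) (hJA : (J * A).IsHermitian) :
    ∃ (k : ℕ) (c : Fin k → ℕ × PI F) (φ : Sem K n (Md (ppF F K) c)), Ad A φ := by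
  let W := Module.AEval' (Matrix.toLin' A)
  let e : (Fin n → K) ≃ₗ[K] W := Module.AEval'.of (Matrix.toLin' A)
  have hC : ∀ (a : K) v, e (a • v) = (C a : K[X]) • e v := by
    intro a v
    rw [map_smul, Module.AEval.C_smul]
  have hX : ∀ v, e (A *ᵥ v) = (X : K[X]) • e v := by
    intro v
    exact (Module.AEval'.X_smul_of (Matrix.toLin' A) v).symm
  let φ : Sem K n W := ⟨e.toAddEquiv, hC⟩
  have hφ : Ad A φ := hX
  haveI : Finite W := Finite.of_equiv _ e.toEquiv
  let b : (Fin n → K) → (Fin n → K) → K := fun v w => star w ⬝ᵥ J *ᵥ v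
  let h : W → W → K := fun v w => b (e.symm v) (e.symm w)
  have hadd : ∀ u v w, h (u + v) w = h u w + h v w := by
    intro u v w
    simp only [h, b]
    rw [map_add, Matrix.mulVec_add, dotProduct_add]
  have hherm : ∀ v w, star (h v w) = h w v := by
    intro v w
    simp only [h, b]
    rw [Matrix.star_dotProduct, star_star, Matrix.star_mulVec, hJ.eq, ← Matrix.dotProduct_mulVec]
  have hsm : ∀ (a : K) v w, h ((C a : K[X]) • v) w = a * h v w := by
    intro a v w
    simp only [h, b]
    rw [Module.AEval.C_smul, map_smul, Matrix.mulVec_smul, dotProduct_smul, smul_eq_mul]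
  have hXX : ∀ v w, h ((X : K[X]) • v) w = h v ((X : K[X]) • w) := by
    intro v w
    obtain ⟨v, rfl⟩ := e.surjective v
    obtain ⟨w, rfl⟩ := e.surjective w
    rw [← hX, ← hX]
    simp only [h, b, LinearEquiv.symm_apply_apply]
    have h1 := hJA.eq
    rw [Matrix.conjTranspose_mul, hJ.eq] at h1
    rw [Matrix.star_mulVec, ← Matrix.dotProduct_mulVec, Matrix.mulVec_mulVec, Matrix.mulVec_mulVec, h1]
  have haddr : ∀ u v w, h u (v + w) = h u v + h u w := by
    intro u v w
    rw [← hherm, hadd, star_add, hherm, hherm]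
  have hsmr : ∀ (a : K) v w, h v ((C (star a) : K[X]) • w) = a * h v w := by
    intro a v w
    rw [← hherm, hsm, star_mul', hherm, star_star]
  have H : IsHF h := by
    refine ⟨hadd, hsm, ?_, hherm, ?_⟩
    · intro f
      induction f using Polynomial.induction_on' with
      | add p q hp hq => intro v w; rw [add_smul, hadd, hp, hq, star_add, add_smul, haddr]
      | monomial k a =>
        intro v w
        rw [← C_mul_X_pow_eq_monomial, mul_smul, hsm, star_mul, star_pow, poly_star_X, poly_star_C,
          mul_comm (X ^ k), mul_smul, hsmr]
        congr 1
        induction k generalizing v w with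
        | zero => simp
        | succ k ih => rw [pow_succ, mul_smul, ih, hXX, ← mul_smul, mul_comm X]
    · intro v hv
      obtain ⟨v, rfl⟩ := e.surjective v
      have h1 : J *ᵥ v = 0 := by
        funext i
        have := hv (e (Pi.single i 1))
        simp only [h, b, LinearEquiv.symm_apply_apply] at this
        simpa [← Pi.single_star] using this
      have h2 := Matrix.mulVec_injective_iff_isUnit.2 hu
      have : v = 0 := h2 (by simpa using h1)
      rw [this, map_zero]
  obtain ⟨k, c, ⟨θ⟩⟩ := classify F H
  refine ⟨k, c, ⟨e.toAddEquiv.trans θ.toAddEquiv, fun a v => ?_⟩, fun v => ?_⟩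
  · change θ (e (a • v)) = _ • θ (e v)
    rw [hC, map_smul]
  · change θ (e (A *ᵥ v)) = _ • θ (e v)
    rw [hX, map_smul]
end L2
end FFU

end file_P6b

section file_P6c
open Finset Polynomial Matrix
namespace FFU
set_option linter.unusedSectionVars false
set_option linter.unusedVariables false
set_option linter.style.haveILetI false

section typ
variable {F K : Type} [Field F] [Field K] [Algebra F K] [StarRing K] [HermPair F K] [Finite K]
variable {n k k' : ℕ}

noncomputable def cnt (c : Fin k → ℕ × PI F) : ℕ × PI F →₀ ℕ := ∑ a, Finsupp.single (c a) 1

lemma cnt_apply (c : Fin k → ℕ × PI F) (i : ℕ × PI F) : cnt c i = Fintype.card {a // c a = i} := by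
  rw [cnt, Finsupp.finsetSum_apply, Fintype.card_subtype, Finset.card_filter]
  refine Finset.sum_congr rfl fun a _ => ?_
  rw [Finsupp.single_apply]

lemma cnt_surj (τ : ℕ × PI F →₀ ℕ) : ∃ (k : ℕ) (c : Fin k → ℕ × PI F), cnt c = τ := by
  induction τ using Finsupp.induction_linear with
  | zero => exact ⟨0, Fin.elim0, by simp [cnt]⟩
  | add f g hf hg =>
    obtain ⟨k, c, rfl⟩ := hf
    obtain ⟨l, d, rfl⟩ := hg
    exact ⟨k + l, Fin.append c d, by simp [cnt, Fin.sum_univ_add]⟩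
  | single i m =>
    exact ⟨m, fun _ => i, by simp [cnt]⟩

lemma tdeg_cnt (c : Fin k → ℕ × PI F) : tdeg (pdeg F) (cnt c) = ∑ a, ((c a).1 + 1) * pdeg F (c a).2 := by
  rw [tdeg, cnt, ← Finsupp.sum_finsetSum_index]
  · refine Finset.sum_congr rfl fun a _ => ?_
    rw [Finsupp.sum_single_index] <;> simp
  · intro i; simp
  · intro i a b; ring

lemma prod_cnt (c : Fin k → ℕ × PI F) (Q : ℝ) :
    ∏ i : Set.range c, wloc Q (pdeg F i.1.2) (Fintype.card {a // c a = i.1}) =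
    (cnt c).prod (fun i k => wloc Q (pdeg F i.2) k) := by
  have hs : (cnt c).support = (Set.range c).toFinset := by
    ext i
    rw [Finsupp.mem_support_iff, cnt_apply, Set.mem_toFinset, ← Nat.pos_iff_ne_zero, Fintype.card_pos_iff]
    constructor
    · rintro ⟨a, h⟩; exact ⟨a, h⟩
    · rintro ⟨a, h⟩; exact ⟨a, h⟩
  rw [Finsupp.prod, Finset.prod_subtype (p := fun x => x ∈ Set.range c) _ (fun x => by rw [hs, Set.mem_toFinset])]
  refine Finset.prod_congr rfl fun i _ => ?_
  rw [cnt_apply]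

lemma iso_of_cnt {c : Fin k → ℕ × PI F} {c' : Fin k' → ℕ × PI F} (h : cnt c = cnt c') :
    Nonempty (Md (ppF F K) c ≃ₗ[K[X]] Md (ppF F K) c') := by
  have h1 : ∀ i, Nonempty ({a // c a = i} ≃ {a // c' a = i}) := by
    intro i
    rw [← Fintype.card_eq, ← cnt_apply, ← cnt_apply, h]
  let e := fun i => (h1 i).some
  let E : Fin k ≃ Fin k' := (Equiv.sigmaFiberEquiv c).symm.trans
    ((Equiv.sigmaCongrRight e).trans (Equiv.sigmaFiberEquiv c'))
  have hE : ∀ a, c' (E a) = c a := fun a => (e (c a) ⟨a, rfl⟩).2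
  have hcE : c = c' ∘ E := by funext a; exact (hE a).symm
  clear_value E
  clear hE e h1 h
  subst hcE
  exact ⟨LinearEquiv.piCongrLeft K[X] (fun a => Lam (ppF F K) (c' a)) E⟩

lemma kap_nontriv (p : PI F) : Nontrivial (kap (ppF F K) p) := by
  rw [Ideal.Quotient.nontrivial_iff, Ne, Ideal.span_singleton_eq_top]
  intro h
  have := natDegree_eq_zero_of_isUnit h
  rw [ppF_deg] at this
  exact (pdeg_pos p).ne' this

lemma cnt_of_iso {c : Fin k → ℕ × PI F} {c' : Fin k' → ℕ × PI F}
    (e : Md (ppF F K) c ≃ₗ[K[X]] Md (ppF F K) c') : cnt c = cnt c' := by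
  ext i
  haveI := fun p : PI F => kap_nontriv (K := K) p
  rw [cnt_apply, cnt_apply]
  exact DD_card_eq ppF_cop ppF_ne e i

lemma card_Md (c : Fin k → ℕ × PI F) : Nat.card (Md (ppF F K) c) = Nat.card K ^ tdeg (pdeg F) (cnt c) := by
  rw [Nat.card_pi, tdeg_cnt, ← Finset.prod_pow_eq_pow_sum]
  refine Finset.prod_congr rfl fun a _ => ?_
  rw [(finite_quot _ (pow_ne_zero _ (ppF_ne _))).2, natDegree_pow, ppF_deg]

lemma sem_tdeg {c : Fin k → ℕ × PI F} (φ : Sem K n (Md (ppF F K) c)) : tdeg (pdeg F) (cnt c) = n := by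
  have h := Nat.card_congr φ.e.toEquiv
  rw [card_Md, Nat.card_fun, Nat.card_fin] at h
  exact (Nat.pow_right_injective (Finite.one_lt_card (α := K)) h).symm

lemma exists_sem {c : Fin k → ℕ × PI F} (h : tdeg (pdeg F) (cnt c) = n) :
    Nonempty (Sem K n (Md (ppF F K) c)) := by
  haveI : Module.Finite K (Md (ppF F K) c) := Module.Finite.of_finite
  have h1 : Module.finrank K (Md (ppF F K) c) = n := by
    haveI := Fintype.ofFinite K
    have := Module.natCard_eq_pow_finrank (K := K) (V := Md (ppF F K) c)
    rw [card_Md, h] at this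
    exact (Nat.pow_right_injective (Finite.one_lt_card (α := K)) this).symm
  have h2 : Module.finrank K (Fin n → K) = Module.finrank K (Md (ppF F K) c) := by
    rw [h1]; simp
  let e := LinearEquiv.ofFinrankEq _ _ h2
  refine ⟨⟨e.toAddEquiv, fun a v => ?_⟩⟩
  change e (a • v) = _ • e v
  rw [map_smul, ← Polynomial.algebraMap_eq, algebraMap_smul]

/-- transport of an adapted identification -/
lemma Ad.trans {V W : Type} [AddCommGroup V] [Module K[X] V] [AddCommGroup W] [Module K[X] W]
    {A : Matrix (Fin n) (Fin n) K} {φ : Sem K n V} (h : Ad A φ) (e : V ≃ₗ[K[X]] W) :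
    ∃ ψ : Sem K n W, Ad A ψ := by
  refine ⟨⟨φ.e.trans e.toAddEquiv, fun a v => ?_⟩, fun v => ?_⟩
  · change e (φ.e (a • v)) = _ • e (φ.e v)
    rw [φ.sm, map_smul]
  · change e (φ.e (A *ᵥ v)) = _ • e (φ.e v)
    rw [h, map_smul]

lemma Ad.iso {V W : Type} [AddCommGroup V] [Module K[X] V] [AddCommGroup W] [Module K[X] W]
    {A : Matrix (Fin n) (Fin n) K} {φ : Sem K n V} {ψ : Sem K n W} (h : Ad A φ) (h' : Ad A ψ) :
    Nonempty (V ≃ₗ[K[X]] W) := by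
  let g : V ≃+ W := φ.e.symm.trans ψ.e
  have hg : ∀ v, g v = ψ.e (φ.e.symm v) := fun v => rfl
  have hl : ∀ (f : K[X]) v, g (f • v) = f • g v := by
    refine poly_lin g.toAddMonoidHom ?_ ?_
    · intro a v
      change g _ = _ • g _
      rw [hg, hg, φ.symm_sm, ψ.sm]
    · intro v
      change g _ = _ • g _
      rw [hg, hg, h.symm, h']
  exact ⟨{ g with map_smul' := hl }⟩

/-- the number of matrices of given type -/
lemma fA_card [Finite F] {c : Fin k → ℕ × PI F} {A : Matrix (Fin n) (Fin n) K}
    {φ : Sem K n (Md (ppF F K) c)} (h : Ad A φ) :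
    (Nat.card (fA A) : ℝ) = Nat.card {r : Md (ppF F K) c →ₗ[K[X]] Md (ppF F K) c // Function.Bijective r} *
      (cnt c).prod (fun i k => wloc (Nat.card F) (pdeg F i.2) k) := by
  obtain ⟨J, hJ, hu, hJA, e1, e2⟩ := L2 (hb_isHF (K := K) c) h
  rw [count2 A J hJ hu hJA, e1, e2]
  have h3 : ∀ r : Md (ppF F K) c →ₗ[K[X]] Md (ppF F K) c,
      (∀ v w, hb K c (r v) w = hb K c v (r w)) ↔ r ∈ Tsa (F := F) (K := K) c := by
    intro r
    rw [mem_Tsa, (hb_isHF (K := K) c).sa_iff]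
  rw [← prod_cnt, ← local_global, mul_comm, Nat.cast_mul]
  let E : {r : Md (ppF F K) c →ₗ[K[X]] Md (ppF F K) c // ∀ v w, hb K c (r v) w = hb K c v (r w)} ≃
    Tsa (F := F) (K := K) c := Equiv.subtypeEquivRight h3
  have E2 := Nat.card_congr (Equiv.subtypeEquiv E (p := fun r => Function.Bijective r.1)
    (q := fun r => Function.Bijective r.1) (fun r => Iff.rfl))
  rw [Nat.card_congr E, E2]

theorem sum_fA [Fintype F] [Fintype (Matrix (Fin n) (Fin n) K)] :
    ∑ A : Matrix (Fin n) (Fin n) K, (Nat.card (fA A) : ℝ) =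
    Nat.card {g : Matrix (Fin n) (Fin n) K // IsUnit g} * partSum (Fintype.card F : ℝ) n := by
  classical
  obtain ⟨hfin, hsum⟩ := types_sum_F (F := F) Fintype.one_lt_card n
  haveI := Fintype.ofFinite {τ : ℕ × PI F →₀ ℕ // tdeg (pdeg F) τ = n}
  rw [← hsum, tsum_fintype]
  choose k c hc using cnt_surj (F := F)
  let S : {τ : ℕ × PI F →₀ ℕ // tdeg (pdeg F) τ = n} → Matrix (Fin n) (Fin n) K → Prop :=
    fun τ A => ∃ φ : Sem K n (Md (ppF F K) (c τ.1)), Ad A φ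
  have hU : ∀ A, ∀ τ τ', S τ A → S τ' A → τ = τ' := by
    rintro A τ τ' ⟨φ, h⟩ ⟨ψ, h'⟩
    obtain ⟨e⟩ := h.iso h'
    apply Subtype.ext
    rw [← hc τ.1, ← hc τ'.1]
    exact cnt_of_iso e
  have hE : ∀ A : Matrix (Fin n) (Fin n) K, Nat.card (fA A) ≠ 0 → ∃ τ, S τ A := by
    intro A hA
    obtain ⟨x⟩ := (Nat.card_ne_zero.1 hA).1
    obtain ⟨k', c', φ, h⟩ := L3 (F := F) x.2.1.1 x.2.1.2 x.2.2.1
    refine ⟨⟨cnt c', sem_tdeg φ⟩, ?_⟩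
    obtain ⟨e⟩ := iso_of_cnt (K := K) (c := c') (c' := c (cnt c')) (hc _).symm
    exact h.trans e
  have h1 : ∀ A : Matrix (Fin n) (Fin n) K, (Nat.card (fA A) : ℝ) =
      ∑ τ, if S τ A then (Nat.card (fA A) : ℝ) else 0 := by
    intro A
    by_cases hA : Nat.card (fA A) = 0
    · simp only [hA, Nat.cast_zero, ite_self, Finset.sum_const_zero]
    · obtain ⟨τ, hτ⟩ := hE A hA
      rw [Finset.sum_eq_single τ, if_pos hτ]
      · intro τ' _ hne
        rw [if_neg]
        intro h'
        exact hne (hU A _ _ h' hτ)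
      · simp
  rw [Finset.sum_congr rfl fun A _ => h1 A, Finset.sum_comm, Finset.mul_sum]
  refine Finset.sum_congr rfl fun τ _ => ?_
  have h2 : ∀ A : Matrix (Fin n) (Fin n) K, (if S τ A then (Nat.card (fA A) : ℝ) else 0) =
      if S τ A then Nat.card {r : Md (ppF F K) (c τ.1) →ₗ[K[X]] Md (ppF F K) (c τ.1) // Function.Bijective r} *
      (τ.1).prod (fun i k => wloc (Fintype.card F : ℝ) (pdeg F i.2) k) else 0 := by
    intro A
    split_ifs with h
    · obtain ⟨φ, h⟩ := h
      rw [fA_card h, hc, Nat.card_eq_fintype_card (α := F)]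
    · rfl
  rw [Finset.sum_congr rfl fun A _ => h2 A, ← Finset.sum_filter, Finset.sum_const, nsmul_eq_mul, ← mul_assoc]
  congr 1
  obtain ⟨φ₀⟩ := exists_sem (K := K) (n := n) (c := c τ.1) (by rw [hc]; exact τ.2)
  rw [← orbit_count φ₀, Nat.cast_mul]
  congr 2
  rw [Nat.card_eq_fintype_card, Fintype.card_subtype]

theorem CP_card [Fintype F] (hN : ∀ a : K, star a = a → a ≠ 0 → ∃ b, b * star b = a)
    (hs : ∃ x : K, star x ≠ x) (n : ℕ) :
    (Nat.card (CP K n) : ℝ) = (Fintype.card F : ℝ) ^ (n ^ 2) * poch (Fintype.card F : ℝ) n *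
      partSum (Fintype.card F : ℝ) n := by
  haveI := Fintype.ofFinite (Matrix (Fin n) (Fin n) K)
  have ht := trans_all hs hN n
  have h1 := count1 ht
  have h2 := sum_fA (F := F) (K := K) (n := n)
  have h3 : (Nat.card (CP K n) : ℝ) * Nat.card (HU K (Fin n)) =
    ∑ A : Matrix (Fin n) (Fin n) K, (Nat.card (fA A) : ℝ) := by exact_mod_cast h1
  have h5 : Nat.card {a : K // star a = a} = Fintype.card F := by
    rw [← Nat.card_eq_fintype_card]
    refine (Nat.card_congr (Equiv.ofBijective (fun x : F => (⟨algebraMap F K x,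
      (HermPair.fix (F := F) _).2 ⟨x, rfl⟩⟩ : {a : K // star a = a})) ⟨?_, ?_⟩)).symm
    · intro x y h
      exact (algebraMap F K).injective (congrArg Subtype.val h)
    · rintro ⟨a, ha⟩
      obtain ⟨x, rfl⟩ := (HermPair.fix (F := F) _).1 ha
      exact ⟨x, rfl⟩
  have h4 := GL_HU (κ := K) (Q := Fintype.card F) (by rw [← Nat.card_eq_fintype_card]; exact card_K F K) h5 n
  have h6 : (Nat.card (HU K (Fin n)) : ℝ) ≠ 0 := by
    rw [Nat.cast_ne_zero]
    haveI : Nonempty (HU K (Fin n)) := ⟨⟨1, Matrix.isHermitian_one, isUnit_one⟩⟩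
    exact Nat.card_pos.ne'
  apply mul_right_cancel₀ h6
  rw [h3, h2, h4]
  ring
end typ
end FFU

end file_P6c

section file_P6d
open Finset Polynomial Matrix
namespace FFU
set_option linter.unusedSectionVars false
set_option linter.unusedVariables false
set_option linter.style.haveILetI false

section fin
variable {K : Type} [Field K] [Fintype K] {q : ℕ}

lemma exists_gen (hK : Fintype.card K = q ^ 2) :
    ∃ g : Kˣ, orderOf g = q ^ 2 - 1 ∧ ∀ a : Kˣ, ∃ k : ℕ, g ^ k = a := by
  classical
  obtain ⟨g, hg⟩ := IsCyclic.exists_generator (α := Kˣ)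
  refine ⟨g, ?_, fun a => ?_⟩
  · rw [orderOf_eq_card_of_forall_mem_zpowers hg, Nat.card_eq_fintype_card, Fintype.card_units, hK]
  · have := hg a
    rw [← mem_powers_iff_mem_zpowers] at this
    exact this

lemma exists_ne (h2 : 2 ≤ q) (hK : Fintype.card K = q ^ 2) : ∃ x : K, x ^ q ≠ x := by
  obtain ⟨g, hg, -⟩ := exists_gen hK
  refine ⟨g, fun h => ?_⟩
  have h1 : g ^ (q - 1) = 1 := by
    have h3 : g ^ q = g := by ext; push_cast; exact h
    apply mul_right_cancel (b := g)
    rw [← pow_succ, one_mul, Nat.sub_add_cancel (by omega), h3]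
  have h4 := orderOf_dvd_of_pow_eq_one h1
  rw [hg] at h4
  have := Nat.le_of_dvd (by omega) h4
  have : q * 2 ≤ q ^ 2 := by rw [sq]; exact Nat.mul_le_mul_left _ h2
  omega

lemma norm_surj (h2 : 2 ≤ q) (hK : Fintype.card K = q ^ 2) (a : K) (ha : a ^ q = a) (h0 : a ≠ 0) :
    ∃ b : K, b * b ^ q = a := by
  obtain ⟨g, hg, hs⟩ := exists_gen hK
  obtain ⟨k, hk⟩ := hs (Units.mk0 a h0)
  have h3 : (Units.mk0 a h0) ^ (q - 1) = 1 := by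
    have h3 : (Units.mk0 a h0) ^ q = Units.mk0 a h0 := by ext; push_cast; exact ha
    apply mul_right_cancel (b := Units.mk0 a h0)
    rw [← pow_succ, one_mul, Nat.sub_add_cancel (by omega), h3]
  rw [← hk, ← pow_mul] at h3
  have h4 := orderOf_dvd_of_pow_eq_one h3
  have h5 : q ^ 2 - 1 = (q + 1) * (q - 1) := by
    obtain ⟨r, rfl⟩ : ∃ r, q = r + 1 := ⟨q - 1, by omega⟩
    simp only [Nat.add_sub_cancel]
    have : (r + 1) ^ 2 = (r + 1 + 1) * r + 1 := by ring
    omega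
  rw [hg, h5] at h4
  obtain ⟨l, hl⟩ := Nat.dvd_of_mul_dvd_mul_right (by omega) h4
  refine ⟨(g ^ l : Kˣ), ?_⟩
  have : a = ((g ^ k : Kˣ) : K) := by rw [hk]; rfl
  rw [this, hl]
  push_cast
  ring

/-- the involution `x ↦ x ^ q` -/
noncomputable abbrev frobStar {p m : ℕ} (hp : p.Prime) (hq : q = p ^ m) (hK : Fintype.card K = q ^ 2) : StarRing K where
  star x := x ^ q
  star_involutive x := by
    change (x ^ q) ^ q = x
    rw [← pow_mul, ← sq, ← hK, FiniteField.pow_card]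
  star_mul x y := by rw [mul_pow, mul_comm]
  star_add x y := by
    haveI := Fact.mk hp
    haveI : CharP K p := charP_of_card_eq_prime_pow (f := m * 2) (by
      rw [hK, hq, pow_mul])
    subst hq
    exact add_pow_char_pow _ _ _ _

theorem U_card {p m : ℕ} (hp : p.Prime) (hm : 0 < m) (hq : q = p ^ m) (hK : Fintype.card K = q ^ 2) (n : ℕ) :
    (Nat.card {P : Matrix (Fin n) (Fin n) K × Matrix (Fin n) (Fin n) K //
      (P.1.map (fun a => a ^ q))ᵀ = -P.1 ∧ (P.2.map (fun a => a ^ q))ᵀ = -P.2 ∧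
      P.1 * P.2 = P.2 * P.1} : ℝ) = (q : ℝ) ^ (n ^ 2) * poch (q : ℝ) n * partSum (q : ℝ) n := by
  have h2 : 2 ≤ q := by
    rw [hq]; exact hp.two_le.trans (Nat.le_self_pow hm.ne' p)
  letI : StarRing K := frobStar hp hq hK
  have hst : ∀ x : K, star x = x ^ q := fun x => rfl
  let S : Subfield K :=
    { carrier := {x | star x = x}
      mul_mem' := fun {a b} ha hb => by
        change star (a * b) = a * b
        rw [star_mul', show star a = a from ha, show star b = b from hb]
      one_mem' := star_one K
      add_mem' := fun {a b} ha hb => by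
        change star (a + b) = a + b
        rw [star_add, show star a = a from ha, show star b = b from hb]
      zero_mem' := star_zero K
      neg_mem' := fun {a} ha => by
        change star (-a) = -a
        rw [star_neg, show star a = a from ha]
      inv_mem' := fun a ha => by
        change star (a⁻¹) = a⁻¹
        rw [star_inv₀, show star a = a from ha] }
  have hne : ∃ x : K, star x ≠ x := exists_ne h2 hK
  haveI : HermPair S K :=
    { fix := fun x => by
        constructor
        · intro h; exact ⟨⟨x, h⟩, rfl⟩
        · rintro ⟨y, rfl⟩; exact y.2
      ne := hne }
  haveI : Fintype S := Fintype.ofFinite S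
  have hS : Fintype.card S = q := by
    have := card_K S K
    rw [Nat.card_eq_fintype_card, Nat.card_eq_fintype_card, hK] at this
    exact (Nat.pow_left_injective (n := 2) two_ne_zero this).symm
  have key := CP_card (F := S) (K := K) (fun a ha h0 => norm_surj h2 hK a ha h0) hne n
  rw [hS] at key
  rw [← key]
  congr 1
  obtain ⟨x, hx⟩ := hne
  let w := x - star x
  have hw : w ≠ 0 := sub_ne_zero.2 hx.symm
  have hws : star w = -w := by simp only [w]; rw [star_sub, star_star]; ring
  have hA : ∀ A : Matrix (Fin n) (Fin n) K, (A.map (fun a => a ^ q))ᵀ = Aᴴ := fun A => rfl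
  have hB : ∀ A : Matrix (Fin n) (Fin n) K, (A.map (fun a => a ^ q))ᵀ = -A ↔ (w • A).IsHermitian := by
    intro A
    rw [hA, Matrix.IsHermitian, Matrix.conjTranspose_smul, hws, neg_smul, ← smul_neg]
    rw [(smul_right_injective _ hw).eq_iff, neg_eq_iff_eq_neg]
  let e : Matrix (Fin n) (Fin n) K ≃ Matrix (Fin n) (Fin n) K := MulAction.toPerm (Units.mk0 w hw)
  have he : ∀ A, e A = w • A := fun A => rfl
  refine Nat.card_congr (Equiv.subtypeEquiv (e.prodCongr e) ?_)
  rintro ⟨A, B⟩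
  simp only [Equiv.prodCongr_apply, Prod.map, he, hB]
  rw [Matrix.smul_mul, Matrix.mul_smul, Matrix.smul_mul, Matrix.mul_smul, (smul_right_injective _ hw).eq_iff,
    (smul_right_injective _ hw).eq_iff]

end fin
end FFU

end file_P6d

theorem feit_fine_unitary_asymptotics
    (q : ℕ) (hq : ∃ p m : ℕ, p.Prime ∧ 0 < m ∧ q = p ^ m)
    (K : Type) [Field K] [Fintype K] (hK : Fintype.card K = q ^ 2) :
    Multipliable (fun j : ℕ => (1 - (q : ℝ) ^ (-(2 * j + 1 : ℤ)))⁻¹) ∧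
    Multipliable (fun j : ℕ =>
      ((1 - (q : ℝ) ^ (-(2 * j + 2 : ℤ)))⁻¹) ^ ((2 * j + 2) / 4)) ∧
    Filter.Tendsto
      (fun n : ℕ => (guCommPairs q K n : ℝ) / (q : ℝ) ^ (n ^ 2 + n))
      Filter.atTop
      (nhds ((∏' j : ℕ, (1 - (q : ℝ) ^ (-(2 * j + 1 : ℤ)))⁻¹) *
        ∏' j : ℕ, ((1 - (q : ℝ) ^ (-(2 * j + 2 : ℤ)))⁻¹) ^ ((2 * j + 2) / 4))) := by
  obtain ⟨p, m, hp, hm, hq⟩ := hq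
  have h2 : (2 : ℝ) ≤ (q : ℝ) := by
    have : 2 ≤ q := by
      rw [hq]; exact hp.two_le.trans (Nat.le_self_pow hm.ne' p)
    exact_mod_cast this
  refine ⟨FFU.first_multipliable h2, FFU.second_multipliable h2, ?_⟩
  refine (FFU.partSum_tendsto h2).congr fun n => ?_
  have h := FFU.U_card (n := n) hp hm hq hK
  have hq0 : (q : ℝ) ≠ 0 := by linarith
  rw [guCommPairs, h, pow_add]
  field_simp
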